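/- There exists a unique classical solution v = (v^{I,i})_{i∈[N], I⊆[N]} of the cascade of moving-boundary PDEs. Moreover, this solution is nonincreasing, and for all I ⊆ [N] and i ∈ I it satisfies 0 ≤ v^{I,i}_t(x) ≤ 1 for all (t,x) ∈ [0,T]×ℝ^I. -/

import Mathlib

open Set Filter
open scoped Topology

variable (N : ℕ) (T σ : ℝ) (D : Fin N → Fin N → ℝ)

/-- The boundary level `Σ_j D_{ij} v^{I∖i,j}_t(x^{−i})` felt by particle `i` in configuration `I`.
Functions `v^{I,i} : [0,T]×ℝ^I → ℝ` are represented as functions on `ℝ × (Fin N → ℝ)` that only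
depend on the coordinates in `I`. -/
def bdrySum (v : Finset (Fin N) → Fin N → ℝ → (Fin N → ℝ) → ℝ) (I : Finset (Fin N))
    (i : Fin N) (t : ℝ) (x : Fin N → ℝ) : ℝ :=
  ∑ j, D i j * v (I.erase i) j t x

/-- The domain `𝒟^I_T v` where all particles of the configuration `I` are alive. -/
def domT (v : Finset (Fin N) → Fin N → ℝ → (Fin N → ℝ) → ℝ) (I : Finset (Fin N)) :
    Set (ℝ × (Fin N → ℝ)) :=
  {p | p.1 ∈ Set.Icc 0 T ∧ ∀ i ∈ I, bdrySum N D v I i p.1 p.2 < p.2 i}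

/-- The domain `𝒟^I v = 𝒟^I_T v ∖ ({T}×ℝ^I)`. -/
def dom (v : Finset (Fin N) → Fin N → ℝ → (Fin N → ℝ) → ℝ) (I : Finset (Fin N)) :
    Set (ℝ × (Fin N → ℝ)) :=
  domT N T D v I ∩ {p | p.1 < T}

/-- The index set `ℐ^I v(t,x)` of killed particles. -/
noncomputable def killedSet (v : Finset (Fin N) → Fin N → ℝ → (Fin N → ℝ) → ℝ)
    (I : Finset (Fin N)) (t : ℝ) (x : Fin N → ℝ) : Finset (Fin N) :=
  I.filter fun i => x i ≤ bdrySum N D v I i t x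

/-- The boundary function `ℱ^I_i v(t,x) = v^{I∖i₀,i}_t(x^{−i₀})`, where `i₀` is the minimal
index of `ℐ^I v(t,x)` (junk value `v^{I,i}_t(x)` if no particle is killed). -/
noncomputable def bdryFun (v : Finset (Fin N) → Fin N → ℝ → (Fin N → ℝ) → ℝ)
    (I : Finset (Fin N)) (i : Fin N) (t : ℝ) (x : Fin N → ℝ) : ℝ :=
  if h : (killedSet N D v I t x).Nonempty
  then v (I.erase ((killedSet N D v I t x).min' h)) i t x
  else v I i t x

/-- `f` is `C^{1,2}` on `U` (with spatial variables ranging over the coordinates of `I`)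
and solves the backward heat equation `∂_t f + (σ²/2) Δ f = 0` there. -/
def SolvesHeatOn (I : Finset (Fin N)) (f : ℝ → (Fin N → ℝ) → ℝ)
    (U : Set (ℝ × (Fin N → ℝ))) : Prop :=
  ∃ (ft : ℝ → (Fin N → ℝ) → ℝ) (fx fxx : ℝ → (Fin N → ℝ) → Fin N → ℝ),
    (∀ p ∈ U, HasDerivWithinAt (fun s => f s p.2) (ft p.1 p.2) (Set.Icc 0 T) p.1) ∧
    (∀ p ∈ U, ∀ j ∈ I,
      HasDerivAt (fun y => f p.1 (Function.update p.2 j y)) (fx p.1 p.2 j) (p.2 j)) ∧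
    (∀ p ∈ U, ∀ j ∈ I,
      HasDerivAt (fun y => fx p.1 (Function.update p.2 j y) j) (fxx p.1 p.2 j) (p.2 j)) ∧
    ContinuousOn (fun p : ℝ × (Fin N → ℝ) => ft p.1 p.2) U ∧
    (∀ j ∈ I, ContinuousOn (fun p : ℝ × (Fin N → ℝ) => fx p.1 p.2 j) U) ∧
    (∀ j ∈ I, ContinuousOn (fun p : ℝ × (Fin N → ℝ) => fxx p.1 p.2 j) U) ∧
    (∀ p ∈ U, ft p.1 p.2 + σ ^ 2 / 2 * ∑ j ∈ I, fxx p.1 p.2 j = 0)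

/-- `v` is a classical solution of the cascade of moving boundary PDEs. -/
def IsClassicalSolution (v : Finset (Fin N) → Fin N → ℝ → (Fin N → ℝ) → ℝ) : Prop :=
  ∀ I : Finset (Fin N),
    (∀ i : Fin N, ∀ t ∈ Set.Icc (0 : ℝ) T, ∀ x y : Fin N → ℝ,
      (∀ j ∈ I, x j = y j) → v I i t x = v I i t y) ∧
    (∀ i ∉ I, ∀ t ∈ Set.Icc (0 : ℝ) T, ∀ x : Fin N → ℝ, v I i t x = 1) ∧
    ∀ i ∈ I,
      (∃ U : Set (ℝ × (Fin N → ℝ)), IsOpen U ∧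
        dom N T D v I = U ∩ {p : ℝ × (Fin N → ℝ) | p.1 ∈ Set.Ico 0 T}) ∧
      SolvesHeatOn N T σ I (v I i) (dom N T D v I) ∧
      (∃ C : ℝ, ∀ t ∈ Set.Ico (0 : ℝ) T, ∀ x : Fin N → ℝ, |v I i t x| ≤ C) ∧
      ContinuousOn (fun p : ℝ × (Fin N → ℝ) => v I i p.1 p.2)
        {p : ℝ × (Fin N → ℝ) | p.1 ∈ Set.Ico 0 T} ∧
      (∀ t ∈ Set.Icc (0 : ℝ) T, ∀ x : Fin N → ℝ, (t, x) ∉ domT N T D v I →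
        v I i t x = bdryFun N D v I i t x) ∧
      (∀ x : Fin N → ℝ, (T, x) ∈ domT N T D v I → v I i T x = 0) ∧
      (∀ K : Set (Fin N → ℝ), IsCompact K → ({T} ×ˢ K ⊆ domT N T D v I) →
        Tendsto (fun t => sSup ((fun x => |v I i t x - v I i T x|) '' K)) (𝓝[<] T) (𝓝 0))

/-- A classical solution is nonincreasing if it is jointly nonincreasing in time and
(componentwise, over the coordinates of `I`) in space. -/
def IsNonincreasingSol (v : Finset (Fin N) → Fin N → ℝ → (Fin N → ℝ) → ℝ) : Prop :=
  ∀ I : Finset (Fin N), ∀ i ∈ I, ∀ s t : ℝ, ∀ x y : Fin N → ℝ,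
    s ∈ Set.Icc (0 : ℝ) T → t ∈ Set.Icc (0 : ℝ) T → s ≤ t → (∀ j ∈ I, y j ≤ x j) →
    v I i t x ≤ v I i s y

open Set Filter
open scoped Topology

namespace Casc
open MeasureTheory ProbabilityTheory

/-- standard Gaussian measure on `ℝ^d` -/
noncomputable def gam (d : ℕ) : Measure (Fin d → ℝ) := Measure.pi fun _ => gaussianReal 0 1

instance instProbGam (d : ℕ) : IsProbabilityMeasure (gam d) := by
  unfold gam; infer_instance

/-- heat semigroup -/
noncomputable def P {d : ℕ} (σ h : ℝ) (f : (Fin d → ℝ) → ℝ) (x : Fin d → ℝ) : ℝ :=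
  ∫ z, f (x + (σ * √h) • z) ∂gam d

/-- bounded measurable function -/
def BM {d : ℕ} (f : (Fin d → ℝ) → ℝ) : Prop := Measurable f ∧ ∃ C, ∀ x, |f x| ≤ C

theorem BM.integrable_comp {d : ℕ} {f : (Fin d → ℝ) → ℝ} (hf : BM f) (x : Fin d → ℝ) (c : ℝ) :
    Integrable (fun z => f (x + c • z)) (gam d) := by
  obtain ⟨hm, C, hC⟩ := hf
  refine Integrable.of_bound (C := C) ?_ (Eventually.of_forall fun z => ?_)
  · exact (hm.comp (by fun_prop)).aestronglyMeasurable
  · simpa using hC _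

theorem BM.of_mem_Icc {d : ℕ} {f : (Fin d → ℝ) → ℝ} (hm : Measurable f)
    (h : ∀ x, f x ∈ Icc (0:ℝ) 1) : BM f :=
  ⟨hm, 1, fun x => abs_le.2 ⟨by linarith [(h x).1], (h x).2⟩⟩

theorem P_mono {d : ℕ} {σ h : ℝ} {f g : (Fin d → ℝ) → ℝ} (hf : BM f) (hg : BM g)
    (hfg : ∀ x, f x ≤ g x) (x : Fin d → ℝ) : P σ h f x ≤ P σ h g x :=
  integral_mono (hf.integrable_comp _ _) (hg.integrable_comp _ _) fun _ => hfg _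

theorem P_const {d : ℕ} {σ h c : ℝ} (x : Fin d → ℝ) : P σ h (fun _ => c) x = c := by
  simp [P]

theorem P_zero_time {d : ℕ} {σ : ℝ} (f : (Fin d → ℝ) → ℝ) : P σ 0 f = f := by
  funext x; simp [P]

theorem P_add {d : ℕ} {σ h : ℝ} {f g : (Fin d → ℝ) → ℝ} (hf : BM f) (hg : BM g)
    (x : Fin d → ℝ) : P σ h (fun y => f y + g y) x = P σ h f x + P σ h g x :=
  integral_add (hf.integrable_comp _ _) (hg.integrable_comp _ _)

theorem P_sub {d : ℕ} {σ h : ℝ} {f g : (Fin d → ℝ) → ℝ} (hf : BM f) (hg : BM g)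
    (x : Fin d → ℝ) : P σ h (fun y => f y - g y) x = P σ h f x - P σ h g x :=
  integral_sub (hf.integrable_comp _ _) (hg.integrable_comp _ _)

theorem P_bound {d : ℕ} {σ h C : ℝ} {f : (Fin d → ℝ) → ℝ} (hC : ∀ x, |f x| ≤ C)
    (x : Fin d → ℝ) : |P σ h f x| ≤ C := by
  have := norm_integral_le_of_norm_le_const (μ := gam d) (f := fun z => f (x + (σ * √h) • z))
    (C := C) (Eventually.of_forall fun z => hC _)
  simpa [P] using this

theorem P_measurable_joint {d : ℕ} {σ : ℝ} {f : (Fin d → ℝ) → ℝ} (hf : Measurable f) :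
    Measurable (fun p : ℝ × (Fin d → ℝ) => P σ p.1 f p.2) := by
  have : Measurable (fun q : (ℝ × (Fin d → ℝ)) × (Fin d → ℝ) =>
      f (q.1.2 + (σ * √q.1.1) • q.2)) := by
    apply hf.comp; fun_prop
  exact (this.stronglyMeasurable.integral_prod_right (ν := gam d)).measurable

theorem P_measurable {d : ℕ} {σ h : ℝ} {f : (Fin d → ℝ) → ℝ} (hf : Measurable f) :
    Measurable (P σ h f) :=
  (P_measurable_joint (σ := σ) hf).comp (measurable_const.prodMk measurable_id : Measurable fun x => (h, x))

theorem BM.P {d : ℕ} {σ h : ℝ} {f : (Fin d → ℝ) → ℝ} (hf : BM f) : BM (P σ h f) :=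
  ⟨P_measurable hf.1, hf.2.imp fun _ hC => P_bound hC⟩

theorem P_mem_Icc {d : ℕ} {σ h : ℝ} {f : (Fin d → ℝ) → ℝ} (hm : Measurable f)
    (hf : ∀ x, f x ∈ Icc (0:ℝ) 1) (x : Fin d → ℝ) : P σ h f x ∈ Icc (0:ℝ) 1 := by
  constructor
  · exact integral_nonneg fun z => (hf _).1
  · have := P_mono (σ := σ) (h := h) (BM.of_mem_Icc hm hf) (g := fun _ => 1)
      ⟨measurable_const, 1, by simp⟩ (fun x => (hf x).2) x
    simpa [P_const] using this

theorem P_antitone {d : ℕ} {σ h : ℝ} {f : (Fin d → ℝ) → ℝ} (hf : BM f)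
    (ha : ∀ x y, x ≤ y → f y ≤ f x) {x y : Fin d → ℝ} (hxy : x ≤ y) :
    P σ h f y ≤ P σ h f x :=
  integral_mono (hf.integrable_comp _ _) (hf.integrable_comp _ _) fun z =>
    ha _ _ (by simpa using hxy)

theorem P_tendsto {d : ℕ} {σ h : ℝ} {f : ℕ → (Fin d → ℝ) → ℝ} {g : (Fin d → ℝ) → ℝ}
    (hm : ∀ n, Measurable (f n)) {C : ℝ} (hC : ∀ n x, |f n x| ≤ C)
    (hlim : ∀ x, Tendsto (fun n => f n x) atTop (𝓝 (g x))) (x : Fin d → ℝ) :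
    Tendsto (fun n => P σ h (f n) x) atTop (𝓝 (P σ h g x)) := by
  refine tendsto_integral_of_dominated_convergence (fun _ => C) ?_ (integrable_const C) ?_ ?_
  · intro n; exact ((hm n).comp (by fun_prop)).aestronglyMeasurable
  · intro n; exact Eventually.of_forall fun z => hC n _
  · exact Eventually.of_forall fun z => hlim _

/-- law with variance `v` -/
noncomputable def gamv (d : ℕ) (v : NNReal) : Measure (Fin d → ℝ) :=
  Measure.pi fun _ => gaussianReal 0 v

instance instProbGamv (d : ℕ) (v : NNReal) : IsProbabilityMeasure (gamv d v) := by
  unfold gamv; infer_instance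

theorem gam_map_smul (d : ℕ) (c : ℝ) :
    (gam d).map (fun z => c • z) = gamv d (NNReal.mk (c ^ 2) (sq_nonneg c)) := by
  unfold gam gamv
  have := Measure.pi_map_pi (μ := fun _ : Fin d => gaussianReal 0 1)
    (f := fun _ x => c * x) (fun i => by fun_prop)
  simp only [gaussianReal_map_const_mul] at this
  have h2 : (fun z : Fin d → ℝ => c • z) = fun z i => c * z i := by
    funext z i; simp
  rw [h2, this]
  simp

theorem gamv_conv (d : ℕ) (v w : NNReal) : gamv d v ∗ gamv d w = gamv d (v + w) := by
  refine Measure.ext_of_charFunDual ?_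
  ext L
  rw [charFunDual_conv]
  unfold gamv
  rw [charFunDual_pi, charFunDual_pi, charFunDual_pi, ← Finset.prod_mul_distrib]
  refine Finset.prod_congr rfl fun i _ => ?_
  rw [← charFunDual_conv, gaussianReal_conv_gaussianReal, add_zero]

theorem P_eq_gamv {d : ℕ} {σ h : ℝ} {f : (Fin d → ℝ) → ℝ} (hf : Measurable f) (x : Fin d → ℝ) :
    P σ h f x = ∫ y, f (x + y) ∂gamv d (NNReal.mk ((σ * √h) ^ 2) (sq_nonneg _)) := by
  rw [← gam_map_smul, integral_map (by fun_prop)]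
  · rfl
  · exact (hf.comp (by fun_prop)).aestronglyMeasurable

theorem P_semigroup {d : ℕ} {σ h k : ℝ} (hh : 0 ≤ h) (hk : 0 ≤ k) {f : (Fin d → ℝ) → ℝ}
    (hf : BM f) (x : Fin d → ℝ) : P σ h (P σ k f) x = P σ (h + k) f x := by
  rw [P_eq_gamv (P_measurable hf.1), P_eq_gamv hf.1]
  have hv : NNReal.mk ((σ * √(h + k)) ^ 2) (sq_nonneg _) =
      (NNReal.mk ((σ * √h) ^ 2) (sq_nonneg _)) + (NNReal.mk ((σ * √k) ^ 2) (sq_nonneg _)) := by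
    apply NNReal.eq
    change (σ * √(h + k)) ^ 2 = (σ * √h) ^ 2 + (σ * √k) ^ 2
    rw [mul_pow, mul_pow, mul_pow, Real.sq_sqrt (by linarith), Real.sq_sqrt hh, Real.sq_sqrt hk]
    ring
  rw [hv, ← gamv_conv, Measure.conv, integral_map (by fun_prop), integral_prod]
  · refine integral_congr_ae (Eventually.of_forall fun y => ?_)
    simp only
    rw [P_eq_gamv hf.1]
    simp [add_assoc]
  · obtain ⟨hm, C, hC⟩ := hf
    refine Integrable.of_bound (C := C) ?_ (Eventually.of_forall fun z => ?_)
    · exact (hm.comp (by fun_prop)).aestronglyMeasurable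
    · simpa using hC _
  · exact (hf.1.comp (by fun_prop)).aestronglyMeasurable

end Casc

open Set Filter
open scoped Topology

namespace Casc
open MeasureTheory ProbabilityTheory

theorem gam_eval (d : ℕ) (i : Fin d) :
    MeasurePreserving (fun z : Fin d → ℝ => z i) (gam d) (gaussianReal 0 1) :=
  measurePreserving_eval (fun _ : Fin d => gaussianReal 0 1) i

theorem gam_integrable_coord (d : ℕ) (i : Fin d) : Integrable (fun z : Fin d → ℝ => z i) (gam d) :=
  (gam_eval d i).integrable_comp_of_integrable
    (memLp_one_iff_integrable.1 (memLp_id_gaussianReal (μ := 0) (v := 1) 1))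

theorem gam_integrable_sq (d : ℕ) (i : Fin d) :
    Integrable (fun z : Fin d → ℝ => z i ^ 2) (gam d) :=
  (gam_eval d i).integrable_comp_of_integrable (g := fun x : ℝ => x ^ 2)
    (memLp_id_gaussianReal (μ := 0) (v := 1) 2).integrable_sq

theorem gam_integral_coord (d : ℕ) (i : Fin d) : ∫ z, z i ∂gam d = 0 := by
  have h := integral_map (μ := gam d) (φ := fun z : Fin d → ℝ => z i) (f := fun x : ℝ => x)
    (gam_eval d i).measurable.aemeasurable (by fun_prop)
  rw [(gam_eval d i).map_eq] at h
  rw [← h]; exact integral_id_gaussianReal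

theorem gam_integral_sq (d : ℕ) (i : Fin d) : ∫ z, z i ^ 2 ∂gam d = 1 := by
  have h := integral_map (μ := gam d) (φ := fun z : Fin d → ℝ => z i) (f := fun x : ℝ => x ^ 2)
    (gam_eval d i).measurable.aemeasurable (by fun_prop)
  rw [(gam_eval d i).map_eq] at h
  rw [← h]
  have h2 := variance_fun_id_gaussianReal (μ := 0) (v := 1)
  rw [variance_of_integral_eq_zero (by fun_prop) integral_id_gaussianReal] at h2
  simpa using h2

theorem P_quad {d : ℕ} {σ h : ℝ} (hh : 0 ≤ h) {f : (Fin d → ℝ) → ℝ} (hf : BM f) {c b : ℝ}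
    (x0 : Fin d → ℝ) (hle : ∀ y, f y ≤ c * ∑ i, (y i - x0 i) ^ 2 + b) (x : Fin d → ℝ) :
    P σ h f x ≤ c * (∑ i, (x i - x0 i) ^ 2 + d * σ ^ 2 * h) + b := by
  set s := σ * √h with hs
  have hs2 : s ^ 2 = σ ^ 2 * h := by rw [hs, mul_pow, Real.sq_sqrt hh]
  have e : ∀ i, (fun z : Fin d → ℝ => ((x + s • z) i - x0 i) ^ 2) =
      fun z => ((x i - x0 i) ^ 2 + (2 * (x i - x0 i) * s) * z i) + s ^ 2 * z i ^ 2 := by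
    intro i; funext z; simp only [Pi.add_apply, Pi.smul_apply, smul_eq_mul]; ring
  have hi1 : ∀ i : Fin d, Integrable (fun z : Fin d → ℝ =>
      ((x i - x0 i) ^ 2 + (2 * (x i - x0 i) * s) * z i)) (gam d) := fun i =>
    (integrable_const _).add ((gam_integrable_coord d i).const_mul _)
  have hi2 : ∀ i : Fin d, Integrable (fun z : Fin d → ℝ => s ^ 2 * z i ^ 2) (gam d) := fun i =>
    (gam_integrable_sq d i).const_mul _
  have hintg : ∀ i, Integrable (fun z : Fin d → ℝ => ((x + s • z) i - x0 i) ^ 2) (gam d) := by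
    intro i; rw [e]; exact (hi1 i).add (hi2 i)
  have hval : ∀ i, ∫ z, ((x + s • z) i - x0 i) ^ 2 ∂gam d = (x i - x0 i) ^ 2 + s ^ 2 := by
    intro i
    rw [e, integral_add (hi1 i) (hi2 i),
      integral_add (integrable_const _) ((gam_integrable_coord d i).const_mul _),
      integral_const_mul, integral_const_mul, gam_integral_coord, gam_integral_sq]
    simp
  have hsum : Integrable (fun z : Fin d → ℝ => ∑ i, ((x + s • z) i - x0 i) ^ 2) (gam d) :=
    integrable_finsetSum _ fun i _ => hintg i
  calc P σ h f x ≤ ∫ z, (c * ∑ i, ((x + s • z) i - x0 i) ^ 2 + b) ∂gam d :=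
        integral_mono (hf.integrable_comp _ _) ((hsum.const_mul c).add (integrable_const b))
          fun z => hle _
    _ = c * (∑ i, (x i - x0 i) ^ 2 + d * σ ^ 2 * h) + b := by
        rw [integral_add (hsum.const_mul c) (integrable_const b), integral_const_mul,
          integral_finsetSum _ fun i _ => hintg i]
        simp only [hval, Finset.sum_add_distrib, hs2]
        simp only [Finset.sum_const, Finset.card_univ, Fintype.card_fin, nsmul_eq_mul, integral_const,
          probReal_univ, one_smul, smul_eq_mul, one_mul]
        ring

theorem gam_orthant_pos (d : ℕ) (c : ℝ) : 0 < (gam d).real {z | ∀ i, z i ≤ c} := by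
  have e : {z : Fin d → ℝ | ∀ i, z i ≤ c} = Set.pi univ fun _ => Iic c := by
    ext z; simp only [Set.mem_pi, mem_univ, true_imp_iff, mem_Iic, mem_setOf_eq]
  have hp : gam d {z | ∀ i, z i ≤ c} ≠ 0 := by
    rw [e, gam, Measure.pi_pi]
    refine Finset.prod_ne_zero_iff.2 fun i _ => ?_
    intro h0
    have := gaussianReal_absolutelyContinuous' 0 (v := 1) one_ne_zero h0
    simp at this
  exact ENNReal.toReal_pos hp (measure_ne_top _ _)

theorem gam_orthant_tendsto (d : ℕ) :
    Tendsto (fun R : ℝ => (gam d).real {z | ∀ i, z i ≤ R}) atTop (𝓝 1) := by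
  have hm : Monotone fun R : ℝ => {z : Fin d → ℝ | ∀ i, z i ≤ R} :=
    fun a b hab z hz i => (hz i).trans hab
  have := tendsto_measure_iUnion_atTop (μ := gam d) hm
  have hu : (⋃ R : ℝ, {z : Fin d → ℝ | ∀ i, z i ≤ R}) = univ := by
    ext z
    simp only [mem_iUnion, mem_setOf_eq, mem_univ, iff_true]
    exact ⟨∑ i, |z i|, fun i => (le_abs_self _).trans
      (Finset.single_le_sum (f := fun i => |z i|) (fun _ _ => abs_nonneg _) (Finset.mem_univ i))⟩
  rw [hu, measure_univ] at this
  have h2 := (ENNReal.tendsto_toReal ENNReal.one_ne_top).comp this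
  simpa [Measure.real, Function.comp_def] using h2

theorem gamv_withDensity (d : ℕ) {v : NNReal} (hv : v ≠ 0) :
    gamv d v = (volume : Measure (Fin d → ℝ)).withDensity
      (fun z => ENNReal.ofReal (∏ i, gaussianPDFReal 0 v (z i))) := by
  unfold gamv
  refine Measure.pi_eq fun s hs => ?_
  rw [withDensity_apply _ (MeasurableSet.univ_pi hs)]
  have hvol : (volume : Measure (Fin d → ℝ)).restrict (Set.pi univ s) =
      Measure.pi fun i => (volume : Measure ℝ).restrict (s i) := by
    rw [volume_pi, Measure.restrict_pi_pi]
  rw [hvol, ← ofReal_integral_eq_lintegral_ofReal]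
  · rw [integral_fintype_prod_eq_prod (𝕜 := ℝ) (fun _ x => gaussianPDFReal 0 v x),
      ENNReal.ofReal_prod_of_nonneg]
    · refine Finset.prod_congr rfl fun i _ => ?_
      rw [gaussianReal_apply_eq_integral _ hv]
    · intro i _; exact integral_nonneg fun x => gaussianPDFReal_nonneg _ _ _
  · exact Integrable.fintype_prod fun i => (integrable_gaussianPDFReal 0 v).restrict
  · exact Eventually.of_forall fun z => Finset.prod_nonneg fun i _ => gaussianPDFReal_nonneg _ _ _

/-- the heat kernel -/
noncomputable def Gk {d : ℕ} (σ : ℝ) (p : ℝ × (Fin d → ℝ)) : ℝ :=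
  if 0 < p.1 then ((√(2 * Real.pi * σ ^ 2 * p.1))⁻¹) ^ d *
    Real.exp (-(∑ i, p.2 i ^ 2) / (2 * σ ^ 2 * p.1)) else 0

theorem Gk_eq_prod {d : ℕ} {σ h : ℝ} (hσ : 0 < σ) (hh : 0 < h) (y : Fin d → ℝ) :
    Gk σ (h, y) = ∏ i, gaussianPDFReal 0 (NNReal.mk ((σ * √h) ^ 2) (sq_nonneg _)) (y i) := by
  simp only [Gk, hh, if_true, gaussianPDFReal, Finset.prod_mul_distrib, ← Real.exp_sum,
    NNReal.coe_mk, mul_pow, Real.sq_sqrt hh.le, sub_zero]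
  rw [Finset.prod_const, Finset.card_univ, Fintype.card_fin, ← Finset.sum_div,
    Finset.sum_neg_distrib]
  congr 3 <;> ring_nf

theorem Gk_nonneg {d : ℕ} {σ : ℝ} (p : ℝ × (Fin d → ℝ)) : 0 ≤ Gk σ p := by
  unfold Gk; split_ifs <;> positivity

theorem P_density {d : ℕ} {σ h : ℝ} (hσ : 0 < σ) (hh : 0 < h) {f : (Fin d → ℝ) → ℝ}
    (hf : Measurable f) (x : Fin d → ℝ) :
    P σ h f x = ∫ y, Gk σ (h, y) * f (x + y) := by
  have hv : (NNReal.mk ((σ * √h) ^ 2) (sq_nonneg _)) ≠ 0 := by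
    intro h0
    have : (σ * √h) ^ 2 = 0 := congrArg NNReal.toReal h0
    have h2 : 0 < σ * √h := by positivity
    nlinarith
  rw [P_eq_gamv hf, gamv_withDensity d hv, integral_withDensity_eq_integral_toReal_smul]
  · refine integral_congr_ae (Eventually.of_forall fun y => ?_)
    simp only [smul_eq_mul]
    rw [ENNReal.toReal_ofReal, Gk_eq_prod hσ hh]
    exact Finset.prod_nonneg fun i _ => gaussianPDFReal_nonneg _ _ _
  · apply Measurable.ennreal_ofReal
    exact Finset.measurable_prod _ fun i _ => (measurable_gaussianPDFReal _ _).comp (measurable_pi_apply i)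
  · exact Eventually.of_forall fun z => ENNReal.ofReal_lt_top

theorem Gk_measurable {d : ℕ} {σ : ℝ} : Measurable (Gk (d := d) σ) := by
  unfold Gk
  refine Measurable.ite (measurableSet_lt measurable_const measurable_fst) ?_ measurable_const
  fun_prop

theorem Gk_integrable {d : ℕ} {σ h : ℝ} (hσ : 0 < σ) (hh : 0 < h) :
    Integrable (fun y : Fin d → ℝ => Gk σ (h, y)) := by
  simp only [Gk_eq_prod hσ hh]
  exact Integrable.fintype_prod fun i => integrable_gaussianPDFReal 0 _

theorem Gk_integral {d : ℕ} {σ h : ℝ} (hσ : 0 < σ) (hh : 0 < h) :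
    ∫ y : Fin d → ℝ, Gk σ (h, y) = 1 := by
  have := P_density hσ hh (d := d) (f := fun _ => 1) measurable_const 0
  rw [P_const] at this
  simpa using this.symm

theorem P_density' {d : ℕ} {σ h : ℝ} (hσ : 0 < σ) (hh : 0 < h) {f : (Fin d → ℝ) → ℝ}
    (hf : Measurable f) (x : Fin d → ℝ) :
    P σ h f x = ∫ y, Gk σ (h, x - y) * f y := by
  rw [P_density hσ hh hf]
  have := integral_sub_left_eq_self (fun y => Gk σ (h, x - y) * f y) volume x
  rw [← integral_neg_eq_self, ← this]
  refine integral_congr_ae (Eventually.of_forall fun y => ?_)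
  simp only [sub_sub_cancel]
  simp [Gk, sub_eq_add_neg]

end Casc

open Set Filter
open scoped Topology

namespace Casc
open MeasureTheory ProbabilityTheory

/-- `t^{-m/2} exp(-1/t)` for `t > 0`, and `0` otherwise. -/
noncomputable def qf (m : ℕ) (t : ℝ) : ℝ := if 0 < t then ((√t)⁻¹) ^ m * Real.exp (-t⁻¹) else 0

theorem qf_bound (m : ℕ) (t : ℝ) : |qf m t| ≤ m.factorial * Real.exp 1 := by
  unfold qf
  split_ifs with h
  · set u := (√t)⁻¹ with hu
    have hu0 : 0 ≤ u := by positivity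
    have hu2 : t⁻¹ = u ^ 2 := by rw [hu, inv_pow, Real.sq_sqrt h.le]
    rw [hu2, abs_of_nonneg (by positivity)]
    have h1 := Real.pow_div_factorial_le_exp (x := u) hu0 m
    rw [div_le_iff₀ (by positivity)] at h1
    calc u ^ m * Real.exp (-u ^ 2) ≤ (Real.exp u * m.factorial) * Real.exp (-u ^ 2) := by gcongr
      _ = m.factorial * Real.exp (u + -u ^ 2) := by rw [Real.exp_add]; ring
      _ ≤ m.factorial * Real.exp 1 := by
        gcongr
        nlinarith [sq_nonneg (u - 1)]
  · simp; positivity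

theorem qf_shift (m : ℕ) (t : ℝ) : qf m t = t ^ 2 * qf (m + 4) t := by
  unfold qf
  split_ifs with h
  · have hs : 0 < √t := Real.sqrt_pos.2 h
    have : t = √t ^ 2 := (Real.sq_sqrt h.le).symm
    have h2 : t ^ 2 * ((√t)⁻¹) ^ 4 = 1 := by
      conv_lhs => rw [this, Real.sqrt_sq hs.le]
      field_simp
    rw [pow_add]
    calc _ = (t ^ 2 * ((√t)⁻¹) ^ 4) * ((√t)⁻¹ ^ m * Real.exp (-t⁻¹)) := by rw [h2, one_mul]
      _ = _ := by ring
  · simp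

theorem qf_hasDerivAt (m : ℕ) (t : ℝ) :
    HasDerivAt (qf m) (-(m / 2 : ℝ) * qf (m + 2) t + qf (m + 4) t) t := by
  rcases lt_trichotomy t 0 with h | h | h
  · have : qf m =ᶠ[𝓝 t] fun _ => 0 := by
      filter_upwards [gt_mem_nhds h] with s hs
      simp [qf, not_lt.2 hs.le]
    have h2 := (hasDerivAt_const t (0 : ℝ)).congr_of_eventuallyEq this
    simpa [qf, not_lt.2 h.le] using h2
  · subst h
    have h0 : -(m / 2 : ℝ) * qf (m + 2) 0 + qf (m + 4) 0 = 0 := by simp [qf]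
    rw [h0, hasDerivAt_iff_isLittleO]
    have hb : (fun x => qf m x - qf m 0 - (x - 0) • (0 : ℝ)) =O[𝓝 0] fun x : ℝ => x ^ 2 := by
      refine Asymptotics.IsBigO.of_bound ((m + 4).factorial * Real.exp 1) ?_
      refine Eventually.of_forall fun x => ?_
      simp only [sub_zero, smul_zero, Real.norm_eq_abs]
      have : qf m 0 = 0 := by simp [qf]
      rw [this, sub_zero, qf_shift, abs_mul, mul_comm]
      gcongr
      exact qf_bound _ _
    refine hb.trans_isLittleO ?_
    simp only [sub_zero]
    simpa using Asymptotics.isLittleO_pow_pow (𝕜 := ℝ) (m := 1) (n := 2) (by norm_num)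
  · have : qf m =ᶠ[𝓝 t] fun s => ((√s)⁻¹) ^ m * Real.exp (-s⁻¹) := by
      filter_upwards [lt_mem_nhds h] with s hs
      simp [qf, hs]
    refine HasDerivAt.congr_of_eventuallyEq ?_ this
    have hs : 0 < √t := Real.sqrt_pos.2 h
    have e1 := (((Real.hasDerivAt_sqrt h.ne').inv hs.ne').pow m).mul
      ((hasDerivAt_inv h.ne').neg.exp)
    refine HasDerivAt.congr_deriv (f := fun s => ((√s)⁻¹) ^ m * Real.exp (-s⁻¹)) e1 ?_
    unfold qf; rw [if_pos h, if_pos h]; simp only [Pi.pow_apply, Pi.inv_apply, Pi.neg_apply]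
    have hts : t = √t ^ 2 := (Real.sq_sqrt h.le).symm
    set u := √t
    have hi : (t ^ 2)⁻¹ = (u⁻¹) ^ 4 := by rw [hts]; rw [← inv_pow]; ring
    rw [hi]
    rcases m with _ | m
    · simp; ring
    · simp only [Nat.add_sub_cancel]
      push_cast
      have : -(1 / (2 * u)) / u ^ 2 = -(1/2) * (u⁻¹) ^ 3 := by field_simp
      rw [this]
      ring

theorem qf_contDiff (m : ℕ) : ContDiff ℝ (⊤ : ℕ∞) (qf m) := by
  rw [contDiff_infty]
  intro n
  induction n generalizing m with
  | zero =>
    exact contDiff_zero.2 (continuous_iff_continuousAt.2 fun t => (qf_hasDerivAt m t).continuousAt)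
  | succ n ih =>
    have : ((n + 1 : ℕ) : WithTop ℕ∞) = (n : WithTop ℕ∞) + 1 := by simp
    rw [this, contDiff_succ_iff_deriv]
    refine ⟨fun t => (qf_hasDerivAt m t).differentiableAt, by simp, ?_⟩
    have : deriv (qf m) = fun t => -(m / 2 : ℝ) * qf (m + 2) t + qf (m + 4) t :=
      funext fun t => (qf_hasDerivAt m t).deriv
    rw [this]
    exact ((contDiff_const.mul (ih (m + 2))).add (ih (m + 4)))

theorem Gk_eq_qf {d : ℕ} {σ : ℝ} (hσ : 0 < σ) (p : ℝ × (Fin d → ℝ)) (hp : p.2 ≠ 0) :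
    Gk σ p = ((√(2 * Real.pi * σ ^ 2))⁻¹) ^ d * ((√((∑ i, p.2 i ^ 2) / (2 * σ ^ 2)))⁻¹) ^ d *
      qf d (p.1 / ((∑ i, p.2 i ^ 2) / (2 * σ ^ 2))) := by
  have hz : 0 < ∑ i, p.2 i ^ 2 := by
    obtain ⟨i, hi⟩ := Function.ne_iff.1 hp
    exact Finset.sum_pos' (fun i _ => sq_nonneg _) ⟨i, Finset.mem_univ _, by
      have : p.2 i ≠ 0 := hi
      positivity⟩
  set z := (∑ i, p.2 i ^ 2) / (2 * σ ^ 2) with hzd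
  have hz' : 0 < z := by positivity
  unfold Gk qf
  by_cases hs : 0 < p.1
  · have : 0 < p.1 / z := by positivity
    simp only [hs, this, if_true]
    have e1 : √(2 * Real.pi * σ ^ 2 * p.1) = √(2 * Real.pi * σ ^ 2) * (√z * √(p.1 / z)) := by
      rw [← Real.sqrt_mul hz'.le, ← Real.sqrt_mul (by positivity)]
      congr 1; field_simp
    rw [e1, mul_inv, mul_inv, mul_pow, mul_pow]
    have e2 : -(∑ i, p.2 i ^ 2) / (2 * σ ^ 2 * p.1) = -(p.1 / z)⁻¹ := by
      rw [hzd]; field_simp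
    rw [e2]; ring
  · have : ¬ 0 < p.1 / z := by
      rw [not_lt] at hs ⊢; exact div_nonpos_of_nonpos_of_nonneg hs hz'.le
    simp [hs, this]

theorem Gk_eventuallyEq {d : ℕ} {σ : ℝ} (p : ℝ × (Fin d → ℝ)) (hp : 0 < p.1) :
    Gk σ =ᶠ[𝓝 p] fun p => ((√(2 * Real.pi * σ ^ 2 * p.1))⁻¹) ^ d *
      Real.exp (-(∑ i, p.2 i ^ 2) / (2 * σ ^ 2 * p.1)) := by
  filter_upwards [continuous_fst.continuousAt.eventually (lt_mem_nhds hp)] with q hq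
  simp [Gk, hq]

theorem Gk_contDiffAt {d : ℕ} {σ : ℝ} (hσ : 0 < σ) (p : ℝ × (Fin d → ℝ)) (hp : p ≠ 0) :
    ContDiffAt ℝ (⊤ : ℕ∞) (Gk σ) p := by
  by_cases h2 : p.2 = 0
  · have h1 : p.1 ≠ 0 := fun h => hp (Prod.ext h h2)
    rcases lt_or_gt_of_ne h1 with h | h
    · have : Gk σ =ᶠ[𝓝 p] fun _ => 0 := by
        filter_upwards [continuous_fst.continuousAt.eventually (gt_mem_nhds h)] with q hq
        simp [Gk, not_lt.2 hq.le]
      exact contDiffAt_const.congr_of_eventuallyEq this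
    · refine ContDiffAt.congr_of_eventuallyEq ?_ (Gk_eventuallyEq p h)
      have a1 : 2 * Real.pi * σ ^ 2 * p.1 ≠ 0 := by positivity
      have a2 : 2 * σ ^ 2 * p.1 ≠ 0 := by positivity
      have a3 : √(2 * Real.pi * σ ^ 2 * p.1) ≠ 0 := by positivity
      have c1 : ContDiffAt ℝ (⊤ : ℕ∞) (fun p : ℝ × (Fin d → ℝ) => √(2 * Real.pi * σ ^ 2 * p.1)) p :=
        (contDiffAt_const.mul contDiffAt_fst).sqrt a1
      have c2 : ContDiffAt ℝ (⊤ : ℕ∞) (fun p : ℝ × (Fin d → ℝ) => -(∑ i, p.2 i ^ 2)) p := by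
        fun_prop
      exact ((c1.inv a3).pow d).mul ((c2.div (contDiffAt_const.mul contDiffAt_fst) a2).exp)
  · have hev : Gk σ =ᶠ[𝓝 p] fun p => ((√(2 * Real.pi * σ ^ 2))⁻¹) ^ d *
        ((√((∑ i, p.2 i ^ 2) / (2 * σ ^ 2)))⁻¹) ^ d *
        qf d (p.1 / ((∑ i, p.2 i ^ 2) / (2 * σ ^ 2))) := by
      filter_upwards [continuous_snd.continuousAt.eventually_ne h2] with q hq
      exact Gk_eq_qf hσ q hq
    refine ContDiffAt.congr_of_eventuallyEq ?_ hev
    have hz : 0 < ∑ i, p.2 i ^ 2 := by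
      obtain ⟨i, hi⟩ := Function.ne_iff.1 h2
      exact Finset.sum_pos' (fun i _ => sq_nonneg _) ⟨i, Finset.mem_univ _, by
        have : p.2 i ≠ 0 := hi
        positivity⟩
    have hz' : (∑ i, p.2 i ^ 2) / (2 * σ ^ 2) ≠ 0 := by positivity
    have hz2 : √((∑ i, p.2 i ^ 2) / (2 * σ ^ 2)) ≠ 0 := by positivity
    have c0 : ContDiffAt ℝ (⊤ : ℕ∞) (fun p : ℝ × (Fin d → ℝ) => (∑ i, p.2 i ^ 2)) p := by
      fun_prop
    have c1 := c0.div_const (2 * σ ^ 2)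
    exact (contDiffAt_const.mul (((c1.sqrt hz').inv hz2).pow d)).mul
      (((qf_contDiff d).contDiffAt).comp p (contDiffAt_fst.div c1 hz'))

end Casc

open Set Filter
open scoped Topology

namespace Casc
open MeasureTheory ProbabilityTheory

/-- directional derivative -/
noncomputable def dv {d : ℕ} (v : ℝ × (Fin d → ℝ)) (f : ℝ × (Fin d → ℝ) → ℝ)
    (p : ℝ × (Fin d → ℝ)) : ℝ := fderiv ℝ f p v

/-- space unit vectors -/
noncomputable def ex {d : ℕ} (i : Fin d) : ℝ × (Fin d → ℝ) := (0, Pi.single i 1)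

/-- time unit vector -/
noncomputable def et {d : ℕ} : ℝ × (Fin d → ℝ) := (1, 0)

/-- the heat operator -/
noncomputable def Hop {d : ℕ} (σ : ℝ) (f : ℝ × (Fin d → ℝ) → ℝ) (p : ℝ × (Fin d → ℝ)) : ℝ :=
  dv et f p - σ ^ 2 / 2 * ∑ i, dv (ex i) (dv (ex i) f) p

theorem dv_congr {d : ℕ} {v : ℝ × (Fin d → ℝ)} {f g : ℝ × (Fin d → ℝ) → ℝ}
    {p : ℝ × (Fin d → ℝ)} (h : f =ᶠ[𝓝 p] g) : dv v f =ᶠ[𝓝 p] dv v g := by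
  filter_upwards [h.fderiv (𝕜 := ℝ)] with q hq
  simp [dv, hq]

theorem Hop_congr {d : ℕ} {σ : ℝ} {f g : ℝ × (Fin d → ℝ) → ℝ}
    {p : ℝ × (Fin d → ℝ)} (h : f =ᶠ[𝓝 p] g) : Hop σ f p = Hop σ g p := by
  simp only [Hop, (dv_congr h).eq_of_nhds]
  congr 2
  exact Finset.sum_congr rfl fun i _ => (dv_congr (dv_congr h)).eq_of_nhds

theorem dv_zero {d : ℕ} {v : ℝ × (Fin d → ℝ)} : dv v (fun _ : ℝ × (Fin d → ℝ) => 0) = fun _ => 0 := by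
  funext p; simp [dv]

theorem Hop_zero {d : ℕ} {σ : ℝ} (p : ℝ × (Fin d → ℝ)) : Hop σ (fun _ => 0) p = 0 := by
  simp [Hop, dv_zero]

theorem contDiffAt_dv {d : ℕ} {v : ℝ × (Fin d → ℝ)} {f : ℝ × (Fin d → ℝ) → ℝ}
    {p : ℝ × (Fin d → ℝ)} (h : ContDiffAt ℝ (⊤ : ℕ∞) f p) : ContDiffAt ℝ (⊤ : ℕ∞) (dv v f) p := by
  have : ContDiffAt ℝ (⊤ : ℕ∞) (fderiv ℝ f) p := h.fderiv_right (by simp)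
  exact this.clm_apply contDiffAt_const

theorem contDiffAt_Hop {d : ℕ} {σ : ℝ} {f : ℝ × (Fin d → ℝ) → ℝ}
    {p : ℝ × (Fin d → ℝ)} (h : ContDiffAt ℝ (⊤ : ℕ∞) f p) : ContDiffAt ℝ (⊤ : ℕ∞) (Hop σ f) p := by
  unfold Hop
  refine (contDiffAt_dv h).sub (contDiffAt_const.mul ?_)
  exact ContDiffAt.sum fun i _ => contDiffAt_dv (contDiffAt_dv h)

theorem dv_hasDerivAt {d : ℕ} {v : ℝ × (Fin d → ℝ)} {f : ℝ × (Fin d → ℝ) → ℝ}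
    {p : ℝ × (Fin d → ℝ)} (h : DifferentiableAt ℝ f p) :
    HasDerivAt (fun t : ℝ => f (p + t • v)) (dv v f p) 0 := by
  have h1 : HasDerivAt (fun t : ℝ => p + t • v) v 0 := by
    simpa using ((hasDerivAt_id (0 : ℝ)).smul_const v).const_add p
  have h2 : HasFDerivAt f (fderiv ℝ f p) (p + (0 : ℝ) • v) := by simpa using h.hasFDerivAt
  exact h2.comp_hasDerivAt (0 : ℝ) h1

theorem sumsq_hasDerivAt {d : ℕ} (y : Fin d → ℝ) (i : Fin d) :
    HasDerivAt (fun t : ℝ => ∑ j, (y j + t * (Pi.single i 1 : Fin d → ℝ) j) ^ 2) (2 * y i) 0 := by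
  have h : ∀ j ∈ Finset.univ, HasDerivAt
      (fun t : ℝ => (y j + t * (Pi.single i 1 : Fin d → ℝ) j) ^ 2)
      (2 * y j * (Pi.single i 1 : Fin d → ℝ) j) 0 := by
    intro j _
    have h1 : HasDerivAt (fun t : ℝ => y j + t * (Pi.single i 1 : Fin d → ℝ) j)
      ((Pi.single i 1 : Fin d → ℝ) j) 0 := by
      simpa using ((hasDerivAt_id (0 : ℝ)).mul_const ((Pi.single i 1 : Fin d → ℝ) j)).const_add (y j)
    simpa using h1.fun_pow 2
  have := HasDerivAt.fun_sum h
  refine this.congr_deriv ?_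
  simp [Pi.single_apply]

theorem dv_ex_Gk {d : ℕ} {σ : ℝ} (hσ : 0 < σ) (i : Fin d) (p : ℝ × (Fin d → ℝ)) (hp : 0 < p.1) :
    dv (ex i) (Gk σ) p = -(p.2 i / (σ ^ 2 * p.1)) * Gk σ p := by
  have hne : p ≠ 0 := by rintro rfl; simp at hp
  have h1 := dv_hasDerivAt (v := ex i) ((Gk_contDiffAt hσ p hne).differentiableAt (by simp))
  have e : (fun t : ℝ => Gk σ (p + t • ex i)) = fun t : ℝ => ((√(2 * Real.pi * σ ^ 2 * p.1))⁻¹) ^ d *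
      Real.exp (-(∑ j, (p.2 j + t * (Pi.single i 1 : Fin d → ℝ) j) ^ 2) / (2 * σ ^ 2 * p.1)) := by
    funext t; simp [Gk, ex, hp]
  rw [e] at h1
  have h2 := ((((sumsq_hasDerivAt p.2 i).neg).div_const (2 * σ ^ 2 * p.1)).exp).const_mul
    (((√(2 * Real.pi * σ ^ 2 * p.1))⁻¹) ^ d)
  rw [h1.unique h2]
  simp only [Gk, hp, if_true, Pi.neg_apply, zero_mul, add_zero]
  field_simp

theorem dv_et_Gk {d : ℕ} {σ : ℝ} (hσ : 0 < σ) (p : ℝ × (Fin d → ℝ)) (hp : 0 < p.1) :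
    dv et (Gk σ) p = ((∑ i, p.2 i ^ 2) / (2 * σ ^ 2 * p.1 ^ 2) - d / (2 * p.1)) * Gk σ p := by
  have hne : p ≠ 0 := by rintro rfl; simp at hp
  have h1 := dv_hasDerivAt (v := et) ((Gk_contDiffAt hσ p hne).differentiableAt (by simp))
  have e : (fun t : ℝ => Gk σ (p + t • et)) =ᶠ[𝓝 0] fun t : ℝ =>
      ((√(2 * Real.pi * σ ^ 2 * (p.1 + t)))⁻¹) ^ d *
      Real.exp (-(∑ j, p.2 j ^ 2) / (2 * σ ^ 2 * (p.1 + t))) := by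
    filter_upwards [lt_mem_nhds (show -p.1 < 0 by linarith)] with t ht
    have : 0 < p.1 + t := by linarith
    simp [Gk, et, this]
  have h1 := h1.congr_of_eventuallyEq e.symm
  have hb : HasDerivAt (fun t : ℝ => p.1 + t) 1 0 := by
    simpa using (hasDerivAt_id (0 : ℝ)).const_add p.1
  have hpos : 0 < 2 * Real.pi * σ ^ 2 * (p.1 + 0) := by rw [add_zero]; positivity
  have hpos2 : 2 * σ ^ 2 * (p.1 + 0) ≠ 0 := by rw [add_zero]; positivity
  have hs : 0 < √(2 * Real.pi * σ ^ 2 * (p.1 + 0)) := Real.sqrt_pos.2 hpos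
  have h2 := ((((hb.const_mul (2 * Real.pi * σ ^ 2)).sqrt hpos.ne').inv hs.ne').pow d).mul
    ((((hasDerivAt_const (0 : ℝ) (-(∑ j, p.2 j ^ 2))).div (hb.const_mul (2 * σ ^ 2)) hpos2)).exp)
  rw [h1.unique h2]
  simp only [Gk, hp, if_true, add_zero, Pi.pow_apply, Pi.inv_apply, Pi.div_apply, mul_one] at *
  have hsq := Real.sq_sqrt hpos.le
  set u := √(2 * Real.pi * σ ^ 2 * p.1)
  have hp' : p.1 = u ^ 2 / (2 * Real.pi * σ ^ 2) := by rw [hsq]; field_simp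
  have key : (d : ℝ) * u⁻¹ ^ (d - 1) * (-(2 * Real.pi * σ ^ 2 / (2 * u)) / u ^ 2) =
      - (d / (2 * p.1)) * u⁻¹ ^ d := by
    rw [hp']
    rcases d with _ | m
    · simp
    · simp only [Nat.add_sub_cancel, pow_succ]
      field_simp
  rw [key]
  field_simp
  ring

theorem Hop_Gk_pos {d : ℕ} {σ : ℝ} (hσ : 0 < σ) (p : ℝ × (Fin d → ℝ)) (hp : 0 < p.1) :
    Hop σ (Gk σ) p = 0 := by
  have hne : p ≠ 0 := by rintro rfl; simp at hp
  have hG := Gk_contDiffAt hσ p hne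
  have hdd : ∀ i : Fin d, dv (ex i) (dv (ex i) (Gk σ)) p =
      (p.2 i ^ 2 / (σ ^ 4 * p.1 ^ 2) - 1 / (σ ^ 2 * p.1)) * Gk σ p := by
    intro i
    have h1 := dv_hasDerivAt (v := ex i) ((contDiffAt_dv (v := ex i) hG).differentiableAt (by simp))
    have e : (fun t : ℝ => dv (ex i) (Gk σ) (p + t • ex i)) =
        fun t : ℝ => -((p.2 i + t) / (σ ^ 2 * p.1)) * Gk σ (p + t • ex i) := by
      funext t
      rw [dv_ex_Gk hσ i _ (by simpa [ex] using hp)]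
      simp [ex]
    rw [e] at h1
    have h2 := dv_hasDerivAt (v := ex i) (hG.differentiableAt (by simp))
    have h3 : HasDerivAt (fun t : ℝ => -((p.2 i + t) / (σ ^ 2 * p.1))) (-(1 / (σ ^ 2 * p.1))) 0 := by
      have := ((((hasDerivAt_id (0 : ℝ)).const_add (p.2 i)).div_const (σ ^ 2 * p.1))).fun_neg
      simpa using this
    have h4 := h3.mul h2
    rw [h1.unique h4, dv_ex_Gk hσ i p hp]
    simp only [zero_smul, add_zero]
    field_simp
    ring
  simp only [Hop, hdd, dv_et_Gk hσ p hp, ← Finset.sum_mul, Finset.sum_sub_distrib, ← Finset.sum_div,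
    Finset.sum_const, Finset.card_univ, Fintype.card_fin, nsmul_eq_mul]
  field_simp
  ring

theorem Hop_eq_zero_of_neg {d : ℕ} {σ : ℝ} {f : ℝ × (Fin d → ℝ) → ℝ}
    (h0 : ∀ p : ℝ × (Fin d → ℝ), p.1 ≤ 0 → f p = 0)
    (p : ℝ × (Fin d → ℝ)) (hf : ContDiffAt ℝ (⊤ : ℕ∞) f p) (hp1 : p.1 ≤ 0) : Hop σ f p = 0 := by
  have hneg : ∀ q : ℝ × (Fin d → ℝ), q.1 < 0 → Hop σ f q = 0 := by
    intro q hq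
    have : f =ᶠ[𝓝 q] fun _ => 0 := by
      filter_upwards [continuous_fst.continuousAt.eventually (gt_mem_nhds hq)] with r hr
      exact h0 r hr.le
    rw [Hop_congr this, Hop_zero]
  have hc : ContinuousAt (Hop σ f) p := (contDiffAt_Hop hf).continuousAt
  have hl : Tendsto (fun t : ℝ => ((p.1 - t, p.2) : ℝ × (Fin d → ℝ))) (𝓝[>] 0) (𝓝 p) := by
    have : Continuous fun t : ℝ => ((p.1 - t, p.2) : ℝ × (Fin d → ℝ)) := by fun_prop
    have h := this.tendsto 0
    simp only [sub_zero] at h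
    exact h.mono_left nhdsWithin_le_nhds
  refine tendsto_nhds_unique (hc.tendsto.comp hl) ?_
  refine tendsto_const_nhds.congr' ?_
  filter_upwards [self_mem_nhdsWithin] with t ht
  have : 0 < t := ht
  exact (hneg _ (by simp; linarith)).symm

theorem Hop_Gk {d : ℕ} {σ : ℝ} (hσ : 0 < σ) (p : ℝ × (Fin d → ℝ)) (hp : p ≠ 0) :
    Hop σ (Gk σ) p = 0 := by
  rcases lt_or_ge 0 p.1 with h | h
  · exact Hop_Gk_pos hσ p h
  · exact Hop_eq_zero_of_neg (fun p hp => by simp [Gk, not_lt.2 hp]) p (Gk_contDiffAt hσ p hp) h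

/-- the localised kernel -/
noncomputable def Ak {d : ℕ} (σ : ℝ) (χ : ContDiffBump (0 : ℝ × (Fin d → ℝ)))
    (p : ℝ × (Fin d → ℝ)) : ℝ := χ p * Gk σ p

/-- the mean value kernel -/
noncomputable def rk {d : ℕ} (σ : ℝ) (χ : ContDiffBump (0 : ℝ × (Fin d → ℝ)))
    (p : ℝ × (Fin d → ℝ)) : ℝ := if p = 0 then 0 else -Hop σ (Ak σ χ) p

theorem Ak_contDiffAt {d : ℕ} {σ : ℝ} (hσ : 0 < σ) (χ : ContDiffBump (0 : ℝ × (Fin d → ℝ)))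
    (p : ℝ × (Fin d → ℝ)) (hp : p ≠ 0) : ContDiffAt ℝ (⊤ : ℕ∞) (Ak σ χ) p :=
  χ.contDiffAt.mul (Gk_contDiffAt hσ p hp)

theorem rk_nonpos {d : ℕ} {σ : ℝ} (hσ : 0 < σ) (χ : ContDiffBump (0 : ℝ × (Fin d → ℝ)))
    (p : ℝ × (Fin d → ℝ)) (hp : p.1 ≤ 0) : rk σ χ p = 0 := by
  unfold rk
  split_ifs with h
  · rfl
  · rw [Hop_eq_zero_of_neg (fun p hp => by simp [Ak, Gk, not_lt.2 hp]) p (Ak_contDiffAt hσ χ p h) hp,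
      neg_zero]

theorem rk_contDiff {d : ℕ} {σ : ℝ} (hσ : 0 < σ) (χ : ContDiffBump (0 : ℝ × (Fin d → ℝ))) :
    ContDiff ℝ (⊤ : ℕ∞) (rk σ χ) := by
  rw [contDiff_iff_contDiffAt]
  intro p
  by_cases hp : p = 0
  · subst hp
    have : rk σ χ =ᶠ[𝓝 0] fun _ => 0 := by
      filter_upwards [Metric.ball_mem_nhds _ χ.rIn_pos] with q hq
      unfold rk
      split_ifs with h
      · rfl
      · have : Ak σ χ =ᶠ[𝓝 q] Gk σ := by
          filter_upwards [Metric.isOpen_ball.mem_nhds hq] with r hr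
          rw [Ak, χ.one_of_mem_closedBall (Metric.ball_subset_closedBall hr), one_mul]
        rw [Hop_congr this, Hop_Gk hσ q h, neg_zero]
    exact contDiffAt_const.congr_of_eventuallyEq this
  · have : rk σ χ =ᶠ[𝓝 p] fun q => -Hop σ (Ak σ χ) q := by
      filter_upwards [isOpen_ne.mem_nhds hp] with q hq
      exact if_neg hq
    exact (contDiffAt_Hop (Ak_contDiffAt hσ χ p hp)).neg.congr_of_eventuallyEq this

theorem Ak_zero {d : ℕ} {σ : ℝ} (χ : ContDiffBump (0 : ℝ × (Fin d → ℝ)))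
    (p : ℝ × (Fin d → ℝ)) (hp : χ.rOut ≤ ‖p‖) : Ak σ χ p = 0 := by
  rw [Ak, χ.zero_of_le_dist (by simpa using hp), zero_mul]

theorem rk_zero {d : ℕ} {σ : ℝ} (χ : ContDiffBump (0 : ℝ × (Fin d → ℝ)))
    (p : ℝ × (Fin d → ℝ)) (hp : χ.rOut < ‖p‖) : rk σ χ p = 0 := by
  unfold rk
  split_ifs with h
  · rfl
  · have : Ak σ χ =ᶠ[𝓝 p] fun _ => 0 := by
      filter_upwards [continuous_norm.continuousAt.eventually (lt_mem_nhds hp)] with q hq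
      exact Ak_zero χ q hq.le
    rw [Hop_congr this, Hop_zero, neg_zero]

theorem rk_compact {d : ℕ} {σ : ℝ} (χ : ContDiffBump (0 : ℝ × (Fin d → ℝ))) :
    HasCompactSupport (rk σ χ) := by
  refine HasCompactSupport.intro (isCompact_closedBall 0 χ.rOut) fun p hp => rk_zero χ p ?_
  simpa using hp

end Casc

open Set Filter
open scoped Topology

namespace Casc
open MeasureTheory ProbabilityTheory

instance instHaarE (d : ℕ) : (volume : Measure (ℝ × (Fin d → ℝ))).IsAddHaarMeasure := by
  rw [Measure.volume_eq_prod]; infer_instance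

/-- convolution against a kernel -/
noncomputable def cv {d : ℕ} (r W : ℝ × (Fin d → ℝ) → ℝ) (p : ℝ × (Fin d → ℝ)) : ℝ :=
  ∫ q, W q * r (p - q)

theorem cv_eq {d : ℕ} (r W : ℝ × (Fin d → ℝ) → ℝ) :
    cv r W = convolution W r (ContinuousLinearMap.mul ℝ ℝ) volume := by
  funext p; simp [cv, convolution_def]

theorem cv_integrable {d : ℕ} {r W : ℝ × (Fin d → ℝ) → ℝ} (hr : Continuous r)
    (hc : HasCompactSupport r) (hW : LocallyIntegrable W) (p : ℝ × (Fin d → ℝ)) :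
    Integrable fun q => W q * r (p - q) := by
  have := hc.convolutionExists_right (ContinuousLinearMap.mul ℝ ℝ) hW hr p
  simpa [ConvolutionExistsAt] using this

theorem cv_contDiff {d : ℕ} {r W : ℝ × (Fin d → ℝ) → ℝ} (hr : ContDiff ℝ (⊤ : ℕ∞) r)
    (hc : HasCompactSupport r) (hW : LocallyIntegrable W) : ContDiff ℝ (⊤ : ℕ∞) (cv r W) := by
  rw [cv_eq]; exact hc.contDiff_convolution_right (ContinuousLinearMap.mul ℝ ℝ) hW hr

theorem dv_contDiff {d : ℕ} {v : ℝ × (Fin d → ℝ)} {r : ℝ × (Fin d → ℝ) → ℝ}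
    (hr : ContDiff ℝ (⊤ : ℕ∞) r) : ContDiff ℝ (⊤ : ℕ∞) (dv v r) :=
  contDiff_iff_contDiffAt.2 fun _ => contDiffAt_dv hr.contDiffAt

theorem dv_compact {d : ℕ} {v : ℝ × (Fin d → ℝ)} {r : ℝ × (Fin d → ℝ) → ℝ}
    (hc : HasCompactSupport r) : HasCompactSupport (dv v r) := hc.fderiv_apply ℝ v

theorem dv_cv {d : ℕ} {v : ℝ × (Fin d → ℝ)} {r W : ℝ × (Fin d → ℝ) → ℝ}
    (hr : ContDiff ℝ (⊤ : ℕ∞) r)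
    (hc : HasCompactSupport r) (hW : LocallyIntegrable W) : dv v (cv r W) = cv (dv v r) W := by
  funext p
  have hr1 : ContDiff ℝ 1 r := hr.of_le (by exact_mod_cast le_top)
  rw [cv_eq, cv_eq]
  have hd := HasCompactSupport.hasFDerivAt_convolution_right (𝕜 := ℝ) (μ := (volume : Measure (ℝ × (Fin d → ℝ)))) (f := W) (g := r)
    (ContinuousLinearMap.mul ℝ ℝ) hc hW hr1 p
  rw [dv, hd.fderiv,
    convolution_precompR_apply _ hW (hc.fderiv ℝ) (hr1.continuous_fderiv one_ne_zero)]
  rfl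

theorem Hop_contDiff {d : ℕ} {σ : ℝ} {r : ℝ × (Fin d → ℝ) → ℝ}
    (hr : ContDiff ℝ (⊤ : ℕ∞) r) : ContDiff ℝ (⊤ : ℕ∞) (Hop σ r) :=
  contDiff_iff_contDiffAt.2 fun _ => contDiffAt_Hop hr.contDiffAt

theorem Hop_compact {d : ℕ} {σ : ℝ} {r : ℝ × (Fin d → ℝ) → ℝ}
    (hc : HasCompactSupport r) : HasCompactSupport (Hop σ r) := by
  refine HasCompactSupport.intro hc fun p hp => ?_
  have : r =ᶠ[𝓝 p] fun _ => 0 := notMem_tsupport_iff_eventuallyEq.1 hp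
  rw [Hop_congr this, Hop_zero]

theorem Hop_cv {d : ℕ} {σ : ℝ} {r W : ℝ × (Fin d → ℝ) → ℝ}
    (hr : ContDiff ℝ (⊤ : ℕ∞) r)
    (hc : HasCompactSupport r) (hW : LocallyIntegrable W) : Hop σ (cv r W) = cv (Hop σ r) W := by
  funext p
  unfold Hop
  simp only [dv_cv hr hc hW, dv_cv (dv_contDiff hr) (dv_compact hc) hW]
  have hi : ∀ i : Fin d, Integrable fun q => W q * dv (ex i) (dv (ex i) r) (p - q) := fun i =>
    cv_integrable (dv_contDiff (dv_contDiff hr)).continuous (dv_compact (dv_compact hc)) hW p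
  have ht : Integrable fun q => W q * dv et r (p - q) :=
    cv_integrable (dv_contDiff hr).continuous (dv_compact hc) hW p
  have hs : Integrable fun q => σ ^ 2 / 2 * ∑ i, W q * dv (ex i) (dv (ex i) r) (p - q) :=
    (integrable_finsetSum _ fun i _ => hi i).const_mul _
  simp only [cv]
  rw [← integral_finsetSum _ fun i _ => hi i, ← integral_const_mul, ← integral_sub ht hs]
  refine integral_congr_ae (Eventually.of_forall fun q => ?_)
  simp only [← Finset.mul_sum]
  ring

theorem locallyIntegrable_of_BM {d : ℕ} {W : ℝ × (Fin d → ℝ) → ℝ} (hm : Measurable W) {C : ℝ}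
    (hC : ∀ p, |W p| ≤ C) : LocallyIntegrable W := by
  have : LocallyIntegrable fun _ : ℝ × (Fin d → ℝ) => C := (continuous_const).locallyIntegrable
  exact this.mono hm.aestronglyMeasurable (Eventually.of_forall fun p => by
    rw [Real.norm_eq_abs, Real.norm_eq_abs]; exact (hC p).trans (le_abs_self _))

theorem Gk_locallyIntegrable {d : ℕ} {σ : ℝ} (hσ : 0 < σ) :
    LocallyIntegrable (Gk (d := d) σ) := by
  intro p
  refine ⟨Ioo (p.1 - 1) (p.1 + 1) ×ˢ univ, prod_mem_nhds (Ioo_mem_nhds (by linarith) (by linarith))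
    univ_mem, ?_⟩
  unfold IntegrableOn
  rw [Measure.volume_eq_prod, ← Measure.prod_restrict, Measure.restrict_univ]
  rw [integrable_prod_iff Gk_measurable.aestronglyMeasurable]
  have hle : ∀ h : ℝ, h ≤ 0 → ∀ y : Fin d → ℝ, Gk σ (h, y) = 0 := fun h hh y => by
    simp [Gk, not_lt.2 hh]
  constructor
  · refine Eventually.of_forall fun h => ?_
    rcases lt_or_ge 0 h with hh | hh
    · exact Gk_integrable hσ hh
    · simp [hle h hh]
  · have e : (fun h : ℝ => ∫ y : Fin d → ℝ, ‖Gk σ (h, y)‖) = indicator (Ioi 0) fun _ => 1 := by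
      funext h
      simp only [Real.norm_eq_abs, abs_of_nonneg (Gk_nonneg _)]
      rcases lt_or_ge 0 h with hh | hh
      · rw [indicator_of_mem (by exact hh), Gk_integral hσ hh]
      · rw [indicator_of_notMem (by simpa using hh)]; simp [hle h hh]
    rw [e]
    exact (integrable_const (1 : ℝ)).indicator measurableSet_Ioi

theorem dv_comp_sub {d : ℕ} (v z : ℝ × (Fin d → ℝ)) (f : ℝ × (Fin d → ℝ) → ℝ)
    (p : ℝ × (Fin d → ℝ)) : dv v (fun q => f (z - q)) p = -dv v f (z - p) := by
  unfold dv
  by_cases hd : DifferentiableAt ℝ f (z - p)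
  · have h1 : HasFDerivAt (fun q : ℝ × (Fin d → ℝ) => z - q) (-ContinuousLinearMap.id ℝ _) p :=
      (hasFDerivAt_id p).const_sub z
    have h2 := hd.hasFDerivAt.comp p h1
    have h3 : fderiv ℝ (fun q => f (z - q)) p = _ := h2.fderiv
    rw [h3]; simp
  · have hd2 : ¬ DifferentiableAt ℝ (fun q => f (z - q)) p := by
      intro h; apply hd
      have h1 : DifferentiableAt ℝ (fun q : ℝ × (Fin d → ℝ) => z - q) (z - p) :=
        (differentiableAt_const z).sub differentiableAt_id
      have h0 : DifferentiableAt ℝ (fun q => f (z - q)) (z - (z - p)) := by simpa using h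
      have h2 := h0.comp (z - p) h1
      have e : ((fun q => f (z - q)) ∘ fun q => z - q) = f := by funext q; simp
      rwa [e] at h2
    rw [fderiv_zero_of_not_differentiableAt hd, fderiv_zero_of_not_differentiableAt hd2]; simp

/-- integration by parts on a time slice -/
theorem slice_ibp {d : ℕ} {f g : ℝ × (Fin d → ℝ) → ℝ} (h : ℝ) (i : Fin d)
    (hf : ∀ y, ContDiffAt ℝ (⊤ : ℕ∞) f (h, y)) (hg : ∀ y, ContDiffAt ℝ (⊤ : ℕ∞) g (h, y))
    {R : ℝ} (hR : ∀ p : ℝ × (Fin d → ℝ), R ≤ ‖p‖ → f p = 0) :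
    ∫ y, f (h, y) * dv (ex i) g (h, y) = -∫ y, dv (ex i) f (h, y) * g (h, y) := by
  have key : ∀ (k : ℝ × (Fin d → ℝ) → ℝ) (y : Fin d → ℝ), ContDiffAt ℝ (⊤ : ℕ∞) k (h, y) →
      DifferentiableAt ℝ (fun y => k (h, y)) y ∧
      fderiv ℝ (fun y => k (h, y)) y (Pi.single i 1) = dv (ex i) k (h, y) := by
    intro k y hk
    have h1 : HasFDerivAt (fun y : Fin d → ℝ => (h, y)) (ContinuousLinearMap.inr ℝ ℝ (Fin d → ℝ)) y :=
      hasFDerivAt_prodMk_right h y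
    have h2 := (hk.differentiableAt (by simp)).hasFDerivAt.comp y h1
    refine ⟨h2.differentiableAt, ?_⟩
    have h3 : fderiv ℝ (fun y => k (h, y)) y = _ := h2.fderiv
    rw [h3]; rfl
  have cf : Continuous fun y => f (h, y) := continuous_iff_continuousAt.2 fun y =>
    (key f y (hf y)).1.continuousAt
  have cg : Continuous fun y => g (h, y) := continuous_iff_continuousAt.2 fun y =>
    (key g y (hg y)).1.continuousAt
  have cdf : Continuous fun y => dv (ex i) f (h, y) := continuous_iff_continuousAt.2 fun y =>
    (key _ y (contDiffAt_dv (hf y))).1.continuousAt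
  have cdg : Continuous fun y => dv (ex i) g (h, y) := continuous_iff_continuousAt.2 fun y =>
    (key _ y (contDiffAt_dv (hg y))).1.continuousAt
  have sf : HasCompactSupport fun y => f (h, y) := by
    refine HasCompactSupport.intro (isCompact_closedBall (0 : Fin d → ℝ) R) fun y hy => hR _ ?_
    have : R < ‖y‖ := by simpa using hy
    exact this.le.trans (norm_snd_le (h, y))
  have sdf : HasCompactSupport fun y => dv (ex i) f (h, y) := by
    refine HasCompactSupport.intro (isCompact_closedBall (0 : Fin d → ℝ) R) fun y hy => ?_
    have : R < ‖y‖ := by simpa using hy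
    have h2 : R < ‖(h, y)‖ := this.trans_le (norm_snd_le (h, y))
    have h3 : f =ᶠ[𝓝 (h, y)] fun _ => 0 := by
      filter_upwards [continuous_norm.continuousAt.eventually (lt_mem_nhds h2)] with q hq
      exact hR q hq.le
    rw [(dv_congr h3).eq_of_nhds, dv_zero]
  have := integral_mul_fderiv_eq_neg_fderiv_mul_of_integrable (μ := (volume : Measure (Fin d → ℝ)))
    (f := fun y => f (h, y)) (g := fun y => g (h, y)) (v := Pi.single i 1)
    (by
      simp only [fun y => (key f y (hf y)).2]
      exact (cdf.mul cg).integrable_of_hasCompactSupport sdf.mul_right)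
    (by
      simp only [fun y => (key g y (hg y)).2]
      exact (cf.mul cdg).integrable_of_hasCompactSupport sf.mul_right)
    ((cf.mul cg).integrable_of_hasCompactSupport sf.mul_right)
    (fun y _ => (key f y (hf y)).1) (fun y _ => (key g y (hg y)).1)
  simpa only [fun y => (key f y (hf y)).2, fun y => (key g y (hg y)).2] using this

end Casc

open Set Filter
open scoped Topology

namespace Casc
open MeasureTheory ProbabilityTheory

theorem dv_mul {d : ℕ} {v : ℝ × (Fin d → ℝ)} {f g : ℝ × (Fin d → ℝ) → ℝ} {p : ℝ × (Fin d → ℝ)}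
    (hf : DifferentiableAt ℝ f p) (hg : DifferentiableAt ℝ g p) :
    dv v (fun q => f q * g q) p = dv v f p * g p + f p * dv v g p := by
  unfold dv
  rw [fderiv_fun_mul hf hg]; simp; ring

theorem Rk_contDiffAt {d : ℕ} {σ : ℝ} (hσ : 0 < σ) (z p : ℝ × (Fin d → ℝ)) (hp : p.1 < z.1) :
    ContDiffAt ℝ (⊤ : ℕ∞) (fun q => Gk σ (z - q)) p := by
  have h1 : z - p ≠ 0 := by
    intro h
    have : z.1 - p.1 = 0 := congrArg Prod.fst h
    linarith
  have h2 : ContDiffAt ℝ (⊤ : ℕ∞) (fun q : ℝ × (Fin d → ℝ) => z - q) p :=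
    contDiffAt_const.sub contDiffAt_id
  exact ContDiffAt.comp p (g := Gk σ) (f := fun q => z - q) (Gk_contDiffAt hσ _ h1) h2

theorem phi_deriv_eq {d : ℕ} {σ : ℝ} (hσ : 0 < σ) (χ : ContDiffBump (0 : ℝ × (Fin d → ℝ)))
    (z : ℝ × (Fin d → ℝ)) (h : ℝ) (h0 : 0 < h) (h1 : h < z.1) :
    ∫ y, dv et (fun q => Ak σ χ q * Gk σ (z - q)) (h, y) =
      -∫ y, rk σ χ (h, y) * Gk σ (z - (h, y)) := by
  have hne : ∀ y : Fin d → ℝ, ((h, y) : ℝ × (Fin d → ℝ)) ≠ 0 := fun y hy => by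
    have : h = 0 := congrArg Prod.fst hy
    linarith
  have cA : ∀ y, ContDiffAt ℝ (⊤ : ℕ∞) (Ak σ χ) (h, y) := fun y => Ak_contDiffAt hσ χ _ (hne y)
  have cR : ∀ y, ContDiffAt ℝ (⊤ : ℕ∞) (fun q => Gk σ (z - q)) (h, y) :=
    fun y => Rk_contDiffAt hσ z _ h1
  have hR0 : ∀ p, Hop σ (fun q => Gk σ (z - q)) p =
      - 2 * dv et (Gk σ) (z - p) + Hop σ (Gk σ) (z - p) := by
    intro p
    unfold Hop
    have : ∀ i : Fin d, dv (ex i) (dv (ex i) fun q => Gk σ (z - q)) p =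
        dv (ex i) (dv (ex i) (Gk σ)) (z - p) := by
      intro i
      have e : (dv (ex i) fun q => Gk σ (z - q)) = fun q => -dv (ex i) (Gk σ) (z - q) :=
        funext fun q => dv_comp_sub _ _ _ _
      have e2 := dv_comp_sub (ex i) z (fun q => -dv (ex i) (Gk σ) q) p
      rw [e, e2]
      unfold dv
      rw [fderiv_fun_neg]; simp
    simp only [this, dv_comp_sub]
    ring
  -- pointwise formula
  have hpt : ∀ y, dv et (fun q => Ak σ χ q * Gk σ (z - q)) (h, y) =
      -(rk σ χ (h, y) * Gk σ (z - (h, y))) + σ ^ 2 / 2 * ∑ i,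
        (dv (ex i) (dv (ex i) (Ak σ χ)) (h, y) * Gk σ (z - (h, y)) -
          Ak σ χ (h, y) * dv (ex i) (dv (ex i) fun q => Gk σ (z - q)) (h, y)) := by
    intro y
    rw [dv_mul ((cA y).differentiableAt (by simp)) ((cR y).differentiableAt (by simp))]
    have hz : Hop σ (Gk σ) (z - (h, y)) = 0 := Hop_Gk_pos hσ _ (by simp; linarith)
    have e1 := hR0 (h, y)
    rw [hz] at e1
    have e2 : dv et (fun q => Gk σ (z - q)) (h, y) = -dv et (Gk σ) (z - (h, y)) :=
      dv_comp_sub _ _ _ _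
    have e3 : dv et (fun q => Gk σ (z - q)) (h, y) =
        -(σ ^ 2 / 2 * ∑ i, dv (ex i) (dv (ex i) fun q => Gk σ (z - q)) (h, y)) := by
      unfold Hop at e1
      linarith
    rw [e3]
    have e4 : dv et (Ak σ χ) (h, y) = -rk σ χ (h, y) +
        σ ^ 2 / 2 * ∑ i, dv (ex i) (dv (ex i) (Ak σ χ)) (h, y) := by
      rw [rk, if_neg (hne y)]; unfold Hop; ring
    rw [e4, Finset.sum_sub_distrib, ← Finset.sum_mul, ← Finset.mul_sum]
    ring
  -- continuity helpers
  have sl : ∀ k : ℝ × (Fin d → ℝ) → ℝ, (∀ y, ContDiffAt ℝ (⊤ : ℕ∞) k (h, y)) →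
      Continuous fun y => k (h, y) := fun k hk => continuous_iff_continuousAt.2 fun y =>
    ContinuousAt.comp (f := fun y : Fin d → ℝ => (h, y)) (hk y).continuousAt (by fun_prop)
  have zA : ∀ p : ℝ × (Fin d → ℝ), χ.rOut < ‖p‖ → Ak σ χ =ᶠ[𝓝 p] fun _ => 0 := fun p hp => by
    filter_upwards [continuous_norm.continuousAt.eventually (lt_mem_nhds hp)] with q hq
    exact Ak_zero χ q hq.le
  have sup : ∀ k : ℝ × (Fin d → ℝ) → ℝ, (∀ p, χ.rOut < ‖p‖ → k p = 0) →
      HasCompactSupport fun y => k (h, y) := fun k hk => by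
    refine HasCompactSupport.intro (isCompact_closedBall (0 : Fin d → ℝ) χ.rOut) fun y hy => hk _ ?_
    have : χ.rOut < ‖y‖ := by simpa using hy
    exact this.trans_le (norm_snd_le (h, y))
  have i1 : ∀ i : Fin d, Integrable fun y =>
      dv (ex i) (dv (ex i) (Ak σ χ)) (h, y) * Gk σ (z - (h, y)) := fun i =>
    ((sl _ fun y => contDiffAt_dv (contDiffAt_dv (cA y))).mul
      (sl _ cR)).integrable_of_hasCompactSupport (sup _ fun p hp => by
        rw [(dv_congr (dv_congr (zA p hp))).eq_of_nhds, dv_zero, dv_zero]).mul_right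
  have i2 : ∀ i : Fin d, Integrable fun y =>
      Ak σ χ (h, y) * dv (ex i) (dv (ex i) fun q => Gk σ (z - q)) (h, y) := fun i =>
    ((sl _ cA).mul (sl _ fun y => contDiffAt_dv (contDiffAt_dv (cR y)))).integrable_of_hasCompactSupport
      (sup _ fun p hp => Ak_zero χ p hp.le).mul_right
  have i3 : Integrable fun y => rk σ χ (h, y) * Gk σ (z - (h, y)) :=
    ((sl _ fun y => (rk_contDiff hσ χ).contDiffAt).mul (sl _ cR)).integrable_of_hasCompactSupport
      (sup _ fun p hp => rk_zero χ p hp).mul_right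
  simp only [hpt]
  have i12 : ∀ i : Fin d, Integrable fun y =>
      dv (ex i) (dv (ex i) (Ak σ χ)) (h, y) * Gk σ (z - (h, y)) -
      Ak σ χ (h, y) * dv (ex i) (dv (ex i) fun q => Gk σ (z - q)) (h, y) := fun i => (i1 i).sub (i2 i)
  have i3n : Integrable fun y => -(rk σ χ (h, y) * Gk σ (z - (h, y))) := i3.neg
  rw [integral_add i3n ((integrable_finsetSum _ fun i _ => i12 i).const_mul _),
    integral_neg, integral_const_mul, integral_finsetSum _ fun i _ => i12 i]
  rw [Finset.sum_eq_zero, mul_zero, add_zero]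
  intro i _
  rw [integral_sub (i1 i) (i2 i)]
  have b1 := slice_ibp h i (fun y => contDiffAt_dv (v := ex i) (cA y)) cR (R := χ.rOut + 1)
    (fun p hp => by
      rw [(dv_congr (zA p (by linarith))).eq_of_nhds, dv_zero])
  have b2 := slice_ibp h i cA (fun y => contDiffAt_dv (v := ex i) (cR y)) (R := χ.rOut)
    (fun p hp => Ak_zero χ p hp)
  rw [b2, b1]; ring

theorem phi_hasDerivAt {d : ℕ} {σ : ℝ} (hσ : 0 < σ) (χ : ContDiffBump (0 : ℝ × (Fin d → ℝ)))
    (z : ℝ × (Fin d → ℝ)) (h : ℝ) (h0 : 0 < h) (h1 : h < z.1) :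
    HasDerivAt (fun h => ∫ y, Ak σ χ (h, y) * Gk σ (z - (h, y)))
      (-∫ y, rk σ χ (h, y) * Gk σ (z - (h, y))) h := by
  rw [← phi_deriv_eq hσ χ z h h0 h1]
  obtain ⟨a, ha0, ha⟩ := exists_between h0
  obtain ⟨b, hb0, hb⟩ := exists_between h1
  set F : ℝ × (Fin d → ℝ) → ℝ := fun q => Ak σ χ q * Gk σ (z - q) with hF
  have cF : ∀ p : ℝ × (Fin d → ℝ), 0 < p.1 → p.1 < z.1 → ContDiffAt ℝ (⊤ : ℕ∞) F p := by
    intro p hp hp1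
    refine (Ak_contDiffAt hσ χ p ?_).mul (Rk_contDiffAt hσ z p hp1)
    rintro rfl; simp at hp
  have zF : ∀ p : ℝ × (Fin d → ℝ), χ.rOut < ‖p‖ → F =ᶠ[𝓝 p] fun _ => 0 := fun p hp => by
    filter_upwards [continuous_norm.continuousAt.eventually (lt_mem_nhds hp)] with q hq
    rw [hF]; simp only; rw [Ak_zero χ q hq.le, zero_mul]
  have hcomp : IsCompact (Icc a b ×ˢ Metric.closedBall (0 : Fin d → ℝ) χ.rOut) :=
    isCompact_Icc.prod (isCompact_closedBall _ _)
  obtain ⟨C, hC⟩ := hcomp.exists_bound_of_continuousOn (f := dv et F) (fun p hp => by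
    have h1 : a ≤ p.1 := hp.1.1
    have h2 : p.1 ≤ b := hp.1.2
    exact (contDiffAt_dv (cF p (by linarith) (by linarith))).continuousAt.continuousWithinAt)
  have mF : ∀ h', Measurable fun y => F (h', y) := by
    intro h'
    have m1 : Measurable (Ak (d := d) σ χ) := χ.continuous.measurable.mul Gk_measurable
    exact (m1.mul (Gk_measurable.comp (measurable_const.sub measurable_id))).comp
      (measurable_const.prodMk measurable_id)
  have slc : Continuous fun y => F (h, y) := continuous_iff_continuousAt.2 fun y =>
    ContinuousAt.comp (f := fun y : Fin d → ℝ => (h, y)) (cF (h, y) h0 h1).continuousAt (by fun_prop)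
  have sldc : Continuous fun y => dv et F (h, y) := continuous_iff_continuousAt.2 fun y =>
    ContinuousAt.comp (f := fun y : Fin d → ℝ => (h, y)) (contDiffAt_dv (cF (h, y) h0 h1)).continuousAt
      (by fun_prop)
  refine (hasDerivAt_integral_of_dominated_loc_of_deriv_le (F := fun h y => F (h, y))
    (F' := fun h y => dv et F (h, y)) (s := Ioo a b)
    (bound := indicator (Metric.closedBall 0 χ.rOut) fun _ => C)
    (Ioo_mem_nhds ha hb0) (Eventually.of_forall fun h' => (mF h').aestronglyMeasurable) ?_
    sldc.aestronglyMeasurable ?_ ?_ ?_).2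
  · refine slc.integrable_of_hasCompactSupport ?_
    refine HasCompactSupport.intro (isCompact_closedBall (0 : Fin d → ℝ) χ.rOut) fun y hy => ?_
    have : χ.rOut < ‖y‖ := by simpa using hy
    exact (zF _ (this.trans_le (norm_snd_le (h, y)))).eq_of_nhds
  · refine Eventually.of_forall fun y h' hh' => ?_
    by_cases hy : y ∈ Metric.closedBall (0 : Fin d → ℝ) χ.rOut
    · rw [indicator_of_mem hy]
      exact hC _ ⟨⟨hh'.1.le, hh'.2.le⟩, hy⟩
    · rw [indicator_of_notMem hy]
      have : χ.rOut < ‖y‖ := by simpa using hy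
      rw [(dv_congr (zF _ (this.trans_le (norm_snd_le (h', y))))).eq_of_nhds, dv_zero, norm_zero]
  · refine (integrable_indicator_iff Metric.isClosed_closedBall.measurableSet).2 ?_
    exact continuous_const.continuousOn.integrableOn_compact (isCompact_closedBall _ _)
  · refine Eventually.of_forall fun y h' hh' => ?_
    have hd := dv_hasDerivAt (v := et)
      ((cF (h', y) (by have := hh'.1; simp; linarith) (by have := hh'.2; simp; linarith)).differentiableAt
        (by simp))
    have e : (fun t : ℝ => F ((h', y) + t • et)) = fun t => F (h' + t, y) := by
      funext t; simp [et]
    rw [e] at hd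
    have hd2 : HasDerivAt (fun t : ℝ => F (h' + t, y)) (dv et F (h', y)) (h' - h') := by simpa using hd
    have hd3 : HasDerivAt (fun t : ℝ => t - h') 1 h' := (hasDerivAt_id h').sub_const h'
    have := HasDerivAt.comp (h := fun t : ℝ => t - h') h' hd2 hd3
    simpa [Function.comp_def] using this

theorem Gk_bound {d : ℕ} {σ : ℝ} (hσ : 0 < σ) {a : ℝ} (ha : 0 < a) (p : ℝ × (Fin d → ℝ)) (hp : a ≤ p.1) :
    Gk σ p ≤ ((√(2 * Real.pi * σ ^ 2 * a))⁻¹) ^ d := by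
  have h : 0 < p.1 := ha.trans_le hp
  simp only [Gk, h, if_true]
  calc _ ≤ ((√(2 * Real.pi * σ ^ 2 * p.1))⁻¹) ^ d * 1 := by
        gcongr
        rw [Real.exp_le_one_iff]
        apply div_nonpos_of_nonpos_of_nonneg
        · simp only [Left.neg_nonpos_iff]; positivity
        · positivity
    _ ≤ _ := by
        rw [mul_one]
        gcongr

theorem phi_tendsto_zero {d : ℕ} {σ : ℝ} (hσ : 0 < σ) (χ : ContDiffBump (0 : ℝ × (Fin d → ℝ)))
    (z : ℝ × (Fin d → ℝ)) (hz : 0 < z.1) :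
    Tendsto (fun h => ∫ y, Ak σ χ (h, y) * Gk σ (z - (h, y))) (𝓝[>] 0) (𝓝 (Gk σ z)) := by
  have e : ∀ h : ℝ, 0 < h → ∫ y, Ak σ χ (h, y) * Gk σ (z - (h, y)) =
      ∫ w, χ (h, (σ * √h) • w) * Gk σ (z - (h, (σ * √h) • w)) ∂gam d := by
    intro h hh
    have m : Measurable fun y => χ (h, y) * Gk σ (z - (h, y)) :=
      (χ.continuous.measurable.mul (Gk_measurable.comp (measurable_const.sub measurable_id))).comp
        (measurable_const.prodMk measurable_id)
    have := P_density hσ hh m 0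
    simp only [P, zero_add] at this
    rw [this]
    exact integral_congr_ae (Eventually.of_forall fun y => by simp only [Ak]; ring)
  have hz2 : ∀ᶠ h : ℝ in 𝓝[>] 0, h ∈ Ioo 0 (z.1 / 2) := Ioo_mem_nhdsGT (by linarith)
  have hlim : Tendsto (fun h : ℝ => ∫ w, χ (h, (σ * √h) • w) * Gk σ (z - (h, (σ * √h) • w)) ∂gam d)
      (𝓝[>] 0) (𝓝 (∫ _w, Gk σ z ∂gam d)) := by
    refine tendsto_integral_filter_of_dominated_convergence
      (fun _ => ((√(2 * Real.pi * σ ^ 2 * (z.1 / 2)))⁻¹) ^ d) ?_ ?_ (integrable_const _) ?_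
    · refine Eventually.of_forall fun h => ?_
      have m : Measurable fun y => χ (h, y) * Gk σ (z - (h, y)) :=
        (χ.continuous.measurable.mul (Gk_measurable.comp (measurable_const.sub measurable_id))).comp
          (measurable_const.prodMk measurable_id)
      exact (m.comp (measurable_id.const_smul (σ * √h))).aestronglyMeasurable
    · filter_upwards [hz2] with h hh
      refine Eventually.of_forall fun w => ?_
      rw [Real.norm_eq_abs, abs_of_nonneg (mul_nonneg χ.nonneg (Gk_nonneg _))]
      calc _ ≤ 1 * Gk σ (z - (h, (σ * √h) • w)) :=
            mul_le_mul_of_nonneg_right χ.le_one (Gk_nonneg _)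
        _ ≤ _ := by
          rw [one_mul]; refine Gk_bound hσ (by linarith) _ ?_
          have := hh.2
          simp; linarith
    · refine Eventually.of_forall fun w => ?_
      have c : Tendsto (fun h : ℝ => ((h, (σ * √h) • w) : ℝ × (Fin d → ℝ))) (𝓝[>] 0) (𝓝 0) := by
        have : Continuous fun h : ℝ => ((h, (σ * √h) • w) : ℝ × (Fin d → ℝ)) := by fun_prop
        have h := this.tendsto 0
        simp only [Real.sqrt_zero, mul_zero, zero_smul] at h
        exact h.mono_left nhdsWithin_le_nhds
      have c1 := (χ.continuous.tendsto 0).comp c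
      rw [χ.one_of_mem_closedBall (Metric.mem_closedBall_self χ.rIn_pos.le)] at c1
      have hz0 : z ≠ 0 := by rintro rfl; simp at hz
      have c2 : Tendsto (Gk σ) (𝓝 (z - 0)) (𝓝 (Gk σ z)) := by
        rw [sub_zero]; exact (Gk_contDiffAt hσ z hz0).continuousAt
      have c3 := c1.mul (c2.comp (c.const_sub z))
      simpa [Function.comp_def] using c3
  rw [integral_const] at hlim
  simp only [probReal_univ, one_smul] at hlim
  refine hlim.congr' ?_
  filter_upwards [self_mem_nhdsWithin] with h hh
  exact (e h hh).symm

theorem phi_tendsto_end {d : ℕ} {σ : ℝ} (hσ : 0 < σ) (χ : ContDiffBump (0 : ℝ × (Fin d → ℝ)))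
    (z : ℝ × (Fin d → ℝ)) (hz : 0 < z.1) :
    Tendsto (fun h => ∫ y, Ak σ χ (h, y) * Gk σ (z - (h, y))) (𝓝[<] z.1) (𝓝 (Ak σ χ z)) := by
  have mA : Measurable (Ak (d := d) σ χ) := χ.continuous.measurable.mul Gk_measurable
  have mA' : ∀ h : ℝ, Measurable fun y => Ak σ χ (h, y) := fun h =>
    mA.comp (measurable_const.prodMk measurable_id)
  have e : ∀ h : ℝ, h < z.1 → ∫ y, Ak σ χ (h, y) * Gk σ (z - (h, y)) =
      ∫ w, Ak σ χ (h, z.2 + (σ * √(z.1 - h)) • w) ∂gam d := by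
    intro h hh
    have := P_density' hσ (sub_pos.2 hh) (mA' h) z.2
    simp only [P] at this
    rw [this]
    exact integral_congr_ae (Eventually.of_forall fun y => by
      simp only [mul_comm]; rfl)
  have hz2 : ∀ᶠ h : ℝ in 𝓝[<] z.1, h ∈ Ioo (z.1 / 2) z.1 := Ioo_mem_nhdsLT (by linarith)
  have hlim : Tendsto (fun h : ℝ => ∫ w, Ak σ χ (h, z.2 + (σ * √(z.1 - h)) • w) ∂gam d)
      (𝓝[<] z.1) (𝓝 (∫ _w, Ak σ χ z ∂gam d)) := by
    refine tendsto_integral_filter_of_dominated_convergence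
      (fun _ => ((√(2 * Real.pi * σ ^ 2 * (z.1 / 2)))⁻¹) ^ d) ?_ ?_ (integrable_const _) ?_
    · refine Eventually.of_forall fun h => ?_
      exact ((mA' h).comp (measurable_const.add
        (measurable_id.const_smul (σ * √(z.1 - h))))).aestronglyMeasurable
    · filter_upwards [hz2] with h hh
      refine Eventually.of_forall fun w => ?_
      rw [Real.norm_eq_abs, Ak, abs_of_nonneg (mul_nonneg χ.nonneg (Gk_nonneg _))]
      calc _ ≤ 1 * Gk σ (h, z.2 + (σ * √(z.1 - h)) • w) :=
            mul_le_mul_of_nonneg_right χ.le_one (Gk_nonneg _)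
        _ ≤ _ := by
          rw [one_mul]; exact Gk_bound hσ (by linarith) _ hh.1.le
    · refine Eventually.of_forall fun w => ?_
      have c : Tendsto (fun h : ℝ => ((h, z.2 + (σ * √(z.1 - h)) • w) : ℝ × (Fin d → ℝ))) (𝓝[<] z.1)
          (𝓝 z) := by
        have : Continuous fun h : ℝ => ((h, z.2 + (σ * √(z.1 - h)) • w) : ℝ × (Fin d → ℝ)) := by
          fun_prop
        have h := this.tendsto z.1
        simp only [sub_self, Real.sqrt_zero, mul_zero, zero_smul, add_zero] at h
        exact h.mono_left nhdsWithin_le_nhds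
      have hz0 : z ≠ 0 := by rintro rfl; simp at hz
      exact (Ak_contDiffAt hσ χ z hz0).continuousAt.tendsto.comp c
  rw [integral_const] at hlim
  simp only [probReal_univ, one_smul] at hlim
  refine hlim.congr' ?_
  filter_upwards [self_mem_nhdsWithin] with h hh
  exact (e h hh).symm

theorem cv_rk_integrable {d : ℕ} {σ : ℝ} (hσ : 0 < σ) {r : ℝ × (Fin d → ℝ) → ℝ} (hr : Continuous r)
    (hc : HasCompactSupport r) (z : ℝ × (Fin d → ℝ)) :
    Integrable fun q => r q * Gk σ (z - q) := by
  have := (cv_integrable hr hc (Gk_locallyIntegrable hσ) z).comp_sub_left z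
  simpa [mul_comm] using this

theorem cv_swap {d : ℕ} (r W : ℝ × (Fin d → ℝ) → ℝ) (p : ℝ × (Fin d → ℝ)) :
    cv r W p = ∫ q, r q * W (p - q) := by
  unfold cv
  rw [← integral_sub_left_eq_self (fun q => W q * r (p - q)) volume p]
  simp [mul_comm]

theorem cv_rk_Gk {d : ℕ} {σ : ℝ} (hσ : 0 < σ) (χ : ContDiffBump (0 : ℝ × (Fin d → ℝ)))
    (z : ℝ × (Fin d → ℝ)) (hz : 0 < z.1) : cv (rk σ χ) (Gk σ) z = Gk σ z - Ak σ χ z := by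
  rw [cv_swap]
  have hintg := cv_rk_integrable hσ (rk_contDiff hσ χ).continuous (rk_compact χ) z
  have hintg' := hintg
  rw [Measure.volume_eq_prod] at hintg'
  rw [Measure.volume_eq_prod, integral_prod _ hintg']
  have hI := hintg'.integral_prod_left
  have hft := intervalIntegral.integral_eq_sub_of_hasDerivAt_of_tendsto
    (f := fun h => ∫ y, Ak σ χ (h, y) * Gk σ (z - (h, y)))
    (f' := fun h => -∫ y, rk σ χ (h, y) * Gk σ (z - (h, y))) hz
    (fun h hh => phi_hasDerivAt hσ χ z h hh.1 hh.2) hI.neg.intervalIntegrable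
    (phi_tendsto_zero hσ χ z hz) (phi_tendsto_end hσ χ z hz)
  rw [intervalIntegral.integral_neg, intervalIntegral.integral_of_le hz.le,
    setIntegral_eq_integral_of_forall_compl_eq_zero] at hft
  · linarith
  · intro h hh
    rw [integral_eq_zero_of_ae]
    refine Eventually.of_forall fun y => ?_
    simp only [mem_Ioc, not_and_or, not_lt, not_le] at hh
    rcases hh with hh | hh
    · simp [rk_nonpos hσ χ (h, y) hh]
    · have : ¬ 0 < (z - (h, y)).1 := by simp; linarith
      have g0 : Gk σ (z - (h, y)) = 0 := if_neg this
      simp [g0]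

end Casc

open Set Filter
open scoped Topology

namespace Casc
open MeasureTheory ProbabilityTheory

/-- heat evolution of `g` started at time `a` (zero before) -/
noncomputable def Wk {d : ℕ} (σ a : ℝ) (g : (Fin d → ℝ) → ℝ) (q : ℝ × (Fin d → ℝ)) : ℝ :=
  if a ≤ q.1 then P σ (q.1 - a) g q.2 else 0

theorem Wk_measurable {d : ℕ} {σ a : ℝ} {g : (Fin d → ℝ) → ℝ} (hg : Measurable g) :
    Measurable (Wk σ a g) := by
  unfold Wk
  refine Measurable.ite (measurableSet_le measurable_const measurable_fst) ?_ measurable_const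
  exact (P_measurable_joint hg).comp ((measurable_fst.sub measurable_const).prodMk measurable_snd)

theorem cv_Hop_rk_Gk {d : ℕ} {σ : ℝ} (hσ : 0 < σ) (χ : ContDiffBump (0 : ℝ × (Fin d → ℝ)))
    (z : ℝ × (Fin d → ℝ)) (hz : 0 < z.1) (hz2 : χ.rOut < ‖z‖) :
    cv (Hop σ (rk σ χ)) (Gk σ) z = 0 := by
  rw [← Hop_cv (rk_contDiff hσ χ) (rk_compact χ) (Gk_locallyIntegrable hσ)]
  have : cv (rk σ χ) (Gk σ) =ᶠ[𝓝 z] Gk σ := by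
    filter_upwards [continuous_norm.continuousAt.eventually (lt_mem_nhds hz2),
      continuous_fst.continuousAt.eventually (lt_mem_nhds hz)] with q h1 h2
    rw [cv_rk_Gk hσ χ q h2, Ak_zero χ q h1.le, sub_zero]
  rw [Hop_congr this, Hop_Gk_pos hσ z hz]

theorem slab_null {d : ℕ} (c : ℝ) : ∀ᵐ q : ℝ × (Fin d → ℝ), q.1 ≠ c := by
  rw [ae_iff]
  have : {q : ℝ × (Fin d → ℝ) | ¬ q.1 ≠ c} = {c} ×ˢ univ := by
    ext q; simp
  rw [this, Measure.volume_eq_prod, Measure.prod_prod]; simp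

theorem cv_Wk {d : ℕ} {σ : ℝ} (hσ : 0 < σ) {r : ℝ × (Fin d → ℝ) → ℝ} (hr : Continuous r)
    (hc : HasCompactSupport r) (a : ℝ) {g : (Fin d → ℝ) → ℝ} (hg : BM g) (p : ℝ × (Fin d → ℝ)) :
    cv r (Wk σ a g) p = ∫ y, g y * cv r (Gk σ) (p - (a, y)) := by
  obtain ⟨hgm, C, hC⟩ := hg
  have hGle : ∀ q : ℝ × (Fin d → ℝ), Integrable (fun y => Gk σ (p - q - (a, y))) ∧
      ∫ y, Gk σ (p - q - (a, y)) ≤ 1 := by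
    intro q
    rcases lt_or_ge a (p.1 - q.1) with h | h
    · have hh : 0 < p.1 - q.1 - a := by linarith
      have e : (fun y : Fin d → ℝ => Gk σ (p - q - (a, y))) =
        fun y => (fun w => Gk σ (p.1 - q.1 - a, w)) ((p.2 - q.2) - y) := rfl
      refine ⟨?_, ?_⟩
      · rw [e]; exact (Gk_integrable hσ hh).comp_sub_left _
      · rw [e, integral_sub_left_eq_self (fun w => Gk σ (p.1 - q.1 - a, w)) volume (p.2 - q.2), Gk_integral hσ hh]
    · have e : ∀ y : Fin d → ℝ, Gk σ (p - q - (a, y)) = 0 := fun y => if_neg (by simp; linarith)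
      simp [e]
  have mK : Measurable fun s : (ℝ × (Fin d → ℝ)) × (Fin d → ℝ) =>
      r s.1 * (Gk σ (p - s.1 - (a, s.2)) * g s.2) := by
    refine (hr.measurable.comp measurable_fst).mul (Measurable.mul ?_ (hgm.comp measurable_snd))
    exact Gk_measurable.comp ((measurable_const.sub measurable_fst).sub
      (measurable_const.prodMk measurable_snd))
  have hintg : Integrable (fun s : (ℝ × (Fin d → ℝ)) × (Fin d → ℝ) =>
      r s.1 * (Gk σ (p - s.1 - (a, s.2)) * g s.2)) (volume.prod volume) := by
    rw [integrable_prod_iff mK.aestronglyMeasurable]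
    have hb : ∀ (q : ℝ × (Fin d → ℝ)) (y : Fin d → ℝ),
      ‖r q * (Gk σ (p - q - (a, y)) * g y)‖ ≤ (‖r q‖ * C) * Gk σ (p - q - (a, y)) := by
      intro q y
      rw [norm_mul, norm_mul, Real.norm_eq_abs (Gk σ _), abs_of_nonneg (Gk_nonneg _), mul_assoc]
      have := hC y
      refine mul_le_mul_of_nonneg_left ?_ (norm_nonneg _)
      rw [mul_comm]
      exact mul_le_mul_of_nonneg_right (by simpa using this) (Gk_nonneg _)
    have hq : ∀ q : ℝ × (Fin d → ℝ), Integrable fun y => r q * (Gk σ (p - q - (a, y)) * g y) :=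
      fun q => ((hGle q).1.const_mul (‖r q‖ * C)).mono'
        (mK.comp (measurable_const.prodMk measurable_id)).aestronglyMeasurable
        (Eventually.of_forall (hb q))
    refine ⟨Eventually.of_forall hq, ?_⟩
    have hri : Integrable fun q => ‖r q‖ * C :=
      (hr.integrable_of_hasCompactSupport hc).norm.mul_const C
    refine hri.mono' (mK.aestronglyMeasurable.norm.integral_prod_right') ?_
    refine Eventually.of_forall fun q => ?_
    rw [Real.norm_eq_abs, abs_of_nonneg (integral_nonneg fun y => norm_nonneg _)]
    have hC0 : 0 ≤ C := (abs_nonneg _).trans (hC 0)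
    calc _ ≤ ∫ y, (‖r q‖ * C) * Gk σ (p - q - (a, y)) :=
          integral_mono (hq q).norm ((hGle q).1.const_mul _) (hb q)
      _ = (‖r q‖ * C) * ∫ y, Gk σ (p - q - (a, y)) := integral_const_mul _ _
      _ ≤ (‖r q‖ * C) * 1 := by gcongr; exact (hGle q).2
      _ = _ := mul_one _
  have e1 : cv r (Wk σ a g) p = ∫ q, ∫ y, r q * (Gk σ (p - q - (a, y)) * g y) := by
    rw [cv_swap]
    refine integral_congr_ae ?_
    filter_upwards [slab_null (p.1 - a)] with q hq
    rw [integral_const_mul]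
    congr 1
    rcases lt_trichotomy a (p.1 - q.1) with h | h | h
    · have hh : 0 < p.1 - q.1 - a := by linarith
      have : a ≤ (p - q).1 := h.le
      rw [Wk, if_pos this]
      exact P_density' hσ hh hgm (p - q).2
    · exact absurd (by linarith) hq
    · have : ¬ a ≤ (p - q).1 := not_le.2 h
      rw [Wk, if_neg this]
      have e : ∀ y : Fin d → ℝ, Gk σ (p - q - (a, y)) = 0 := fun y => if_neg (by simp; linarith)
      simp [e]
  rw [e1, integral_integral_swap hintg]
  refine integral_congr_ae (Eventually.of_forall fun y => ?_)
  simp only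
  rw [cv_swap, ← integral_const_mul]
  refine integral_congr_ae (Eventually.of_forall fun q => ?_)
  simp only
  rw [sub_right_comm p q]; ring

theorem mean_value {d : ℕ} {σ : ℝ} (hσ : 0 < σ) {r : ℝ} (hr : 0 < r) :
    ∃ ρ : ℝ × (Fin d → ℝ) → ℝ, ContDiff ℝ (⊤ : ℕ∞) ρ ∧ HasCompactSupport ρ ∧
      (∀ q, q.1 ≤ 0 → ρ q = 0) ∧ (∀ q, r ≤ ‖q‖ → ρ q = 0) ∧
      ∀ (a : ℝ) (g : (Fin d → ℝ) → ℝ), BM g → ∀ p : ℝ × (Fin d → ℝ),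
        (∀ y, g y ≠ 0 → r ≤ ‖p - (a, y)‖) →
        cv ρ (Wk σ a g) p = Wk σ a g p ∧ cv (Hop σ ρ) (Wk σ a g) p = 0 := by
  let χ : ContDiffBump (0 : ℝ × (Fin d → ℝ)) := ⟨r / 4, r / 2, by linarith, by linarith⟩
  have hout : χ.rOut = r / 2 := rfl
  have cρ := rk_contDiff hσ χ
  have sρ : HasCompactSupport (rk σ χ) := rk_compact χ
  refine ⟨rk σ χ, cρ, sρ, rk_nonpos hσ χ, fun q hq => rk_zero χ q (by rw [hout]; linarith), ?_⟩
  intro a g hg p hp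
  rcases lt_or_ge a p.1 with h | h
  · rw [cv_Wk hσ cρ.continuous sρ a hg p,
      cv_Wk hσ (Hop_contDiff cρ).continuous (Hop_compact sρ) a hg p]
    have hz : ∀ y : Fin d → ℝ, 0 < (p - (a, y)).1 := fun y => by simp; linarith
    constructor
    · rw [Wk, if_pos h.le, P_density' hσ (sub_pos.2 h) hg.1]
      refine integral_congr_ae (Eventually.of_forall fun y => ?_)
      simp only
      by_cases hy : g y = 0
      · simp [hy]
      · rw [cv_rk_Gk hσ χ _ (hz y), Ak_zero χ _ (by rw [hout]; linarith [hp y hy]), sub_zero, mul_comm]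
        rfl
    · rw [integral_eq_zero_of_ae]
      refine Eventually.of_forall fun y => ?_
      by_cases hy : g y = 0
      · simp [hy]
      · simp only [Pi.zero_apply]
        rw [cv_Hop_rk_Gk hσ χ _ (hz y) (by rw [hout]; linarith [hp y hy]), mul_zero]
  · have key : ∀ k : ℝ × (Fin d → ℝ) → ℝ, (∀ q, q.1 ≤ 0 → k q = 0) → cv k (Wk σ a g) p = 0 := by
      intro k hk
      rw [cv_swap, integral_eq_zero_of_ae]
      refine Eventually.of_forall fun q => ?_
      simp only [Pi.zero_apply]
      rcases lt_or_ge 0 q.1 with hq | hq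
      · have : ¬ a ≤ (p - q).1 := by simp; linarith
        rw [Wk, if_neg this, mul_zero]
      · rw [hk q hq, zero_mul]
    refine ⟨?_, key _ fun q hq => Hop_eq_zero_of_neg (rk_nonpos hσ χ) q cρ.contDiffAt hq⟩
    rw [key _ (rk_nonpos hσ χ)]
    rcases h.lt_or_eq with h' | h'
    · rw [Wk, if_neg (not_le.2 h')]
    · rw [Wk, if_pos h'.ge, h', sub_self, P_zero_time]
      by_contra hne
      have := hp p.2 (fun h0 => hne h0.symm)
      have e : p - (a, p.2) = 0 := by ext <;> simp [h']
      rw [e, norm_zero] at this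
      linarith

end Casc

open Set Filter
open scoped Topology

namespace Casc
open MeasureTheory ProbabilityTheory
set_option linter.unusedVariables false

/-- dyadic number `k 2^{-n}` -/
noncomputable def dy (n k : ℕ) : ℝ := k * (1 / 2 : ℝ) ^ n

theorem dy_nonneg (n k : ℕ) : 0 ≤ dy n k := by unfold dy; positivity

theorem dy_succ (n k : ℕ) : dy n (k + 1) = dy n k + (1 / 2 : ℝ) ^ n := by
  unfold dy; push_cast; ring

theorem dy_zero (n : ℕ) : dy n 0 = 0 := by simp [dy]

theorem dy_double (n k : ℕ) : dy (n + 1) (2 * k) = dy n k := by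
  unfold dy; push_cast; rw [pow_succ]; ring

theorem dy_add (n k m : ℕ) : dy n (k + m) = dy n k + dy n m := by
  unfold dy; push_cast; ring

/-- data of an obstacle problem -/
structure Obs {d : ℕ} (σ : ℝ) (u : ℝ → (Fin d → ℝ) → ℝ) (K : ℝ → Set (Fin d → ℝ)) : Prop where
  u01 : ∀ τ, 0 ≤ τ → ∀ x, u τ x ∈ Icc (0:ℝ) 1
  um : ∀ τ, 0 ≤ τ → Measurable (u τ)
  ua : ∀ τ, 0 ≤ τ → ∀ x y, x ≤ y → u τ y ≤ u τ x
  ut : ∀ s t, 0 ≤ s → s ≤ t → ∀ x, u s x ≤ u t x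
  us : ∀ (n k : ℕ) s, 0 ≤ s → ∀ x, P σ s (u (dy n k)) x ≤ u (dy n k + s) x
  Km : ∀ τ, 0 ≤ τ → MeasurableSet (K τ)
  Kd : ∀ τ, 0 ≤ τ → ∀ x y, x ≤ y → y ∈ K τ → x ∈ K τ
  Kt : ∀ s t, 0 ≤ s → s ≤ t → K s ⊆ K t
  Ko : IsOpen {p : ℝ × (Fin d → ℝ) | 0 < p.1 ∧ p.2 ∉ K p.1}

open Classical in
/-- replace `z` by the obstacle on the killed set -/
noncomputable def Fo {d : ℕ} (u : ℝ → (Fin d → ℝ) → ℝ) (K : ℝ → Set (Fin d → ℝ)) (τ : ℝ)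
    (z : (Fin d → ℝ) → ℝ) (x : Fin d → ℝ) : ℝ := if x ∈ K τ then u τ x else z x

/-- scheme at mesh points -/
noncomputable def Ws {d : ℕ} (σ : ℝ) (u : ℝ → (Fin d → ℝ) → ℝ) (K : ℝ → Set (Fin d → ℝ)) (n : ℕ) :
    ℕ → (Fin d → ℝ) → ℝ
  | 0 => Fo u K 0 (fun _ => 0)
  | k + 1 => Fo u K (dy n (k + 1)) (P σ ((1 / 2 : ℝ) ^ n) (Ws σ u K n k))

/-- mesh index -/
noncomputable def fl (n : ℕ) (τ : ℝ) : ℕ := ⌊τ / (1 / 2 : ℝ) ^ n⌋₊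

theorem fl_le (n : ℕ) {τ : ℝ} (h : 0 ≤ τ) : dy n (fl n τ) ≤ τ := by
  unfold dy fl
  have h2 : (0:ℝ) < (1 / 2) ^ n := by positivity
  rw [← le_div_iff₀ h2]
  exact Nat.floor_le (by positivity)

theorem lt_fl (n : ℕ) (τ : ℝ) : τ < dy n (fl n τ + 1) := by
  unfold dy fl
  have h2 : (0:ℝ) < (1 / 2) ^ n := by positivity
  rw [← div_lt_iff₀ h2]
  push_cast
  exact Nat.lt_floor_add_one _

theorem dy_mono (n : ℕ) {a b : ℕ} (h : a ≤ b) : dy n a ≤ dy n b := by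
  unfold dy; gcongr

theorem dy_lt_iff (n : ℕ) {a b : ℕ} : dy n a < dy n b ↔ a < b := by
  unfold dy
  rw [mul_lt_mul_iff_left₀ (by positivity)]; exact Nat.cast_lt

theorem fl_unique {n k : ℕ} {τ : ℝ} (h1 : dy n k ≤ τ) (h2 : τ < dy n (k + 1)) : fl n τ = k := by
  have h0 : 0 ≤ τ := (dy_nonneg n k).trans h1
  have a := (dy_lt_iff n).1 ((fl_le n h0).trans_lt h2)
  have b := (dy_lt_iff n).1 (h1.trans_lt (lt_fl n τ))
  omega

/-- scheme at all times -/
noncomputable def ws {d : ℕ} (σ : ℝ) (u : ℝ → (Fin d → ℝ) → ℝ) (K : ℝ → Set (Fin d → ℝ)) (n : ℕ)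
    (τ : ℝ) (x : Fin d → ℝ) : ℝ := P σ (τ - dy n (fl n τ)) (Ws σ u K n (fl n τ)) x

/-- limit of the scheme -/
noncomputable def vs {d : ℕ} (σ : ℝ) (u : ℝ → (Fin d → ℝ) → ℝ) (K : ℝ → Set (Fin d → ℝ))
    (τ : ℝ) (x : Fin d → ℝ) : ℝ := ⨆ n, ws σ u K n τ x

/-- solution of the obstacle problem -/
noncomputable def Vs {d : ℕ} (σ : ℝ) (u : ℝ → (Fin d → ℝ) → ℝ) (K : ℝ → Set (Fin d → ℝ))
    (τ : ℝ) : (Fin d → ℝ) → ℝ := Fo u K τ (vs σ u K τ)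

section scheme
variable {d : ℕ} {σ : ℝ} {u : ℝ → (Fin d → ℝ) → ℝ} {K : ℝ → Set (Fin d → ℝ)}

theorem Fo_mem {τ : ℝ} {z : (Fin d → ℝ) → ℝ} {x : Fin d → ℝ} (h : x ∈ K τ) :
    Fo u K τ z x = u τ x := if_pos h

theorem Fo_not {τ : ℝ} {z : (Fin d → ℝ) → ℝ} {x : Fin d → ℝ} (h : x ∉ K τ) :
    Fo u K τ z x = z x := if_neg h

theorem Obs.Fo_mono (H : Obs σ u K) {s t : ℝ} (hs : 0 ≤ s) (hst : s ≤ t)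
    {z z' : (Fin d → ℝ) → ℝ} (hz : ∀ x, z x ≤ z' x) (hu : ∀ x, z x ≤ u t x) (x : Fin d → ℝ) :
    Fo u K s z x ≤ Fo u K t z' x := by
  by_cases h1 : x ∈ K s
  · rw [Fo_mem h1, Fo_mem (H.Kt s t hs hst h1)]; exact H.ut s t hs hst x
  · rw [Fo_not h1]
    by_cases h2 : x ∈ K t
    · rw [Fo_mem h2]; exact hu x
    · rw [Fo_not h2]; exact hz x

theorem Obs.le_Fo (H : Obs σ u K) {t : ℝ}
    {z : (Fin d → ℝ) → ℝ} (hu : ∀ x, z x ≤ u t x) (x : Fin d → ℝ) :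
    z x ≤ Fo u K t z x := by
  by_cases h2 : x ∈ K t
  · rw [Fo_mem h2]; exact hu x
  · rw [Fo_not h2]

theorem Obs.Fo_le (H : Obs σ u K) {t : ℝ}
    {z : (Fin d → ℝ) → ℝ} (hu : ∀ x, z x ≤ u t x) (x : Fin d → ℝ) :
    Fo u K t z x ≤ u t x := by
  by_cases h2 : x ∈ K t
  · rw [Fo_mem h2]
  · rw [Fo_not h2]; exact hu x

theorem Obs.Fo_anti (H : Obs σ u K) {t : ℝ} (ht : 0 ≤ t)
    {z : (Fin d → ℝ) → ℝ} (hu : ∀ x, z x ≤ u t x) (ha : ∀ x y, x ≤ y → z y ≤ z x)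
    (x y : Fin d → ℝ) (hxy : x ≤ y) : Fo u K t z y ≤ Fo u K t z x := by
  by_cases h1 : y ∈ K t
  · rw [Fo_mem h1, Fo_mem (H.Kd t ht x y hxy h1)]; exact H.ua t ht x y hxy
  · rw [Fo_not h1]
    exact (ha x y hxy).trans (H.le_Fo hu x)

theorem Obs.Fo_meas (H : Obs σ u K) {t : ℝ} (ht : 0 ≤ t)
    {z : (Fin d → ℝ) → ℝ} (hm : Measurable z) : Measurable (Fo u K t z) := by
  unfold Fo
  exact Measurable.ite (H.Km t ht) (H.um t ht) hm

theorem Obs.Fo_01 (H : Obs σ u K) {t : ℝ} (ht : 0 ≤ t)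
    {z : (Fin d → ℝ) → ℝ} (hz : ∀ x, z x ∈ Icc (0:ℝ) 1) (x : Fin d → ℝ) :
    Fo u K t z x ∈ Icc (0:ℝ) 1 := by
  by_cases h1 : x ∈ K t
  · rw [Fo_mem h1]; exact H.u01 t ht x
  · rw [Fo_not h1]; exact hz x

theorem Obs.Ws_basic (H : Obs σ u K) (n k : ℕ) : Measurable (Ws σ u K n k) ∧
    (∀ x, Ws σ u K n k x ∈ Icc (0:ℝ) 1) ∧ (∀ x y, x ≤ y → Ws σ u K n k y ≤ Ws σ u K n k x) ∧
    (∀ x, Ws σ u K n k x ≤ u (dy n k) x) := by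
  induction k with
  | zero =>
    have h0 : ∀ x, (fun _ => (0:ℝ)) x ≤ u 0 x := fun x => (H.u01 0 le_rfl x).1
    rw [dy_zero]
    refine ⟨H.Fo_meas le_rfl measurable_const, H.Fo_01 le_rfl fun x => by simp,
      H.Fo_anti le_rfl h0 fun _ _ _ => le_rfl, H.Fo_le h0⟩
  | succ k ih =>
    obtain ⟨h1, h2, h3, h4⟩ := ih
    have hb := BM.of_mem_Icc h1 h2
    have hh : (0:ℝ) ≤ (1 / 2) ^ n := by positivity
    have h0 : ∀ x, P σ ((1 / 2 : ℝ) ^ n) (Ws σ u K n k) x ≤ u (dy n (k + 1)) x := fun x => by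
      rw [dy_succ]
      exact (P_mono hb (BM.of_mem_Icc (H.um _ (dy_nonneg _ _)) (H.u01 _ (dy_nonneg _ _))) h4 x).trans
        (H.us n k _ hh x)
    have hd := dy_nonneg n (k + 1)
    exact ⟨H.Fo_meas hd hb.P.1, H.Fo_01 hd (P_mem_Icc h1 h2),
      H.Fo_anti hd h0 fun x y hxy => P_antitone hb h3 hxy, H.Fo_le h0⟩

theorem Obs.Ws_BM (H : Obs σ u K) (n k : ℕ) : BM (Ws σ u K n k) :=
  BM.of_mem_Icc (H.Ws_basic n k).1 (H.Ws_basic n k).2.1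

theorem Obs.u_BM (H : Obs σ u K) {τ : ℝ} (h : 0 ≤ τ) : BM (u τ) :=
  BM.of_mem_Icc (H.um τ h) (H.u01 τ h)

theorem Obs.PWs_le_u (H : Obs σ u K) (n k : ℕ) {s : ℝ} (hs : 0 ≤ s) (x : Fin d → ℝ) :
    P σ s (Ws σ u K n k) x ≤ u (dy n k + s) x :=
  (P_mono (H.Ws_BM n k) (H.u_BM (dy_nonneg _ _)) (H.Ws_basic n k).2.2.2 x).trans (H.us n k s hs x)

theorem Obs.PWs_le_Ws (H : Obs σ u K) (n k : ℕ) (x : Fin d → ℝ) :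
    P σ ((1 / 2 : ℝ) ^ n) (Ws σ u K n k) x ≤ Ws σ u K n (k + 1) x := by
  refine H.le_Fo (fun x => ?_) x
  rw [dy_succ]
  exact H.PWs_le_u n k (by positivity) x

theorem Obs.PWs_le_Ws' (H : Obs σ u K) (n k m : ℕ) (x : Fin d → ℝ) :
    P σ (dy n m) (Ws σ u K n k) x ≤ Ws σ u K n (k + m) x := by
  induction m generalizing x with
  | zero => simp [dy_zero, P_zero_time]
  | succ m ih =>
    rw [dy_succ, add_comm (dy n m), ← P_semigroup (by positivity) (dy_nonneg _ _) (H.Ws_BM n k)]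
    exact (P_mono (H.Ws_BM n k).P (H.Ws_BM n _) ih x).trans (H.PWs_le_Ws n (k + m) x)

theorem Obs.Ws_succ_le (H : Obs σ u K) (n k : ℕ) (x : Fin d → ℝ) :
    Ws σ u K n k x ≤ Ws σ u K n (k + 1) x := by
  induction k generalizing x with
  | zero =>
    exact H.Fo_mono le_rfl (dy_nonneg n 1) (fun x => (P_mem_Icc (H.Ws_basic n 0).1
      (H.Ws_basic n 0).2.1 x).1) (fun x => (H.u01 _ (dy_nonneg n 1) x).1) x
  | succ k ih =>
    have hle : dy n (k + 1) ≤ dy n (k + 1 + 1) := dy_mono n (by omega)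
    refine H.Fo_mono (dy_nonneg n (k + 1)) hle
      (fun x => P_mono (H.Ws_BM n k) (H.Ws_BM n _) ih x) (fun x => ?_) x
    refine (H.PWs_le_u n k (by positivity) x).trans ?_
    rw [← dy_succ]
    exact H.ut _ _ (dy_nonneg _ _) hle x

theorem Obs.Ws_mono (H : Obs σ u K) (n k m : ℕ) (x : Fin d → ℝ) :
    Ws σ u K n k x ≤ Ws σ u K n (k + m) x := by
  induction m with
  | zero => exact le_rfl
  | succ m ih => exact ih.trans (H.Ws_succ_le n (k + m) x)

theorem Obs.P_half (H : Obs σ u K) (n k : ℕ) {s : ℝ} (hs : 0 ≤ s) (x : Fin d → ℝ) :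
    P σ (s + (1 / 2 : ℝ) ^ n) (Ws σ u K n k) x ≤ P σ s (Ws σ u K n (k + 1)) x := by
  rw [← P_semigroup hs (by positivity) (H.Ws_BM n k)]
  exact P_mono (H.Ws_BM n k).P (H.Ws_BM n _) (H.PWs_le_Ws n k) x

theorem Obs.Ws_refine (H : Obs σ u K) (n k : ℕ) (x : Fin d → ℝ) :
    Ws σ u K n k x ≤ Ws σ u K (n + 1) (2 * k) x := by
  induction k generalizing x with
  | zero => exact le_rfl
  | succ k ih =>
    have e : 2 * (k + 1) = (2 * k + 1) + 1 := by ring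
    rw [e]
    have hd : dy (n + 1) (2 * k + 1 + 1) = dy n (k + 1) := by rw [← e, dy_double]
    change Fo u K _ _ x ≤ Fo u K _ _ x
    rw [hd]
    refine H.Fo_mono (dy_nonneg _ _) le_rfl (fun x => ?_) (fun x => ?_) x
    · have h1 := H.P_half (n + 1) (2 * k) (s := (1 / 2 : ℝ) ^ (n + 1)) (by positivity) x
      have h2 : (1 / 2 : ℝ) ^ (n + 1) + (1 / 2 : ℝ) ^ (n + 1) = (1 / 2 : ℝ) ^ n := by
        rw [pow_succ]; ring
      rw [h2] at h1
      exact (P_mono (H.Ws_BM n k) (H.Ws_BM _ _) ih x).trans h1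
    · rw [dy_succ]; exact H.PWs_le_u n k (by positivity) x

theorem Obs.ws_mono_n (H : Obs σ u K) (n : ℕ) {τ : ℝ} (hτ : 0 ≤ τ) (x : Fin d → ℝ) :
    ws σ u K n τ x ≤ ws σ u K (n + 1) τ x := by
  unfold ws
  have a := fl_le n hτ
  have b := lt_fl n τ
  set k := fl n τ with hk
  have e2 : dy (n + 1) (2 * k + 1) = dy n k + (1 / 2 : ℝ) ^ (n + 1) := by
    rw [dy_succ, dy_double]
  have e3 : dy (n + 1) (2 * k + 1 + 1) = dy n (k + 1) := by
    rw [← dy_double n (k + 1)]; congr 1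
  rcases lt_or_ge τ (dy (n + 1) (2 * k + 1)) with h | h
  · rw [fl_unique (by rw [dy_double]; exact a) h, dy_double]
    exact P_mono (H.Ws_BM _ _) (H.Ws_BM _ _) (H.Ws_refine n k) x
  · rw [fl_unique h (by rw [e3]; exact b)]
    have h1 := H.P_half (n + 1) (2 * k) (s := τ - dy (n + 1) (2 * k + 1)) (by linarith) x
    refine le_trans ?_ h1
    have : τ - dy (n + 1) (2 * k + 1) + (1 / 2 : ℝ) ^ (n + 1) = τ - dy n k := by rw [e2]; ring
    rw [this]
    exact P_mono (H.Ws_BM _ _) (H.Ws_BM _ _) (H.Ws_refine n k) x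

theorem Obs.ws_monotone (H : Obs σ u K) {τ : ℝ} (hτ : 0 ≤ τ) (x : Fin d → ℝ) :
    Monotone fun n => ws σ u K n τ x :=
  monotone_nat_of_le_succ fun n => H.ws_mono_n n hτ x

theorem Obs.ws_01 (H : Obs σ u K) (n : ℕ) (τ : ℝ) (x : Fin d → ℝ) :
    ws σ u K n τ x ∈ Icc (0:ℝ) 1 :=
  P_mem_Icc (H.Ws_basic _ _).1 (H.Ws_basic _ _).2.1 x

theorem Obs.ws_meas (H : Obs σ u K) (n : ℕ) (τ : ℝ) : Measurable (ws σ u K n τ) :=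
  (H.Ws_BM _ _).P.1

theorem Obs.ws_le_u (H : Obs σ u K) (n : ℕ) {τ : ℝ} (hτ : 0 ≤ τ) (x : Fin d → ℝ) :
    ws σ u K n τ x ≤ u τ x := by
  have := H.PWs_le_u n (fl n τ) (sub_nonneg.2 (fl_le n hτ)) x
  rwa [add_sub_cancel] at this

theorem Obs.ws_anti (H : Obs σ u K) (n : ℕ) (τ : ℝ) (x y : Fin d → ℝ) (h : x ≤ y) :
    ws σ u K n τ y ≤ ws σ u K n τ x :=
  P_antitone (H.Ws_BM _ _) (H.Ws_basic _ _).2.2.1 h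

theorem Obs.ws_bdd (H : Obs σ u K) (τ : ℝ) (x : Fin d → ℝ) :
    BddAbove (range fun n => ws σ u K n τ x) :=
  ⟨1, by rintro _ ⟨n, rfl⟩; exact (H.ws_01 n τ x).2⟩

theorem Obs.ws_tendsto (H : Obs σ u K) {τ : ℝ} (hτ : 0 ≤ τ) (x : Fin d → ℝ) :
    Tendsto (fun n => ws σ u K n τ x) atTop (𝓝 (vs σ u K τ x)) :=
  tendsto_atTop_ciSup (H.ws_monotone hτ x) (H.ws_bdd τ x)

theorem Obs.ws_le_vs (H : Obs σ u K) (n : ℕ) (τ : ℝ) (x : Fin d → ℝ) :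
    ws σ u K n τ x ≤ vs σ u K τ x := le_ciSup (H.ws_bdd τ x) n

theorem Obs.vs_le_u (H : Obs σ u K) {τ : ℝ} (hτ : 0 ≤ τ) (x : Fin d → ℝ) :
    vs σ u K τ x ≤ u τ x := ciSup_le fun n => H.ws_le_u n hτ x

theorem Obs.vs_01 (H : Obs σ u K) (τ : ℝ) (x : Fin d → ℝ) :
    vs σ u K τ x ∈ Icc (0:ℝ) 1 :=
  ⟨(H.ws_01 0 τ x).1.trans (H.ws_le_vs 0 τ x), ciSup_le fun n => (H.ws_01 n τ x).2⟩

theorem Obs.vs_meas (H : Obs σ u K) {τ : ℝ} (hτ : 0 ≤ τ) : Measurable (vs σ u K τ) :=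
  measurable_of_tendsto_metrizable (fun n => H.ws_meas n τ)
    (tendsto_pi_nhds.2 fun x => H.ws_tendsto hτ x)

theorem Obs.vs_anti (H : Obs σ u K) (τ : ℝ) (x y : Fin d → ℝ) (h : x ≤ y) :
    vs σ u K τ y ≤ vs σ u K τ x :=
  ciSup_le fun n => (H.ws_anti n τ x y h).trans (H.ws_le_vs n τ x)

theorem Obs.Vs_le_u (H : Obs σ u K) {τ : ℝ} (hτ : 0 ≤ τ) (x : Fin d → ℝ) :
    Vs σ u K τ x ≤ u τ x := H.Fo_le (H.vs_le_u hτ) x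

theorem Obs.vs_le_Vs (H : Obs σ u K) {τ : ℝ} (hτ : 0 ≤ τ) (x : Fin d → ℝ) :
    vs σ u K τ x ≤ Vs σ u K τ x := H.le_Fo (H.vs_le_u hτ) x

theorem Obs.Vs_01 (H : Obs σ u K) {τ : ℝ} (hτ : 0 ≤ τ) (x : Fin d → ℝ) :
    Vs σ u K τ x ∈ Icc (0:ℝ) 1 := H.Fo_01 hτ (H.vs_01 τ) x

theorem Obs.Vs_meas (H : Obs σ u K) {τ : ℝ} (hτ : 0 ≤ τ) : Measurable (Vs σ u K τ) :=
  H.Fo_meas hτ (H.vs_meas hτ)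

theorem Obs.Vs_anti (H : Obs σ u K) {τ : ℝ} (hτ : 0 ≤ τ) (x y : Fin d → ℝ) (h : x ≤ y) :
    Vs σ u K τ y ≤ Vs σ u K τ x := H.Fo_anti hτ (H.vs_le_u hτ) (H.vs_anti τ) x y h

theorem Vs_K {τ : ℝ} {x : Fin d → ℝ} (h : x ∈ K τ) : Vs σ u K τ x = u τ x := Fo_mem h

theorem Vs_notK {τ : ℝ} {x : Fin d → ℝ} (h : x ∉ K τ) : Vs σ u K τ x = vs σ u K τ x := Fo_not h

theorem fl_dy (n k : ℕ) : fl n (dy n k) = k :=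
  fl_unique le_rfl ((dy_lt_iff n).2 (Nat.lt_succ_self k))

theorem ws_dy (n k : ℕ) (x : Fin d → ℝ) : ws σ u K n (dy n k) x = Ws σ u K n k x := by
  unfold ws
  rw [fl_dy, sub_self, P_zero_time]

theorem Ws_K (n k : ℕ) {x : Fin d → ℝ} (h : x ∈ K (dy n k)) :
    Ws σ u K n k x = u (dy n k) x := by
  cases k with
  | zero => rw [dy_zero] at *; exact Fo_mem h
  | succ k => exact Fo_mem h

theorem Vs_zero {x : Fin d → ℝ} (h : x ∉ K 0) : Vs σ u K 0 x = 0 := by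
  rw [Vs_notK h]
  have : ∀ n, ws σ u K n 0 x = 0 := fun n => by
    have := ws_dy (σ := σ) (u := u) (K := K) n 0 x
    rw [dy_zero] at this
    rw [this]; exact Fo_not h
  simp [vs, this]

theorem dy_refine (n k m : ℕ) : dy (n + m) (2 ^ m * k) = dy n k := by
  induction m with
  | zero => simp
  | succ m ih =>
    rw [← ih, ← add_assoc, ← dy_double (n + m) (2 ^ m * k)]; congr 1; ring

theorem Obs.P_ws_le (H : Obs σ u K) (n k : ℕ) {s : ℝ} (hs : 0 ≤ s) (x : Fin d → ℝ) :
    P σ s (Ws σ u K n k) x ≤ ws σ u K n (dy n k + s) x := by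
  have e : fl n (dy n k + s) = k + fl n s := by
    refine fl_unique ?_ ?_
    · rw [dy_add]; linarith [fl_le n hs]
    · rw [add_assoc, dy_add]; linarith [lt_fl n s]
  unfold ws
  rw [e, dy_add]
  have h1 := fl_le n hs
  have e2 : s = (dy n k + s - (dy n k + dy n (fl n s))) + dy n (fl n s) := by ring
  conv_lhs => rw [e2]
  rw [← P_semigroup (by linarith) (dy_nonneg _ _) (H.Ws_BM n k)]
  exact P_mono (H.Ws_BM n k).P (H.Ws_BM n _) (H.PWs_le_Ws' n k _) x

/-- superheat property at dyadic starting times -/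
theorem Obs.Vs_super (H : Obs σ u K) (n k : ℕ) {s : ℝ} (hs : 0 ≤ s) (x : Fin d → ℝ) :
    P σ s (Vs σ u K (dy n k)) x ≤ Vs σ u K (dy n k + s) x := by
  have h0 := dy_nonneg n k
  refine le_trans ?_ (H.vs_le_Vs (by linarith) x)
  have e : Vs σ u K (dy n k) = vs σ u K (dy n k) := by
    funext y
    refine le_antisymm ?_ (H.vs_le_Vs h0 y)
    by_cases hy : y ∈ K (dy n k)
    · rw [Vs_K hy, ← Ws_K (σ := σ) (u := u) n k hy, ← ws_dy]
      exact H.ws_le_vs n _ y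
    · rw [Vs_notK hy]
  rw [e]
  have lim := P_tendsto (σ := σ) (h := s) (fun m => H.ws_meas m (dy n k)) (C := 1)
    (fun m y => abs_le.2 ⟨by linarith [(H.ws_01 m (dy n k) y).1], (H.ws_01 m (dy n k) y).2⟩)
    (fun y => H.ws_tendsto h0 y) x
  refine le_of_tendsto lim ?_
  filter_upwards [eventually_ge_atTop n] with m hm
  obtain ⟨j, rfl⟩ := Nat.exists_eq_add_of_le hm
  have e1 : ws σ u K (n + j) (dy n k) = Ws σ u K (n + j) (2 ^ j * k) := by
    funext y
    rw [← dy_refine n k j, ws_dy]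
  rw [e1, ← dy_refine n k j]
  exact (H.P_ws_le _ _ hs x).trans (H.ws_le_vs _ _ x)

theorem Obs.vs_shift (H : Obs σ u K) {τ : ℝ} (hτ : 0 ≤ τ) (n k : ℕ) (x : Fin d → ℝ) :
    vs σ u K τ x ≤ vs σ u K (τ + dy n k) x := by
  refine le_of_tendsto (H.ws_tendsto hτ x) ?_
  filter_upwards [eventually_ge_atTop n] with m hm
  obtain ⟨j, rfl⟩ := Nat.exists_eq_add_of_le hm
  refine le_trans ?_ (H.ws_le_vs (n + j) _ x)
  rw [← dy_refine n k j]
  set N := n + j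
  set k' := 2 ^ j * k
  have e : fl N (τ + dy N k') = fl N τ + k' := by
    refine fl_unique ?_ ?_
    · rw [dy_add]; linarith [fl_le N hτ]
    · rw [add_right_comm, dy_add]; linarith [lt_fl N τ]
  unfold ws
  rw [e, dy_add]
  have : τ + dy N k' - (dy N (fl N τ) + dy N k') = τ - dy N (fl N τ) := by ring
  rw [this]
  exact P_mono (H.Ws_BM _ _) (H.Ws_BM _ _) (H.Ws_mono N _ _) x

/-- bound near `τ = 0` -/
theorem Obs.Vs_init (H : Obs σ u K) {r : ℝ} (hr : 0 < r) (x0 : Fin d → ℝ)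
    (hK : ∀ τ, 0 ≤ τ → τ < r → ∀ y ∈ K τ, r ^ 2 ≤ ∑ i, (y i - x0 i) ^ 2)
    {τ : ℝ} (hτ : 0 ≤ τ) (hτr : τ < r) (x : Fin d → ℝ) :
    Vs σ u K τ x ≤ (1 / r ^ 2) * (∑ i, (x i - x0 i) ^ 2 + d * σ ^ 2 * τ) := by
  have hFo : ∀ t, 0 ≤ t → t < r → ∀ z : (Fin d → ℝ) → ℝ,
      (∀ x, z x ≤ (1 / r ^ 2) * (∑ i, (x i - x0 i) ^ 2 + d * σ ^ 2 * t)) → ∀ x,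
      Fo u K t z x ≤ (1 / r ^ 2) * (∑ i, (x i - x0 i) ^ 2 + d * σ ^ 2 * t) := by
    intro t ht htr z hz x
    by_cases h : x ∈ K t
    · rw [Fo_mem h]
      refine (H.u01 t ht x).2.trans ?_
      have h1 := hK t ht htr x h
      have h2 : 0 ≤ d * σ ^ 2 * t := by positivity
      rw [one_div, inv_mul_eq_div, le_div_iff₀ (by positivity)]
      linarith
    · rw [Fo_not h]; exact hz x
  have hP : ∀ n k, ∀ s, 0 ≤ s →
      (∀ x, Ws σ u K n k x ≤ (1 / r ^ 2) * (∑ i, (x i - x0 i) ^ 2 + d * σ ^ 2 * dy n k)) → ∀ x,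
      P σ s (Ws σ u K n k) x ≤ (1 / r ^ 2) * (∑ i, (x i - x0 i) ^ 2 + d * σ ^ 2 * (dy n k + s)) := by
    intro n k s hs h x
    have := P_quad (σ := σ) (h := s) (f := Ws σ u K n k) hs (H.Ws_BM n k) (c := 1 / r ^ 2)
      (b := (1 / r ^ 2) * (d * σ ^ 2 * dy n k)) x0 (fun y => (h y).trans (by rw [mul_add])) x
    refine this.trans (le_of_eq (by ring))
  have hW : ∀ n k, dy n k < r → ∀ x,
      Ws σ u K n k x ≤ (1 / r ^ 2) * (∑ i, (x i - x0 i) ^ 2 + d * σ ^ 2 * dy n k) := by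
    intro n k
    induction k with
    | zero =>
      intro h x
      rw [dy_zero] at *
      exact hFo 0 le_rfl h _ (fun x => by positivity) x
    | succ k ih =>
      intro h x
      refine hFo _ (dy_nonneg _ _) h _ (fun x => ?_) x
      have := hP n k ((1 / 2 : ℝ) ^ n) (by positivity)
        (ih ((dy_mono n (Nat.le_succ k)).trans_lt h)) x
      rwa [← dy_succ] at this
  refine hFo τ hτ hτr _ (fun x => ?_) x
  refine ciSup_le fun n => ?_
  have h1 := fl_le n hτ
  have := hP n (fl n τ) (τ - dy n (fl n τ)) (by linarith) (hW n _ (h1.trans_lt hτr)) x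
  rwa [add_sub_cancel] at this

/-- dependence on coordinates -/
theorem Vs_coord (S : Finset (Fin d))
    (hu : ∀ τ, 0 ≤ τ → ∀ x y : Fin d → ℝ, (∀ j ∈ S, x j = y j) → u τ x = u τ y)
    (hK : ∀ τ, 0 ≤ τ → ∀ x y : Fin d → ℝ, (∀ j ∈ S, x j = y j) → (x ∈ K τ ↔ y ∈ K τ))
    {τ : ℝ} (hτ : 0 ≤ τ) (x y : Fin d → ℝ) (h : ∀ j ∈ S, x j = y j) :
    Vs σ u K τ x = Vs σ u K τ y := by
  have hF : ∀ t, 0 ≤ t → ∀ z : (Fin d → ℝ) → ℝ,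
      (∀ x y : Fin d → ℝ, (∀ j ∈ S, x j = y j) → z x = z y) →
      ∀ x y : Fin d → ℝ, (∀ j ∈ S, x j = y j) → Fo u K t z x = Fo u K t z y := by
    intro t ht z hz x y h
    unfold Fo
    by_cases hx : x ∈ K t
    · rw [if_pos hx, if_pos ((hK t ht x y h).1 hx), hu t ht x y h]
    · rw [if_neg hx, if_neg (fun h' => hx ((hK t ht x y h).2 h')), hz x y h]
  have hP : ∀ s, ∀ z : (Fin d → ℝ) → ℝ,
      (∀ x y : Fin d → ℝ, (∀ j ∈ S, x j = y j) → z x = z y) →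
      ∀ x y : Fin d → ℝ, (∀ j ∈ S, x j = y j) → P σ s z x = P σ s z y := by
    intro s z hz x y h
    unfold P
    congr 1
    funext w
    exact hz _ _ fun j hj => by simp [h j hj]
  have hW : ∀ n k, ∀ x y : Fin d → ℝ, (∀ j ∈ S, x j = y j) →
      Ws σ u K n k x = Ws σ u K n k y := by
    intro n k
    induction k with
    | zero => exact hF 0 le_rfl _ fun _ _ _ => rfl
    | succ k ih => exact hF _ (dy_nonneg _ _) _ (hP _ _ ih)
  refine hF τ hτ _ (fun x y h => ?_) x y h
  unfold vs
  congr 1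
  funext n
  exact hP _ _ (hW _ _) x y h

end scheme
end Casc

open Set Filter
open scoped Topology

namespace Casc
open MeasureTheory ProbabilityTheory

section scheme2
variable {d : ℕ} {σ : ℝ} {u : ℝ → (Fin d → ℝ) → ℝ} {K : ℝ → Set (Fin d → ℝ)}

/-- mass injected at mesh point `j` -/
noncomputable def gs (σ : ℝ) (u : ℝ → (Fin d → ℝ) → ℝ) (K : ℝ → Set (Fin d → ℝ)) (n : ℕ) :
    ℕ → (Fin d → ℝ) → ℝ
  | 0 => Ws σ u K n 0
  | k + 1 => fun x => Ws σ u K n (k + 1) x - P σ ((1 / 2 : ℝ) ^ n) (Ws σ u K n k) x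

theorem Obs.gs_BM (H : Obs σ u K) (n k : ℕ) : BM (gs σ u K n k) := by
  cases k with
  | zero => exact H.Ws_BM n 0
  | succ k =>
    refine ⟨(H.Ws_BM n _).1.sub (H.Ws_BM n k).P.1, 1, fun x => ?_⟩
    have h1 := (H.Ws_basic n (k + 1)).2.1 x
    have h2 := P_mem_Icc (σ := σ) (h := (1 / 2 : ℝ) ^ n) (H.Ws_basic n k).1 (H.Ws_basic n k).2.1 x
    simp only [gs]
    rw [abs_le]
    constructor <;> linarith [h1.1, h1.2, h2.1, h2.2]

theorem gs_supp (n k : ℕ) {x : Fin d → ℝ} (h : gs σ u K n k x ≠ 0) : x ∈ K (dy n k) := by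
  by_contra hx
  apply h
  cases k with
  | zero => rw [dy_zero] at hx; exact Fo_not (z := fun _ => 0) hx
  | succ k =>
    change Fo u K _ _ x - _ = 0
    rw [Fo_not hx, sub_self]

theorem Obs.sum_Wk (H : Obs σ u K) (n M : ℕ) (p : ℝ × (Fin d → ℝ)) (hp : dy n M ≤ p.1) :
    ∑ j ∈ Finset.range (M + 1), Wk σ (dy n j) (gs σ u K n j) p =
      P σ (p.1 - dy n M) (Ws σ u K n M) p.2 := by
  induction M with
  | zero =>
    rw [Finset.sum_range_one, Wk, if_pos hp]; rfl
  | succ M ih =>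
    have hle := dy_mono n (Nat.le_succ M)
    rw [Finset.sum_range_succ, ih (hle.trans hp), Wk, if_pos hp]
    simp only [gs]
    rw [P_sub (H.Ws_BM n _) (H.Ws_BM n M).P,
      P_semigroup (by linarith) (by positivity) (H.Ws_BM n M)]
    have : p.1 - dy n (M + 1) + (1 / 2 : ℝ) ^ n = p.1 - dy n M := by rw [dy_succ]; ring
    rw [this]; ring

/-- extension by zero to negative times -/
noncomputable def wse (σ : ℝ) (u : ℝ → (Fin d → ℝ) → ℝ) (K : ℝ → Set (Fin d → ℝ)) (n : ℕ)
    (p : ℝ × (Fin d → ℝ)) : ℝ := if 0 ≤ p.1 then ws σ u K n p.1 p.2 else 0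

noncomputable def vse (σ : ℝ) (u : ℝ → (Fin d → ℝ) → ℝ) (K : ℝ → Set (Fin d → ℝ))
    (p : ℝ × (Fin d → ℝ)) : ℝ := if 0 ≤ p.1 then vs σ u K p.1 p.2 else 0

theorem Obs.wse_eq (H : Obs σ u K) (n M : ℕ) (p : ℝ × (Fin d → ℝ)) (hp : p.1 < dy n (M + 1)) :
    wse σ u K n p = ∑ j ∈ Finset.range (M + 1), Wk σ (dy n j) (gs σ u K n j) p := by
  unfold wse
  split_ifs with h0
  · have hk := fl_le n h0
    unfold ws
    rw [← H.sum_Wk n _ p hk]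
    refine Finset.sum_subset ?_ ?_
    · intro j hj
      have : fl n p.1 < M + 1 := (dy_lt_iff n).1 (hk.trans_lt hp)
      simp at *; omega
    · intro j hj hj2
      have : fl n p.1 + 1 ≤ j := by simp at hj2; omega
      have h3 := (lt_fl n p.1).trans_le (dy_mono n this)
      rw [Wk, if_neg (not_le.2 h3)]
  · symm
    refine Finset.sum_eq_zero fun j _ => ?_
    rw [Wk, if_neg]
    exact fun h => h0 ((dy_nonneg n j).trans h)

theorem Obs.wse_meas (H : Obs σ u K) (n : ℕ) : Measurable (wse σ u K n) := by
  refine measurable_of_tendsto_metrizable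
    (f := fun (M : ℕ) p => ∑ j ∈ Finset.range (M + 1), Wk σ (dy n j) (gs σ u K n j) p) (fun M => ?_)
    (tendsto_pi_nhds.2 fun p => ?_)
  · exact Finset.measurable_fun_sum _ fun j _ => Wk_measurable (H.gs_BM n j).1
  · refine tendsto_const_nhds.congr' ?_
    filter_upwards [eventually_ge_atTop (fl n p.1)] with M hM
    exact H.wse_eq n M p ((lt_fl n p.1).trans_le (dy_mono n (by omega)))

theorem Obs.wse_abs (H : Obs σ u K) (n : ℕ) (p : ℝ × (Fin d → ℝ)) : |wse σ u K n p| ≤ 1 := by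
  unfold wse
  split_ifs
  · have := H.ws_01 n p.1 p.2
    exact abs_le.2 ⟨by linarith [this.1], this.2⟩
  · simp

theorem Obs.wse_tendsto (H : Obs σ u K) (p : ℝ × (Fin d → ℝ)) :
    Tendsto (fun n => wse σ u K n p) atTop (𝓝 (vse σ u K p)) := by
  unfold wse vse
  split_ifs with h
  · exact H.ws_tendsto h p.2
  · exact tendsto_const_nhds

theorem Obs.vse_meas (H : Obs σ u K) : Measurable (vse σ u K) :=
  measurable_of_tendsto_metrizable (fun n => H.wse_meas n) (tendsto_pi_nhds.2 H.wse_tendsto)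

theorem Obs.vse_abs (H : Obs σ u K) (p : ℝ × (Fin d → ℝ)) : |vse σ u K p| ≤ 1 :=
  le_of_tendsto ((H.wse_tendsto p).abs) (Eventually.of_forall fun n => H.wse_abs n p)

theorem cv_lim {W : ℕ → ℝ × (Fin d → ℝ) → ℝ} {V : ℝ × (Fin d → ℝ) → ℝ} (hm : ∀ n, Measurable (W n))
    (hb : ∀ n p, |W n p| ≤ 1) (hl : ∀ p, Tendsto (fun n => W n p) atTop (𝓝 (V p)))
    {r : ℝ × (Fin d → ℝ) → ℝ} (hr : Continuous r) (hc : HasCompactSupport r) (p : ℝ × (Fin d → ℝ)) :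
    Tendsto (fun n => cv r (W n) p) atTop (𝓝 (cv r V p)) := by
  unfold cv
  have hri : Integrable fun q => r (p - q) :=
    (hr.integrable_of_hasCompactSupport hc).comp_sub_left p
  refine tendsto_integral_of_dominated_convergence (fun q => ‖r (p - q)‖) ?_ hri.norm ?_ ?_
  · intro n
    exact (hm n).aestronglyMeasurable.mul hri.aestronglyMeasurable
  · intro n
    refine Eventually.of_forall fun q => ?_
    rw [norm_mul]
    exact mul_le_of_le_one_left (norm_nonneg _) (hb n q)
  · exact Eventually.of_forall fun q => (hl q).mul_const _

theorem Obs.cv_wse (H : Obs σ u K) (n M : ℕ) {r : ℝ × (Fin d → ℝ) → ℝ} (hr : Continuous r)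
    (hc : HasCompactSupport r) (h0 : ∀ q, q.1 ≤ 0 → r q = 0) (p : ℝ × (Fin d → ℝ))
    (hp : p.1 < dy n (M + 1)) :
    cv r (wse σ u K n) p =
      ∑ j ∈ Finset.range (M + 1), cv r (Wk σ (dy n j) (gs σ u K n j)) p := by
  unfold cv
  rw [← integral_finsetSum]
  · refine integral_congr_ae (Eventually.of_forall fun q => ?_)
    simp only
    rw [← Finset.sum_mul]
    rcases lt_or_ge q.1 p.1 with h | h
    · rw [H.wse_eq n M q (h.trans hp)]
    · rw [h0 (p - q) (by simp; linarith)]; simp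
  · intro j _
    obtain ⟨hm, C, hC⟩ := H.gs_BM n j
    refine cv_integrable hr hc (locallyIntegrable_of_BM (Wk_measurable hm) (C := C) fun q => ?_) p
    unfold Wk
    split_ifs
    · exact P_bound hC _
    · simpa using (abs_nonneg _).trans (hC 0)

theorem Obs.vse_mean (H : Obs σ u K) (hσ : 0 < σ) {r : ℝ} (hr : 0 < r) :
    ∃ ρ : ℝ × (Fin d → ℝ) → ℝ, ContDiff ℝ (⊤ : ℕ∞) ρ ∧ HasCompactSupport ρ ∧
      ∀ p : ℝ × (Fin d → ℝ), (∀ a y, 0 ≤ a → y ∈ K a → r ≤ ‖p - (a, y)‖) →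
        cv ρ (vse σ u K) p = vse σ u K p ∧ cv (Hop σ ρ) (vse σ u K) p = 0 := by
  obtain ⟨ρ, c1, c2, c3, -, c5⟩ := mean_value (d := d) hσ hr
  refine ⟨ρ, c1, c2, fun p hp => ?_⟩
  have key : ∀ n, cv ρ (wse σ u K n) p = wse σ u K n p ∧ cv (Hop σ ρ) (wse σ u K n) p = 0 := by
    intro n
    have hp1 := lt_fl n p.1
    rw [H.cv_wse n _ c1.continuous c2 c3 p hp1, H.wse_eq n _ p hp1,
      H.cv_wse n _ (Hop_contDiff c1).continuous (Hop_compact c2)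
        (fun q hq => Hop_eq_zero_of_neg c3 q c1.contDiffAt hq) p hp1]
    have h5 := fun j => c5 (dy n j) (gs σ u K n j) (H.gs_BM n j) p
      (fun y hy => hp _ y (dy_nonneg n j) (gs_supp n j hy))
    exact ⟨Finset.sum_congr rfl fun j _ => (h5 j).1, Finset.sum_eq_zero fun j _ => (h5 j).2⟩
  constructor
  · refine tendsto_nhds_unique (cv_lim H.wse_meas H.wse_abs H.wse_tendsto c1.continuous c2 p) ?_
    simp only [(key _).1]
    exact H.wse_tendsto p
  · refine tendsto_nhds_unique (cv_lim H.wse_meas H.wse_abs H.wse_tendsto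
      (Hop_contDiff (σ := σ) c1).continuous (Hop_compact c2) p) ?_
    simp only [(key _).2]
    exact tendsto_const_nhds

/-- smoothness and heat equation off the killed set -/
theorem Obs.Vs_smooth (H : Obs σ u K) (hσ : 0 < σ) (p : ℝ × (Fin d → ℝ)) (h0 : 0 < p.1)
    (hp : p.2 ∉ K p.1) :
    ContDiffAt ℝ (⊤ : ℕ∞) (fun q : ℝ × (Fin d → ℝ) => Vs σ u K q.1 q.2) p ∧
      Hop σ (fun q : ℝ × (Fin d → ℝ) => Vs σ u K q.1 q.2) p = 0 := by
  obtain ⟨R, hR, hsub⟩ := Metric.isOpen_iff.1 H.Ko p ⟨h0, hp⟩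
  obtain ⟨ρ, c1, c2, c3⟩ := H.vse_mean hσ (half_pos hR)
  have hloc : LocallyIntegrable (vse σ u K) := locallyIntegrable_of_BM H.vse_meas H.vse_abs
  have hev : ∀ q ∈ Metric.ball p (R / 2), ∀ a y, 0 ≤ a → y ∈ K a → R / 2 ≤ ‖q - (a, y)‖ := by
    intro q hq a y ha hy
    by_contra hlt
    push Not at hlt
    rw [Metric.mem_ball] at hq
    have : ((a, y) : ℝ × (Fin d → ℝ)) ∈ Metric.ball p R := by
      rw [Metric.mem_ball]
      have h1 : dist (a, y) q < R / 2 := by rw [dist_comm, dist_eq_norm]; exact hlt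
      linarith [dist_triangle (a, y) q p]
    exact (hsub this).2 hy
  have hball : Metric.ball p (R / 2) ∈ 𝓝 p := Metric.ball_mem_nhds p (half_pos hR)
  have e1 : (fun q : ℝ × (Fin d → ℝ) => Vs σ u K q.1 q.2) =ᶠ[𝓝 p] cv ρ (vse σ u K) := by
    filter_upwards [hball] with q hq
    rw [(c3 q (hev q hq)).1]
    have := hsub (Metric.ball_subset_ball (by linarith) hq)
    rw [vse, if_pos this.1.le, Vs_notK this.2]
  refine ⟨(cv_contDiff c1 c2 hloc).contDiffAt.congr_of_eventuallyEq e1, ?_⟩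
  rw [Hop_congr e1, Hop_cv c1 c2 hloc]
  exact (c3 p (hev p (Metric.mem_ball_self (half_pos hR)))).2

theorem dy_approx {a : ℝ} (ha : 0 ≤ a) : Tendsto (fun n => dy n (fl n a)) atTop (𝓝 a) := by
  have h : Tendsto (fun n : ℕ => a - (1 / 2 : ℝ) ^ n) atTop (𝓝 (a - 0)) :=
    tendsto_const_nhds.sub (tendsto_pow_atTop_nhds_zero_of_lt_one (by norm_num) (by norm_num))
  rw [sub_zero] at h
  refine tendsto_of_tendsto_of_tendsto_of_le_of_le h tendsto_const_nhds (fun n => ?_)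
    fun n => fl_le n ha
  have := lt_fl n a
  rw [dy_succ] at this
  simp only; linarith

/-- monotonicity in time -/
theorem Obs.Vs_mono (H : Obs σ u K) (hσ : 0 < σ) {s t : ℝ} (hs : 0 ≤ s) (hst : s ≤ t)
    (x : Fin d → ℝ) : Vs σ u K s x ≤ Vs σ u K t x := by
  rcases hst.eq_or_lt with rfl | hlt
  · exact le_rfl
  by_cases hx : x ∈ K t
  · rw [Vs_K hx]
    exact (H.Vs_le_u hs x).trans (H.ut s t hs hst x)
  · have hxs : x ∉ K s := fun h => hx (H.Kt s t hs hst h)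
    have hc := (H.Vs_smooth hσ (t, x) (hs.trans_lt hlt) hx).1.continuousAt
    have h1 : Tendsto (fun n => ((s + dy n (fl n (t - s)), x) : ℝ × (Fin d → ℝ))) atTop
        (𝓝 (t, x)) := by
      have := (dy_approx (sub_nonneg.2 hst)).const_add s
      rw [add_sub_cancel] at this
      exact this.prodMk_nhds tendsto_const_nhds
    refine ge_of_tendsto (hc.tendsto.comp h1) (Eventually.of_forall fun n => ?_)
    simp only [Function.comp]
    rw [Vs_notK hxs]
    exact (H.vs_shift hs _ _ x).trans (H.vs_le_Vs (by linarith [dy_nonneg n (fl n (t - s))]) x)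

end scheme2
end Casc

open Set Filter
open scoped Topology

namespace Casc
open MeasureTheory ProbabilityTheory

/-- regular (monotone, superheat) functions -/
structure Reg {d : ℕ} (σ : ℝ) (V : ℝ → (Fin d → ℝ) → ℝ) : Prop where
  v01 : ∀ τ, 0 ≤ τ → ∀ x, V τ x ∈ Icc (0:ℝ) 1
  vm : ∀ τ, 0 ≤ τ → Measurable (V τ)
  va : ∀ τ, 0 ≤ τ → ∀ x y, x ≤ y → V τ y ≤ V τ x
  vt : ∀ s t, 0 ≤ s → s ≤ t → ∀ x, V s x ≤ V t x
  vs : ∀ (n k : ℕ) s, 0 ≤ s → ∀ x, P σ s (V (dy n k)) x ≤ V (dy n k + s) x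

/-- lower Lipschitz property along a backward curve -/
def LL {d : ℕ} (V : ℝ → (Fin d → ℝ) → ℝ) (τ0 : ℝ) (x0 : Fin d → ℝ) (L r : ℝ) : Prop :=
  ∀ s, 0 ≤ s → s < r → V τ0 x0 - L * s ≤ V (τ0 - s) (fun i => x0 i - L * s)

theorem P_two_level {d : ℕ} {σ h : ℝ} {f : (Fin d → ℝ) → ℝ} (hf : BM f) (h0 : ∀ x, 0 ≤ f x)
    (x : Fin d → ℝ) {c e a b : ℝ} (hce : c ≤ e)
    (ha : ∀ z : Fin d → ℝ, (∀ i, z i ≤ c) → a ≤ f (x + (σ * √h) • z))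
    (hb : ∀ z : Fin d → ℝ, (∀ i, z i ≤ e) → b ≤ f (x + (σ * √h) • z)) :
    (gam d).real {z | ∀ i, z i ≤ c} * a +
      ((gam d).real {z | ∀ i, z i ≤ e} - (gam d).real {z | ∀ i, z i ≤ c}) * b ≤ P σ h f x := by
  have hm : ∀ c : ℝ, MeasurableSet {z : Fin d → ℝ | ∀ i, z i ≤ c} := fun c => by
    have : {z : Fin d → ℝ | ∀ i, z i ≤ c} = Iic (fun _ => c) := by ext z; rfl
    rw [this]; exact measurableSet_Iic
  set E1 := {z : Fin d → ℝ | ∀ i, z i ≤ c}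
  set E2 := {z : Fin d → ℝ | ∀ i, z i ≤ e}
  have hsub : E1 ⊆ E2 := fun z hz i => (hz i).trans hce
  have i1 : Integrable (E1.indicator fun _ => a) (gam d) := (integrable_const a).indicator (hm c)
  have i2 : Integrable ((E2 \ E1).indicator fun _ => b) (gam d) :=
    (integrable_const b).indicator ((hm e).diff (hm c))
  have e1 : ∫ z, (E1.indicator (fun _ => a) z + (E2 \ E1).indicator (fun _ => b) z) ∂gam d =
      (gam d).real E1 * a + ((gam d).real E2 - (gam d).real E1) * b := by
    rw [integral_add i1 i2, integral_indicator_const _ (hm c),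
      integral_indicator_const _ ((hm e).diff (hm c)), measureReal_sdiff hsub (hm c)]
    simp only [smul_eq_mul]; rfl
  rw [← e1]
  refine integral_mono (i1.add i2) (hf.integrable_comp _ _) fun z => ?_
  simp only
  by_cases h1 : z ∈ E1
  · have : z ∉ E2 \ E1 := fun h => h.2 h1
    rw [indicator_of_mem h1, indicator_of_notMem this, add_zero]
    exact ha z h1
  · rw [indicator_of_notMem h1, zero_add]
    by_cases h2 : z ∈ E2
    · rw [indicator_of_mem (show z ∈ E2 \ E1 from ⟨h2, h1⟩)]; exact hb z h2
    · rw [indicator_of_notMem (fun h => h2 h.1)]; exact h0 _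

set_option maxHeartbeats 1000000 in
theorem Reg.lsc {d : ℕ} {σ : ℝ} (hσ : 0 < σ) {V : ℝ → (Fin d → ℝ) → ℝ} (H : Reg σ V)
    {τ0 : ℝ} (hτ0 : 0 < τ0) (x0 : Fin d → ℝ) {L r : ℝ} (hL : 0 ≤ L) (hr : 0 < r)
    (hLL : LL V τ0 x0 L r) {ε : ℝ} (hε : 0 < ε) :
    ∃ δ > 0, ∀ τ x, τ0 - δ < τ → (∀ i, x i < x0 i + δ) → V τ0 x0 - ε ≤ V τ x := by
  wlog hrt : r ≤ τ0 generalizing r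
  · exact this hτ0 (fun s h1 h2 => hLL s h1 (h2.trans_le (by linarith))) le_rfl
  set c0 := (gam d).real {z | ∀ i, z i ≤ -2 / σ} with hc0
  have hc0p : 0 < c0 := gam_orthant_pos d _
  have hc01 : c0 ≤ 1 := measureReal_le_one
  -- choose the opening
  obtain ⟨A, hA, hAe⟩ : ∃ A : ℝ, 0 < A ∧
      1 - c0 * ε / 4 ≤ (gam d).real {z | ∀ i, z i ≤ (√(1 + A ^ 2) - 1) / σ} := by
    have hlt : 1 - c0 * ε / 4 < 1 := by have := mul_pos hc0p hε; linarith
    obtain ⟨R, hR⟩ := ((gam_orthant_tendsto d).eventually (lt_mem_nhds hlt)).exists_forall_of_atTop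
    refine ⟨σ * |R| + 1, by positivity, (hR _ ?_).le⟩
    have h1 : σ * |R| + 1 ≤ √(1 + (σ * |R| + 1) ^ 2) :=
      Real.le_sqrt_of_sq_le (by linarith)
    rw [le_div_iff₀ hσ]
    have := le_abs_self R
    nlinarith
  set e := (gam d).real {z | ∀ i, z i ≤ (√(1 + A ^ 2) - 1) / σ} with he
  have he1 : e ≤ 1 := measureReal_le_one
  set M := 1 + A ^ 2 with hM
  have hM1 : 1 < M := by rw [hM]; nlinarith
  have hM0 : 0 < M := by linarith
  let f : ℝ → ℝ := fun s => V (τ0 - s) (fun i => x0 i + A * √s)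
  have f01 : ∀ s, s < r → f s ∈ Icc (0:ℝ) 1 := fun s hs => H.v01 _ (by linarith) _
  have fanti : ∀ s s', s ≤ s' → s' < r → f s' ≤ f s := by
    intro s s' h h'
    refine (H.va _ (by linarith) (fun i => x0 i + A * √s) _ fun i => ?_).trans
      (H.vt _ _ (by linarith) (by linarith) _)
    have := Real.sqrt_le_sqrt h
    simp only
    gcongr
  set m := sSup (f '' Ioo 0 r) with hm
  have hbdd : BddAbove (f '' Ioo 0 r) := ⟨1, by rintro _ ⟨s, hs, rfl⟩; exact (f01 s hs.2).2⟩
  have hne : (f '' Ioo 0 r).Nonempty := ⟨_, r / 2, ⟨by linarith, by linarith⟩, rfl⟩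
  have hfm : ∀ s, 0 < s → s < r → f s ≤ m := fun s h1 h2 => le_csSup hbdd ⟨s, ⟨h1, h2⟩, rfl⟩
  have hm1 : m ≤ 1 := csSup_le hne (by rintro _ ⟨s, hs, rfl⟩; exact (f01 s hs.2).2)
  have hm0 : 0 ≤ m := (f01 (r/2) (by linarith)).1.trans (hfm (r/2) (by linarith) (by linarith))
  have hce : 0 < c0 * ε := mul_pos hc0p hε
  obtain ⟨_, ⟨s', ⟨hs'0, hs'r⟩, rfl⟩, hs'⟩ := exists_lt_of_lt_csSup hne
    (show m - c0 * ε / 4 < m by linarith)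
  -- choose a small dyadic step
  set η := min s' (min (ε / (4 * (L + 1))) (A ^ 2 / ((L + 1) ^ 2 * M))) with hη
  have hη0 : 0 < η := by
    rw [hη]; refine lt_min hs'0 (lt_min (by positivity) (by positivity))
  have hηs : η ≤ s' := min_le_left _ _
  have hη1 : η ≤ ε / (4 * (L + 1)) := (min_le_right _ _).trans (min_le_left _ _)
  have hη2 : η ≤ A ^ 2 / ((L + 1) ^ 2 * M) := (min_le_right _ _).trans (min_le_right _ _)
  obtain ⟨n, hn⟩ := ((dy_approx (a := τ0 - η / 2) (by linarith)).eventually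
    (lt_mem_nhds (show τ0 - η < τ0 - η / 2 by linarith))).exists
  have hn2 := fl_le n (τ := τ0 - η / 2) (by linarith)
  set k := fl n (τ0 - η / 2)
  set S := τ0 - dy n k with hS
  have hS0 : 0 < S := by linarith
  have hSη : S < η := by linarith
  set s := S / M with hs
  have hs0 : 0 < s := by positivity
  have hMs : M * s = S := by rw [hs]; field_simp
  have hsS : s < S := by rw [← hMs]; nlinarith
  have key : c0 * (V τ0 x0 - L * S) + (e - c0) * f S ≤ f s := by
    have hsup := H.vs n k (A ^ 2 * s) (by positivity) (fun i => x0 i + A * √s)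
    have e1 : dy n k + A ^ 2 * s = τ0 - s := by
      have : A ^ 2 * s = S - s := by rw [← hMs, hM]; ring
      rw [this, hS]; ring
    rw [e1] at hsup
    refine le_trans ?_ hsup
    have e2 : √(A ^ 2 * s) = A * √s := by
      rw [Real.sqrt_mul (by positivity), Real.sqrt_sq hA.le]
    have hdS : dy n k = τ0 - S := by rw [hS]; ring
    have hss : 0 < √s := Real.sqrt_pos.2 hs0
    refine P_two_level (BM.of_mem_Icc (H.vm _ (dy_nonneg _ _)) (H.v01 _ (dy_nonneg _ _)))
      (fun x => (H.v01 _ (dy_nonneg _ _) x).1) _ ?_ ?_ ?_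
    · have : 0 ≤ √M := Real.sqrt_nonneg _
      gcongr; linarith
    · intro z hz
      refine (hLL S hS0.le (by linarith)).trans ?_
      rw [hdS]
      refine H.va _ (by linarith) _ _ fun i => ?_
      simp only [Pi.add_apply, Pi.smul_apply, smul_eq_mul, e2]
      have h1 : σ * z i ≤ -2 := by
        have := hz i
        rw [le_div_iff₀ hσ] at this; linarith
      have h2 : L * S ≤ A * √s := by
        have h3 : (L * S) ^ 2 ≤ (A * √s) ^ 2 := by
          rw [mul_pow, mul_pow, Real.sq_sqrt hs0.le]
          have h4 : S * ((L + 1) ^ 2 * M) ≤ A ^ 2 := by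
            rw [← le_div_iff₀ (by positivity)]; linarith
          have h5 : L ^ 2 * S ^ 2 = (S * (L ^ 2 * M)) * s := by rw [← hMs]; ring
          rw [h5]
          refine mul_le_mul_of_nonneg_right ?_ hs0.le
          refine le_trans ?_ h4
          gcongr; linarith
        exact le_of_sq_le_sq h3 (by positivity)
      have h6 : σ * (A * √s) * z i ≤ -2 * (A * √s) := by
        have := mul_le_mul_of_nonneg_right h1 (show 0 ≤ A * √s by positivity)
        linarith
      linarith
    · intro z hz
      change V (τ0 - S) _ ≤ _
      rw [hdS]
      refine H.va _ (by linarith) _ _ fun i => ?_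
      simp only [Pi.add_apply, Pi.smul_apply, smul_eq_mul, e2]
      have h1 : σ * z i ≤ √M - 1 := by
        have := hz i
        rw [le_div_iff₀ hσ] at this; linarith
      have h2 : √S = √M * √s := by rw [← hMs, Real.sqrt_mul hM0.le]
      rw [h2]
      have h6 : σ * (A * √s) * z i ≤ (√M - 1) * (A * √s) := by
        have := mul_le_mul_of_nonneg_right h1 (show 0 ≤ A * √s by positivity)
        linarith
      nlinarith
  have h1 : f s ≤ m := hfm s hs0 (by linarith)
  have h2 : m - c0 * ε / 4 ≤ f S := hs'.le.trans (fanti S s' (by linarith) hs'r)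
  have hec : 0 ≤ e - c0 := by
    rw [sub_nonneg]
    refine measureReal_mono (fun z hz i => (hz i).trans ?_)
    have : 0 ≤ √M := Real.sqrt_nonneg _
    gcongr; linarith
  have h3 : L * S ≤ ε / 4 := by
    have : S * (4 * (L + 1)) ≤ ε := by rw [← le_div_iff₀ (by positivity)]; linarith
    nlinarith
  have h4 : V τ0 x0 - ε < m := by
    have a1 : (e - c0) * (m - c0 * ε / 4) ≤ (e - c0) * f S := mul_le_mul_of_nonneg_left h2 hec
    have a2 : c0 * (L * S) ≤ c0 * (ε / 4) := mul_le_mul_of_nonneg_left h3 hc0p.le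
    have a3 : (e - c0) * (c0 * ε / 4) ≤ 1 * (c0 * ε / 4) :=
      mul_le_mul_of_nonneg_right (by linarith) (by positivity)
    have a4 : (1 - e) * m ≤ (1 - e) * 1 := mul_le_mul_of_nonneg_left hm1 (by linarith)
    have a6 := key.trans h1
    have a5 : c0 * (V τ0 x0 - ε) < c0 * m := by linarith
    exact lt_of_mul_lt_mul_left a5 hc0p.le
  obtain ⟨_, ⟨s1, ⟨hs1, hs1r⟩, rfl⟩, hs1m⟩ := exists_lt_of_lt_csSup hne h4
  refine ⟨min s1 (A * √s1), lt_min hs1 (by have := Real.sqrt_pos.2 hs1; positivity), ?_⟩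
  intro τ x hτ hx
  refine hs1m.le.trans ?_
  have b1 : τ0 - s1 ≤ τ := by have := min_le_left s1 (A * √s1); linarith
  refine (H.vt (τ0 - s1) τ (by linarith) b1 _).trans (H.va τ (by linarith) _ _ fun i => ?_)
  have := min_le_right s1 (A * √s1)
  have := hx i
  simp only; linarith

end Casc

open Set Filter
open scoped Topology

namespace Casc
open MeasureTheory ProbabilityTheory

/-- killed set of the cascade -/
def kset {N : ℕ} (D : Fin N → Fin N → ℝ) (V : Finset (Fin N) → Fin N → ℝ → (Fin N → ℝ) → ℝ)
    (I : Finset (Fin N)) (τ : ℝ) : Set (Fin N → ℝ) :=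
  {x | ∃ i ∈ I, x i ≤ ∑ j, D i j * V (I.erase i) j τ x}

/-- obstacle of the cascade -/
noncomputable def uob {N : ℕ} (V : Finset (Fin N) → Fin N → ℝ → (Fin N → ℝ) → ℝ)
    (I : Finset (Fin N)) (i : Fin N) (τ : ℝ) (x : Fin N → ℝ) : ℝ :=
  (insert ∅ I.ssubsets).inf' (Finset.insert_nonempty _ _) fun J => V J i τ x

open Classical in
/-- the cascade -/
noncomputable def cas {N : ℕ} (σ : ℝ) (D : Fin N → Fin N → ℝ) (I : Finset (Fin N)) :
    Fin N → ℝ → (Fin N → ℝ) → ℝ :=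
  Finset.strongInduction (p := fun _ => Fin N → ℝ → (Fin N → ℝ) → ℝ)
    (fun I prev i => if i ∈ I then
      Vs σ (uob (fun J => if h : J ⊂ I then prev J h else fun _ _ _ => 1) I i)
        (kset D (fun J => if h : J ⊂ I then prev J h else fun _ _ _ => 1) I)
      else fun _ _ => 1) I

theorem mem_ins {N : ℕ} {I : Finset (Fin N)} {i : Fin N} (hi : i ∈ I) {J : Finset (Fin N)}
    (hJ : J ∈ insert ∅ I.ssubsets) : J ⊂ I := by
  rcases Finset.mem_insert.1 hJ with rfl | h
  · exact Finset.empty_ssubset.2 ⟨i, hi⟩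
  · exact Finset.mem_ssubsets.1 h

theorem uob_congr {N : ℕ} {V W : Finset (Fin N) → Fin N → ℝ → (Fin N → ℝ) → ℝ}
    {I : Finset (Fin N)} {i : Fin N} (hi : i ∈ I) (h : ∀ J, J ⊂ I → V J = W J) :
    uob V I i = uob W I i := by
  funext τ x
  unfold uob
  refine Finset.inf'_congr _ rfl fun J hJ => ?_
  rw [h J (mem_ins hi hJ)]

theorem kset_congr {N : ℕ} {D : Fin N → Fin N → ℝ}
    {V W : Finset (Fin N) → Fin N → ℝ → (Fin N → ℝ) → ℝ}
    {I : Finset (Fin N)} (h : ∀ J, J ⊂ I → V J = W J) :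
    kset D V I = kset D W I := by
  funext τ
  ext x
  unfold kset
  simp only [Set.mem_ofPred_eq]
  refine exists_congr fun i => and_congr_right fun hi => ?_
  rw [h _ (Finset.erase_ssubset hi)]

theorem cas_mem {N : ℕ} {σ : ℝ} {D : Fin N → Fin N → ℝ} {I : Finset (Fin N)} {i : Fin N}
    (hi : i ∈ I) : cas σ D I i = Vs σ (uob (cas σ D) I i) (kset D (cas σ D) I) := by
  unfold cas
  rw [Finset.strongInduction_eq]
  rw [if_pos hi]
  have h : ∀ J, J ⊂ I → (fun J => if h : J ⊂ I then
      (fun J (_ : J ⊂ I) => cas σ D J) J h else fun _ _ _ => 1) J = cas σ D J := fun J hJ => by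
    simp only [dif_pos hJ]
  have e1 := uob_congr hi h
  have e2 := kset_congr (D := D) h
  exact congrArg₂ (Vs σ) e1 e2

theorem cas_notMem {N : ℕ} {σ : ℝ} {D : Fin N → Fin N → ℝ} {I : Finset (Fin N)} {i : Fin N}
    (hi : i ∉ I) : cas σ D I i = fun _ _ => 1 := by
  unfold cas
  rw [Finset.strongInduction_eq]
  rw [if_neg hi]

/-- invariants of the cascade -/
structure Inv {N : ℕ} (σ : ℝ) (D : Fin N → Fin N → ℝ)
    (V : Finset (Fin N) → Fin N → ℝ → (Fin N → ℝ) → ℝ) (I : Finset (Fin N)) : Prop where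
  one : ∀ i ∉ I, V I i = fun _ _ => 1
  reg : ∀ i, Reg σ (V I i)
  coord : ∀ i τ, 0 ≤ τ → ∀ x y : Fin N → ℝ, (∀ j ∈ I, x j = y j) → V I i τ x = V I i τ y
  sub : ∀ J, J ⊂ I → ∀ i τ, 0 ≤ τ → ∀ x, V I i τ x ≤ V J i τ x
  kill : ∀ k ∈ I, ∀ τ, 0 ≤ τ → ∀ x : Fin N → ℝ, x k ≤ ∑ j, D k j * V (I.erase k) j τ x →
    ∀ i, V I i τ x = V (I.erase k) i τ x
  smooth : ∀ i ∈ I, ∀ τ, 0 < τ → ∀ x, x ∉ kset D V I τ →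
    ContDiffAt ℝ (⊤ : ℕ∞) (fun q : ℝ × (Fin N → ℝ) => V I i q.1 q.2) (τ, x) ∧
      Hop σ (fun q : ℝ × (Fin N → ℝ) => V I i q.1 q.2) (τ, x) = 0
  cont : ∀ i τ, 0 < τ → ∀ x, ContinuousAt (fun q : ℝ × (Fin N → ℝ) => V I i q.1 q.2) (τ, x)
  usc : ∀ i x, ∀ ε > 0, ∀ᶠ p in 𝓝[{p : ℝ × (Fin N → ℝ) | 0 ≤ p.1}] (0, x),
    V I i p.1 p.2 < V I i 0 x + ε
  ll : ∀ i τ, 0 < τ → ∀ x, ∃ L r, 0 ≤ L ∧ 0 < r ∧ LL (V I i) τ x L r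
  zero : ∀ i ∈ I, ∀ x, x ∉ kset D V I 0 → V I i 0 x = 0

theorem Reg.one {d : ℕ} {σ : ℝ} : Reg σ (fun (_ : ℝ) (_ : Fin d → ℝ) => (1:ℝ)) where
  v01 := by simp
  vm := fun _ _ => measurable_const
  va := fun _ _ _ _ _ => le_rfl
  vt := fun _ _ _ _ _ => le_rfl
  vs := fun n k s hs x => by rw [P_const]

theorem Reg.uob {N : ℕ} {σ : ℝ} {V : Finset (Fin N) → Fin N → ℝ → (Fin N → ℝ) → ℝ}
    {I : Finset (Fin N)} {i : Fin N} (hi : i ∈ I) (h : ∀ J, J ⊂ I → Reg σ (V J i)) :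
    Reg σ (uob V I i) := by
  have hm : ∀ τ, 0 ≤ τ → Measurable (Casc.uob V I i τ) := by
    intro τ hτ
    have : Casc.uob V I i τ =
        (insert ∅ I.ssubsets).inf' (Finset.insert_nonempty _ _) fun J => V J i τ := by
      funext x; rw [Finset.inf'_apply]; rfl
    rw [this]
    exact Finset.inf'_induction _ _ (p := fun f => Measurable f) (fun f hf g hg => hf.inf hg)
      fun J hJ => (h J (mem_ins hi hJ)).vm τ hτ
  have h01 : ∀ τ, 0 ≤ τ → ∀ x, Casc.uob V I i τ x ∈ Icc (0:ℝ) 1 := by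
    intro τ hτ x
    refine ⟨Finset.le_inf' _ _ fun J hJ => ((h J (mem_ins hi hJ)).v01 τ hτ x).1, ?_⟩
    have hJ : (∅ : Finset (Fin N)) ∈ insert ∅ I.ssubsets := Finset.mem_insert_self _ _
    exact (Finset.inf'_le _ hJ).trans ((h ∅ (mem_ins hi hJ)).v01 τ hτ x).2
  refine ⟨h01, hm, ?_, ?_, ?_⟩
  · intro τ hτ x y hxy
    exact Finset.le_inf' _ _ fun J hJ => (Finset.inf'_le _ hJ).trans
      ((h J (mem_ins hi hJ)).va τ hτ x y hxy)
  · intro s t hs hst x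
    exact Finset.le_inf' _ _ fun J hJ => (Finset.inf'_le _ hJ).trans
      ((h J (mem_ins hi hJ)).vt s t hs hst x)
  · intro n k s hs x
    refine Finset.le_inf' _ _ fun J hJ => ?_
    have R := h J (mem_ins hi hJ)
    have h0 := dy_nonneg n k
    exact (P_mono (BM.of_mem_Icc (hm _ h0) (h01 _ h0)) (BM.of_mem_Icc (R.vm _ h0) (R.v01 _ h0))
      (fun y => Finset.inf'_le _ hJ) x).trans (R.vs n k s hs x)

theorem LL.mono {d : ℕ} {σ : ℝ} {V : ℝ → (Fin d → ℝ) → ℝ} (H : Reg σ V) {τ L L' r r' : ℝ}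
    {x : Fin d → ℝ} (h : LL V τ x L r) (hL : L ≤ L') (hr : r' ≤ r) (hr' : r' ≤ τ) :
    LL V τ x L' r' := by
  intro s hs hsr
  have h1 := h s hs (hsr.trans_le hr)
  have h2 : L * s ≤ L' * s := mul_le_mul_of_nonneg_right hL hs
  have h3 := H.va (τ - s) (by linarith) (fun i => x i - L' * s) (fun i => x i - L * s)
    (fun i => by simp only; linarith)
  linarith

section step
variable {N : ℕ} {σ : ℝ} {D : Fin N → Fin N → ℝ}
  {V : Finset (Fin N) → Fin N → ℝ → (Fin N → ℝ) → ℝ} {I : Finset (Fin N)}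

theorem Inv.sub' (h : Inv σ D V I) {J : Finset (Fin N)} (hJ : J ⊆ I) (i : Fin N) {τ : ℝ}
    (hτ : 0 ≤ τ) (x : Fin N → ℝ) : V I i τ x ≤ V J i τ x := by
  rcases hJ.eq_or_ssubset with rfl | h'
  · exact le_rfl
  · exact h.sub J h' i τ hτ x

theorem sumD_mono (hD : ∀ i j, 0 ≤ D i j) {f g : Fin N → ℝ} (h : ∀ j, f j ≤ g j) (i : Fin N) :
    ∑ j, D i j * f j ≤ ∑ j, D i j * g j :=
  Finset.sum_le_sum fun j _ => mul_le_mul_of_nonneg_left (h j) (hD i j)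

/-- eventually alive near an alive point at positive time -/
theorem alive_nhds (hI : ∀ J, J ⊂ I → Inv σ D V J) {p : ℝ × (Fin N → ℝ)} (h0 : 0 < p.1)
    (hp : p.2 ∉ kset D V I p.1) : ∀ᶠ q in 𝓝 p, 0 < q.1 ∧ q.2 ∉ kset D V I q.1 := by
  refine (continuous_fst.continuousAt.eventually (lt_mem_nhds h0)).and ?_
  have : ∀ᶠ q : ℝ × (Fin N → ℝ) in 𝓝 p, ∀ i ∈ I, ∑ j, D i j * V (I.erase i) j q.1 q.2 < q.2 i := by
    rw [Filter.eventually_all_finset]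
    intro i hi
    have hc : ContinuousAt (fun q : ℝ × (Fin N → ℝ) => ∑ j, D i j * V (I.erase i) j q.1 q.2) p := by
      refine tendsto_finsetSum _ fun j _ => ?_
      exact ((hI _ (Finset.erase_ssubset hi)).cont j p.1 h0 p.2).const_mul _
    have hc2 : ContinuousAt (fun q : ℝ × (Fin N → ℝ) => q.2 i) p := by fun_prop
    refine hc.eventually_lt hc2 ?_
    by_contra hle
    exact hp ⟨i, hi, not_lt.1 hle⟩
  filter_upwards [this] with q hq
  rintro ⟨i, hi, hle⟩
  exact absurd (hq i hi) (not_lt.2 hle)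

theorem obs_of (hD : ∀ i j, 0 ≤ D i j) (hI : ∀ J, J ⊂ I → Inv σ D V J) {i : Fin N} (hi : i ∈ I) :
    Obs σ (uob V I i) (kset D V I) := by
  have R : Reg σ (uob V I i) := Reg.uob hi fun J hJ => (hI J hJ).reg i
  refine ⟨R.v01, R.vm, R.va, R.vt, R.vs, ?_, ?_, ?_, ?_⟩
  · intro τ hτ
    have : kset D V I τ = ⋃ i ∈ I, {x | x i ≤ ∑ j, D i j * V (I.erase i) j τ x} := by
      ext x; simp [kset]
    rw [this]
    refine Finset.measurableSet_biUnion _ fun i hi => ?_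
    refine measurableSet_le (measurable_pi_apply i) ?_
    exact Finset.measurable_fun_sum _ fun j _ =>
      (((hI _ (Finset.erase_ssubset hi)).reg j).vm τ hτ).const_mul _
  · rintro τ hτ x y hxy ⟨i, hi, h⟩
    refine ⟨i, hi, (hxy i).trans (h.trans ?_)⟩
    exact sumD_mono hD (fun j => ((hI _ (Finset.erase_ssubset hi)).reg j).va τ hτ x y hxy) i
  · rintro s t hs hst x ⟨i, hi, h⟩
    refine ⟨i, hi, h.trans ?_⟩
    exact sumD_mono hD (fun j => ((hI _ (Finset.erase_ssubset hi)).reg j).vt s t hs hst x) i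
  · rw [isOpen_iff_mem_nhds]
    rintro p ⟨h0, hp⟩
    exact alive_nhds hI h0 hp

/-- eventually alive near an alive point at time zero -/
theorem alive_nhds_zero (hD : ∀ i j, 0 ≤ D i j) (hI : ∀ J, J ⊂ I → Inv σ D V J) {x : Fin N → ℝ}
    (hx : x ∉ kset D V I 0) :
    ∀ᶠ q in 𝓝[{p : ℝ × (Fin N → ℝ) | 0 ≤ p.1}] (0, x), q.2 ∉ kset D V I q.1 := by
  have : ∀ᶠ q in 𝓝[{p : ℝ × (Fin N → ℝ) | 0 ≤ p.1}] (0, x),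
      ∀ i ∈ I, ∑ j, D i j * V (I.erase i) j q.1 q.2 < q.2 i := by
    rw [Filter.eventually_all_finset]
    intro i hi
    have hlt : ∑ j, D i j * V (I.erase i) j 0 x < x i := by
      by_contra hle
      exact hx ⟨i, hi, not_lt.1 hle⟩
    set g := x i - ∑ j, D i j * V (I.erase i) j 0 x with hg
    have hg0 : 0 < g := by linarith
    have hS : 0 ≤ ∑ j, D i j := Finset.sum_nonneg fun j _ => hD i j
    set ε := g / (2 * (∑ j, D i j + 1)) with hε
    have hε0 : 0 < ε := by positivity
    have h1 : ∀ᶠ q in 𝓝[{p : ℝ × (Fin N → ℝ) | 0 ≤ p.1}] (0, x), ∀ j,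
        V (I.erase i) j q.1 q.2 < V (I.erase i) j 0 x + ε := by
      rw [Filter.eventually_all]
      exact fun j => (hI _ (Finset.erase_ssubset hi)).usc j x ε hε0
    have hc2 : ContinuousAt (fun q : ℝ × (Fin N → ℝ) => q.2 i) (0, x) := by fun_prop
    have h2 : ∀ᶠ q in 𝓝[{p : ℝ × (Fin N → ℝ) | 0 ≤ p.1}] (0, x), x i - g / 2 < q.2 i :=
      (hc2.eventually (lt_mem_nhds (show x i - g / 2 < x i by linarith))).filter_mono
        nhdsWithin_le_nhds
    filter_upwards [h1, h2] with q h1 h2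
    have h3 := sumD_mono hD (fun j => (h1 j).le) i
    have h4 : ∑ j, D i j * (V (I.erase i) j 0 x + ε) =
        ∑ j, D i j * V (I.erase i) j 0 x + (∑ j, D i j) * ε := by
      rw [Finset.sum_mul, ← Finset.sum_add_distrib]
      exact Finset.sum_congr rfl fun j _ => by ring
    have h5 : (∑ j, D i j) * ε ≤ g / 2 := by
      have : (∑ j, D i j + 1) * ε = g / 2 := by rw [hε]; field_simp
      nlinarith
    linarith
  filter_upwards [this] with q hq
  rintro ⟨i, hi, hle⟩
  exact absurd (hq i hi) (not_lt.2 hle)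

theorem kill_of (hD : ∀ i j, 0 ≤ D i j) (hI : ∀ J, J ⊂ I → Inv σ D V J) {i k : Fin N}
    (hi : i ∈ I) (hk : k ∈ I) {τ : ℝ} (hτ : 0 ≤ τ) {x : Fin N → ℝ}
    (hx : x k ≤ ∑ j, D k j * V (I.erase k) j τ x) :
    uob V I i τ x = V (I.erase k) i τ x := by
  have hss := Finset.erase_ssubset hk
  have Hk := hI _ hss
  refine le_antisymm (Finset.inf'_le _ ?_) (Finset.le_inf' _ _ fun J hJ => ?_)
  · exact Finset.mem_insert_of_mem (Finset.mem_ssubsets.2 hss)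
  · have hJI := mem_ins hi hJ
    by_cases hkJ : k ∈ J
    · have hsub : J.erase k ⊆ I.erase k := Finset.erase_subset_erase k hJI.subset
      have hkill : x k ≤ ∑ j, D k j * V (J.erase k) j τ x :=
        hx.trans (sumD_mono hD (fun j => Hk.sub' hsub j hτ x) k)
      rw [(hI J hJI).kill k hkJ τ hτ x hkill i]
      exact Hk.sub' hsub i hτ x
    · have hsub : J ⊆ I.erase k := fun a ha =>
        Finset.mem_erase.2 ⟨fun h => hkJ (h ▸ ha), hJI.subset ha⟩
      exact Hk.sub' hsub i hτ x

end step
end Casc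

open Set Filter
open scoped Topology

namespace Casc
open MeasureTheory ProbabilityTheory

theorem ll_alive {N : ℕ} {σ : ℝ} {W : ℝ → (Fin N → ℝ) → ℝ} (R : Reg σ W) {τ : ℝ} (hτ : 0 < τ)
    {x : Fin N → ℝ}
    (h : ContDiffAt ℝ (⊤ : ℕ∞) (fun q : ℝ × (Fin N → ℝ) => W q.1 q.2) (τ, x)) :
    ∃ L r, 0 ≤ L ∧ 0 < r ∧ LL W τ x L r := by
  obtain ⟨K, s, hs, hK⟩ := (h.of_le (m := 1) (by exact_mod_cast le_top)).exists_lipschitzOnWith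
  obtain ⟨r0, hr0, hball⟩ := Metric.mem_nhds_iff.1 hs
  refine ⟨K, min r0 τ, K.2, lt_min hr0 hτ, fun t ht htr => ?_⟩
  have h1 : t < r0 := htr.trans_le (min_le_left _ _)
  have h2 : t < τ := htr.trans_le (min_le_right _ _)
  have hd : dist ((τ, x) : ℝ × (Fin N → ℝ)) (τ - t, x) = t := by
    rw [Prod.dist_eq]; simp [abs_of_nonneg ht, ht]
  have h3 := hK.dist_le_mul (τ, x) (hball (Metric.mem_ball_self hr0)) (τ - t, x)
    (hball (by rw [Metric.mem_ball, dist_comm, hd]; exact h1))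
  rw [hd, Real.dist_eq] at h3
  have h4 := (abs_le.1 h3).2
  have h5 := R.va (τ - t) (by linarith) (fun i => x i - K * t) x
    (fun i => by have := mul_nonneg K.2 ht; simp only; exact sub_le_self _ this)
  simp only at h4
  linarith

theorem inv_step {N : ℕ} {σ : ℝ} {D : Fin N → Fin N → ℝ}
    {V : Finset (Fin N) → Fin N → ℝ → (Fin N → ℝ) → ℝ} {I : Finset (Fin N)}
    (hσ : 0 < σ) (hD : ∀ i j, 0 ≤ D i j) (hI : ∀ J, J ⊂ I → Inv σ D V J)
    (hone : ∀ i ∉ I, V I i = fun _ _ => 1)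
    (hV : ∀ i ∈ I, V I i = Vs σ (uob V I i) (kset D V I)) : Inv σ D V I := by
  have hE : ∀ k ∈ I, Inv σ D V (I.erase k) := fun k hk => hI _ (Finset.erase_ssubset hk)
  have hreg : ∀ i, Reg σ (V I i) := by
    intro i
    by_cases hi : i ∈ I
    · have H := obs_of hD hI hi
      rw [hV i hi]
      exact ⟨fun τ hτ x => H.Vs_01 hτ x, fun τ hτ => H.Vs_meas hτ,
        fun τ hτ x y h => H.Vs_anti hτ x y h, fun s t hs hst x => H.Vs_mono hσ hs hst x,
        fun n k s hs x => H.Vs_super n k hs x⟩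
    · rw [hone i hi]; exact Reg.one
  have hcoord : ∀ i τ, 0 ≤ τ → ∀ x y : Fin N → ℝ, (∀ j ∈ I, x j = y j) →
      V I i τ x = V I i τ y := by
    intro i τ hτ x y hxy
    by_cases hi : i ∈ I
    · rw [hV i hi]
      refine Vs_coord I ?_ ?_ hτ x y hxy
      · intro τ hτ x y h
        refine Finset.inf'_congr _ rfl fun J hJ => ?_
        have hJI := mem_ins hi hJ
        exact (hI J hJI).coord i τ hτ x y fun j hj => h j (hJI.subset hj)
      · have key : ∀ τ, 0 ≤ τ → ∀ x y : Fin N → ℝ, (∀ j ∈ I, x j = y j) →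
            x ∈ kset D V I τ → y ∈ kset D V I τ := by
          rintro τ hτ x y h ⟨k, hk, hle⟩
          refine ⟨k, hk, ?_⟩
          rw [← h k hk]
          refine hle.trans (le_of_eq (Finset.sum_congr rfl fun j _ => ?_))
          rw [(hE k hk).coord j τ hτ x y fun l hl => h l (Finset.mem_of_mem_erase hl)]
        exact fun τ hτ x y h => ⟨key τ hτ x y h, key τ hτ y x fun j hj => (h j hj).symm⟩
    · rw [hone i hi]
  have hsub : ∀ J, J ⊂ I → ∀ i τ, 0 ≤ τ → ∀ x, V I i τ x ≤ V J i τ x := by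
    intro J hJ i τ hτ x
    by_cases hi : i ∈ I
    · rw [hV i hi]
      refine ((obs_of hD hI hi).Vs_le_u hτ x).trans (Finset.inf'_le _ ?_)
      exact Finset.mem_insert_of_mem (Finset.mem_ssubsets.2 hJ)
    · rw [hone i hi, (hI J hJ).one i fun h => hi (hJ.subset h)]
  have hkill : ∀ k ∈ I, ∀ τ, 0 ≤ τ → ∀ x : Fin N → ℝ,
      x k ≤ ∑ j, D k j * V (I.erase k) j τ x → ∀ i, V I i τ x = V (I.erase k) i τ x := by
    intro k hk τ hτ x hx i
    by_cases hi : i ∈ I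
    · rw [hV i hi, Vs_K (show x ∈ kset D V I τ from ⟨k, hk, hx⟩), kill_of hD hI hi hk hτ hx]
    · rw [hone i hi, (hE k hk).one i fun h => hi (Finset.mem_of_mem_erase h)]
  have hsmooth : ∀ i ∈ I, ∀ τ, 0 < τ → ∀ x, x ∉ kset D V I τ →
      ContDiffAt ℝ (⊤ : ℕ∞) (fun q : ℝ × (Fin N → ℝ) => V I i q.1 q.2) (τ, x) ∧
      Hop σ (fun q : ℝ × (Fin N → ℝ) => V I i q.1 q.2) (τ, x) = 0 := by
    intro i hi τ hτ x hx
    rw [hV i hi]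
    exact (obs_of hD hI hi).Vs_smooth hσ (τ, x) hτ hx
  have hll : ∀ i τ, 0 < τ → ∀ x, ∃ L r, 0 ≤ L ∧ 0 < r ∧ LL (V I i) τ x L r := by
    intro i τ hτ x
    by_cases hi : i ∈ I
    · by_cases hx : x ∈ kset D V I τ
      · obtain ⟨k, hk, hle⟩ := hx
        choose L r hL hr hLL using fun j => (hE k hk).ll j τ hτ x
        have : Nonempty (Fin N) := ⟨i⟩
        obtain ⟨j0, hj0⟩ := Finite.exists_min r
        have hL1 : ∀ j, L j ≤ ∑ j, L j := fun j =>
          Finset.single_le_sum (f := L) (fun j _ => hL j) (Finset.mem_univ j)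
        have hL10 : 0 ≤ ∑ j, L j := Finset.sum_nonneg fun j _ => hL j
        generalize ∑ j, L j = L1 at hL1 hL10
        have hS : 0 ≤ ∑ j, D k j := Finset.sum_nonneg fun j _ => hD k j
        have hLL1 : L1 ≤ (1 + ∑ j, D k j) * L1 := by nlinarith
        refine ⟨(1 + ∑ j, D k j) * L1, min (r j0) τ, by positivity, lt_min (hr j0) hτ, ?_⟩
        have hA : ∀ j, LL (V (I.erase k) j) τ x L1 (min (r j0) τ) := fun j =>
          (hLL j).mono ((hE k hk).reg j) (hL1 j) ((min_le_left _ _).trans (hj0 j)) (min_le_right _ _)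
        have hB : ∀ j, LL (V (I.erase k) j) τ x ((1 + ∑ j, D k j) * L1) (min (r j0) τ) := fun j =>
          (hA j).mono ((hE k hk).reg j) hLL1 le_rfl (min_le_right _ _)
        intro s hs hsr
        have hsτ : s < τ := hsr.trans_le (min_le_right _ _)
        set L2 := (1 + ∑ j, D k j) * L1 with hL2
        have hk2 : (fun i => x i - L2 * s) k ≤
            ∑ j, D k j * V (I.erase k) j (τ - s) (fun i => x i - L2 * s) := by
          have h1 : ∑ j, D k j * (V (I.erase k) j τ x - L1 * s) ≤
              ∑ j, D k j * V (I.erase k) j (τ - s) (fun i => x i - L2 * s) := by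
            refine sumD_mono hD (fun j => (hA j s hs hsr).trans ?_) k
            refine ((hE k hk).reg j).va _ (by linarith) _ _ fun i => ?_
            have := mul_le_mul_of_nonneg_right hLL1 hs
            simp only; linarith
          have h2 : ∑ j, D k j * (V (I.erase k) j τ x - L1 * s) =
              ∑ j, D k j * V (I.erase k) j τ x - (∑ j, D k j) * (L1 * s) := by
            rw [Finset.sum_mul, ← Finset.sum_sub_distrib]
            exact Finset.sum_congr rfl fun j _ => by ring
          have h3 : 0 ≤ L1 * s := mul_nonneg hL10 hs
          simp only
          have : L2 * s = L1 * s + (∑ j, D k j) * (L1 * s) := by rw [hL2]; ring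
          linarith
        rw [hkill k hk τ hτ.le x hle i, hkill k hk (τ - s) (by linarith) _ hk2 i]
        exact hB i s hs hsr
      · exact ll_alive (hreg i) hτ (hsmooth i hi τ hτ x hx).1
    · rw [hone i hi]
      exact ⟨0, 1, le_rfl, one_pos, fun s _ _ => by simp⟩
  have hzero : ∀ i ∈ I, ∀ x, x ∉ kset D V I 0 → V I i 0 x = 0 := by
    intro i hi x hx
    rw [hV i hi, Vs_zero hx]
  refine ⟨hone, hreg, hcoord, hsub, hkill, hsmooth, ?_, ?_, hll, hzero⟩
  · intro i τ hτ x
    by_cases hi : i ∈ I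
    · by_cases hx : x ∈ kset D V I τ
      · obtain ⟨k, hk, hle⟩ := hx
        refine tendsto_order.2 ⟨fun a ha => ?_, fun a ha => ?_⟩
        · obtain ⟨L, r, hL, hr, hLL⟩ := hll i τ hτ x
          simp only at ha
          obtain ⟨δ, hδ, hl⟩ := (hreg i).lsc hσ hτ x hL hr hLL
            (show 0 < (V I i τ x - a) / 2 by linarith)
          have e1 : ∀ᶠ q : ℝ × (Fin N → ℝ) in 𝓝 (τ, x), τ - δ < q.1 :=
            continuous_fst.continuousAt.eventually (lt_mem_nhds (show τ - δ < τ by linarith))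
          have e2 : ∀ᶠ q : ℝ × (Fin N → ℝ) in 𝓝 (τ, x), ∀ i, q.2 i < x i + δ := by
            rw [Filter.eventually_all]
            intro i
            have hc2 : ContinuousAt (fun q : ℝ × (Fin N → ℝ) => q.2 i) (τ, x) := by fun_prop
            exact hc2.eventually (gt_mem_nhds (show x i < x i + δ by linarith))
          filter_upwards [e1, e2] with q h1 h2
          have := hl q.1 q.2 h1 h2
          linarith
        · simp only [hkill k hk τ hτ.le x hle i] at ha
          have e1 := ((hE k hk).cont i τ hτ x).eventually (gt_mem_nhds ha)
          have e2 : ∀ᶠ q : ℝ × (Fin N → ℝ) in 𝓝 (τ, x), 0 < q.1 :=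
            continuous_fst.continuousAt.eventually (lt_mem_nhds hτ)
          filter_upwards [e1, e2] with q h1 h2
          exact (hsub _ (Finset.erase_ssubset hk) i q.1 h2.le q.2).trans_lt h1
      · exact (hsmooth i hi τ hτ x hx).1.continuousAt
    · rw [hone i hi]; exact continuousAt_const
  · intro i x ε hε
    by_cases hi : i ∈ I
    · by_cases hx : x ∈ kset D V I 0
      · obtain ⟨k, hk, hle⟩ := hx
        rw [hkill k hk 0 le_rfl x hle i]
        filter_upwards [(hE k hk).usc i x ε hε, self_mem_nhdsWithin] with q h1 h2
        exact (hsub _ (Finset.erase_ssubset hk) i q.1 h2 q.2).trans_lt h1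
      · obtain ⟨r, hr, hb⟩ := Metric.mem_nhdsWithin_iff.1 (alive_nhds_zero hD hI hx)
        have hK : ∀ τ, 0 ≤ τ → τ < r → ∀ y ∈ kset D V I τ, r ^ 2 ≤ ∑ i, (y i - x i) ^ 2 := by
          intro τ hτ hτr y hy
          by_contra hlt
          push Not at hlt
          refine (hb (show ((τ, y) : ℝ × (Fin N → ℝ)) ∈ _ from ⟨?_, hτ⟩)) hy
          rw [Metric.mem_ball, Prod.dist_eq, max_lt_iff]
          refine ⟨by simpa [Real.dist_eq, abs_of_nonneg hτ] using hτr, ?_⟩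
          rw [dist_pi_lt_iff hr]
          intro j
          rw [Real.dist_eq]
          refine abs_lt_of_sq_lt_sq ?_ hr.le
          refine lt_of_le_of_lt ?_ hlt
          exact Finset.single_le_sum (f := fun i => (y i - x i) ^ 2) (fun j _ => sq_nonneg _)
            (Finset.mem_univ j)
        have hc : ContinuousAt (fun q : ℝ × (Fin N → ℝ) =>
            (1 / r ^ 2) * (∑ i, (q.2 i - x i) ^ 2 + N * σ ^ 2 * q.1)) (0, x) := by fun_prop
        have e1 := hc.eventually (gt_mem_nhds (show (1 / r ^ 2) *
          (∑ i, (((0, x) : ℝ × (Fin N → ℝ)).2 i - x i) ^ 2 +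
            N * σ ^ 2 * ((0, x) : ℝ × (Fin N → ℝ)).1) < ε by simpa using hε))
        have e2 : ∀ᶠ q : ℝ × (Fin N → ℝ) in 𝓝 (0, x), q.1 < r :=
            continuous_fst.continuousAt.eventually (gt_mem_nhds hr)
        rw [hzero i hi x hx, zero_add, hV i hi]
        filter_upwards [nhdsWithin_le_nhds e1, nhdsWithin_le_nhds e2, self_mem_nhdsWithin]
          with q h1 h2 h3
        exact ((obs_of hD hI hi).Vs_init hr x hK h3 h2 q.2).trans_lt h1
    · rw [hone i hi]
      exact Filter.Eventually.of_forall fun _ => by simpa using hε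

theorem inv_cas {N : ℕ} {σ : ℝ} {D : Fin N → Fin N → ℝ} (hσ : 0 < σ) (hD : ∀ i j, 0 ≤ D i j)
    (I : Finset (Fin N)) : Inv σ D (cas σ D) I := by
  induction I using Finset.strongInduction with
  | H I ih => exact inv_step hσ hD ih (fun i hi => cas_notMem hi) (fun i hi => cas_mem hi)

end Casc

open Set Filter
open scoped Topology

namespace Casc
open MeasureTheory ProbabilityTheory

/-- the solution, in the original time variable -/
noncomputable def sol {N : ℕ} (T σ : ℝ) (D : Fin N → Fin N → ℝ) (I : Finset (Fin N)) (i : Fin N)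
    (t : ℝ) (x : Fin N → ℝ) : ℝ := cas σ D I i (T - t) x

section
variable {N : ℕ} {T σ : ℝ} {D : Fin N → Fin N → ℝ}

theorem mem_domT_sol {I : Finset (Fin N)} {t : ℝ} {x : Fin N → ℝ} :
    (t, x) ∈ domT N T D (sol T σ D) I ↔ t ∈ Icc 0 T ∧ x ∉ kset D (cas σ D) I (T - t) := by
  constructor
  · rintro ⟨h1, h2⟩
    refine ⟨h1, ?_⟩
    rintro ⟨i, hi, hle⟩
    exact absurd (h2 i hi) (not_lt.2 hle)
  · rintro ⟨h1, h2⟩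
    refine ⟨h1, fun i hi => ?_⟩
    by_contra hle
    exact h2 ⟨i, hi, not_lt.1 hle⟩

theorem mem_dom_sol {I : Finset (Fin N)} {p : ℝ × (Fin N → ℝ)} :
    p ∈ dom N T D (sol T σ D) I ↔
      (p.1 ∈ Ico 0 T ∧ p.2 ∉ kset D (cas σ D) I (T - p.1)) := by
  obtain ⟨t, x⟩ := p
  constructor
  · rintro ⟨h1, h2⟩
    have := mem_domT_sol.1 h1
    exact ⟨⟨this.1.1, h2⟩, this.2⟩
  · rintro ⟨h1, h2⟩
    exact ⟨mem_domT_sol.2 ⟨⟨h1.1, h1.2.le⟩, h2⟩, h1.2⟩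

theorem dv_zero_of_const {d : ℕ} {f : ℝ × (Fin d → ℝ) → ℝ} {p v : ℝ × (Fin d → ℝ)}
    (h : ∀ t : ℝ, f (p + t • v) = f p) : dv v f p = 0 := by
  by_cases hd : DifferentiableAt ℝ f p
  · have h1 := dv_hasDerivAt (v := v) hd
    have h2 : HasDerivAt (fun t : ℝ => f (p + t • v)) 0 0 := by
      simp only [h]; exact hasDerivAt_const _ _
    exact h1.unique h2
  · rw [dv, fderiv_zero_of_not_differentiableAt hd]; rfl

theorem solves_sol (hσ : 0 < σ) (hD : ∀ i j, 0 ≤ D i j) {I : Finset (Fin N)} {i : Fin N}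
    (hi : i ∈ I) : SolvesHeatOn N T σ I (sol T σ D I i) (dom N T D (sol T σ D) I) := by
  have HI := inv_cas (N := N) hσ hD I
  set F : ℝ × (Fin N → ℝ) → ℝ := fun q => cas σ D I i q.1 q.2 with hF
  have hsm : ∀ p ∈ dom N T D (sol T σ D) I, ContDiffAt ℝ (⊤ : ℕ∞) F (T - p.1, p.2) ∧
      Hop σ F (T - p.1, p.2) = 0 := fun p hp => by
    have := mem_dom_sol.1 hp
    exact HI.smooth i hi _ (by linarith [this.1.2]) _ this.2
  have hne : (⊤ : ℕ∞) ≠ 0 := by simp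
  have hdiff : ∀ {G : ℝ × (Fin N → ℝ) → ℝ} {q}, ContDiffAt ℝ (⊤ : ℕ∞) G q → DifferentiableAt ℝ G q :=
    fun h => h.differentiableAt (by simp)
  have hsp : ∀ {G : ℝ × (Fin N → ℝ) → ℝ} {τ : ℝ} {x : Fin N → ℝ}, DifferentiableAt ℝ G (τ, x) →
      ∀ j, HasDerivAt (fun y => G (τ, Function.update x j y)) (dv (ex j) G (τ, x)) (x j) := by
    intro G τ x hG j
    have h1 : HasDerivAt (fun y => ((τ, Function.update x j y) : ℝ × (Fin N → ℝ)))
        (0, Pi.single j 1) (x j) := (hasDerivAt_const _ _).prodMk (hasDerivAt_update x j (x j))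
    have h2 : HasFDerivAt G (fderiv ℝ G (τ, x)) (τ, Function.update x j (x j)) := by
      rw [Function.update_eq_self]; exact hG.hasFDerivAt
    exact h2.comp_hasDerivAt (x j) h1
  have hcts : ∀ G : ℝ × (Fin N → ℝ) → ℝ, (∀ p ∈ dom N T D (sol T σ D) I,
      ContDiffAt ℝ (⊤ : ℕ∞) G (T - p.1, p.2)) →
      ContinuousOn (fun p : ℝ × (Fin N → ℝ) => G (T - p.1, p.2)) (dom N T D (sol T σ D) I) := by
    intro G hG p hp
    have hc : ContinuousAt (fun p : ℝ × (Fin N → ℝ) => ((T - p.1, p.2) : ℝ × (Fin N → ℝ))) p := by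
      fun_prop
    exact (ContinuousAt.comp (f := fun p : ℝ × (Fin N → ℝ) => ((T - p.1, p.2) : ℝ × (Fin N → ℝ)))
      (hG p hp).continuousAt hc).continuousWithinAt
  refine ⟨fun t x => - dv et F (T - t, x), fun t x j => dv (ex j) F (T - t, x),
    fun t x j => dv (ex j) (dv (ex j) F) (T - t, x), ?_, ?_, ?_, ?_, ?_, ?_, ?_⟩
  · intro p hp
    have h1 : HasDerivAt (fun s => ((T - s, p.2) : ℝ × (Fin N → ℝ))) (-1, 0) p.1 :=
      ((hasDerivAt_id p.1).const_sub T).prodMk (hasDerivAt_const _ _)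
    have h2 := (hdiff (hsm p hp).1).hasFDerivAt.comp_hasDerivAt p.1 h1
    have h3 : fderiv ℝ F (T - p.1, p.2) (-1, 0) = - dv et F (T - p.1, p.2) := by
      rw [dv, ← map_neg]; congr 1; simp [et]
    rw [h3] at h2
    exact h2.hasDerivWithinAt
  · intro p hp j _
    exact hsp (hdiff (hsm p hp).1) j
  · intro p hp j _
    exact hsp (hdiff (contDiffAt_dv (hsm p hp).1)) j
  · exact (hcts _ fun p hp => contDiffAt_dv (hsm p hp).1).neg
  · exact fun j _ => hcts _ fun p hp => contDiffAt_dv (hsm p hp).1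
  · exact fun j _ => hcts _ fun p hp => contDiffAt_dv (contDiffAt_dv (hsm p hp).1)
  · intro p hp
    have h1 := (hsm p hp).2
    have hp' := mem_dom_sol.1 hp
    have h2 : ∀ j ∉ I, dv (ex j) (dv (ex j) F) (T - p.1, p.2) = 0 := by
      intro j hj
      have e : dv (ex j) F =ᶠ[𝓝 (T - p.1, p.2)] fun _ => 0 := by
        have : ∀ᶠ q : ℝ × (Fin N → ℝ) in 𝓝 (T - p.1, p.2), 0 < q.1 :=
          continuous_fst.continuousAt.eventually
            (lt_mem_nhds (show 0 < T - p.1 by linarith [hp'.1.2]))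
        filter_upwards [this] with q hq
        refine dv_zero_of_const fun t => ?_
        have e1 : (q + t • ex j : ℝ × (Fin N → ℝ)).1 = q.1 := by simp [ex]
        simp only [hF]
        rw [e1]
        refine HI.coord i q.1 hq.le _ _ fun l hl => ?_
        have : l ≠ j := fun h => hj (h ▸ hl)
        simp [ex, Pi.single_eq_of_ne this]
      rw [(dv_congr e).eq_of_nhds]
      exact dv_zero_of_const fun t => rfl
    rw [Hop] at h1
    have h3 : ∑ j ∈ I, dv (ex j) (dv (ex j) F) (T - p.1, p.2) =
        ∑ j, dv (ex j) (dv (ex j) F) (T - p.1, p.2) :=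
      Finset.sum_subset (Finset.subset_univ _) fun j _ hj => h2 j hj
    simp only [h3]
    linarith

theorem classical_sol (hT : 0 < T) (hσ : 0 < σ) (hD : ∀ i j, 0 ≤ D i j) :
    IsClassicalSolution N T σ D (sol T σ D) := by
  intro I
  have HI := inv_cas (N := N) hσ hD I
  refine ⟨fun i t ht x y h => HI.coord i _ (by linarith [ht.2]) x y h,
    fun i hi t ht x => by rw [sol, HI.one i hi], fun i hi => ⟨?_, solves_sol hσ hD hi, ?_, ?_, ?_, ?_, ?_⟩⟩
  · refine ⟨(fun p : ℝ × (Fin N → ℝ) => ((T - p.1, p.2) : ℝ × (Fin N → ℝ))) ⁻¹'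
      {q | 0 < q.1 ∧ q.2 ∉ kset D (cas σ D) I q.1}, ?_, ?_⟩
    · refine IsOpen.preimage (by fun_prop) ?_
      rw [isOpen_iff_mem_nhds]
      rintro p ⟨h0, hp⟩
      exact alive_nhds (fun J _ => inv_cas hσ hD J) h0 hp
    · ext p
      rw [mem_dom_sol]
      constructor
      · rintro ⟨h1, h2⟩
        exact ⟨⟨sub_pos.2 h1.2, h2⟩, h1⟩
      · rintro ⟨⟨h1, h2⟩, h3⟩
        exact ⟨h3, h2⟩
  · refine ⟨1, fun t ht x => ?_⟩
    have := (HI.reg i).v01 (T - t) (by linarith [ht.2]) x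
    rw [sol, abs_of_nonneg this.1]
    exact this.2
  · intro p hp
    have hc : ContinuousAt (fun p : ℝ × (Fin N → ℝ) => ((T - p.1, p.2) : ℝ × (Fin N → ℝ))) p := by
      fun_prop
    have h1 := HI.cont i (T - p.1) (by linarith [hp.2]) p.2
    exact (ContinuousAt.comp (f := fun p : ℝ × (Fin N → ℝ) => ((T - p.1, p.2) : ℝ × (Fin N → ℝ)))
      h1 hc).continuousWithinAt
  · intro t ht x hx
    have hk : (killedSet N D (sol T σ D) I t x).Nonempty := by
      by_contra hne
      rw [Finset.not_nonempty_iff_eq_empty] at hne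
      refine hx ⟨ht, fun i hi => ?_⟩
      by_contra hle
      have : i ∈ killedSet N D (sol T σ D) I t x := Finset.mem_filter.2 ⟨hi, not_lt.1 hle⟩
      rw [hne] at this
      simp at this
    rw [bdryFun, dif_pos hk]
    have h2 := Finset.mem_filter.1 ((killedSet N D (sol T σ D) I t x).min'_mem hk)
    exact HI.kill _ h2.1 (T - t) (by linarith [ht.2]) x h2.2 i
  · intro x hx
    have := (mem_domT_sol.1 hx).2
    rw [sub_self] at this
    rw [sol, sub_self]
    exact HI.zero i hi x this
  · intro K hK hKd
    have h0 : ∀ x ∈ K, cas σ D I i 0 x = 0 := fun x hx => by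
      have := (mem_domT_sol.1 (hKd ⟨rfl, hx⟩)).2
      rw [sub_self] at this
      exact HI.zero i hi x this
    have key : ∀ ε > 0, ∀ᶠ t in 𝓝[<] T, ∀ x ∈ K, cas σ D I i (T - t) x < ε := by
      intro ε hε
      have h1 : ∀ᶠ τ : ℝ in 𝓝 0, ∀ x ∈ K, 0 ≤ τ → cas σ D I i τ x < ε := by
        refine hK.eventually_forall_of_forall_eventually fun x hx => ?_
        have := HI.usc i x ε hε
        rw [h0 x hx, zero_add] at this
        exact eventually_nhdsWithin_iff.1 this
      have h2 : Tendsto (fun t => T - t) (𝓝[<] T) (𝓝 0) := by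
        have : Tendsto (fun t => T - t) (𝓝 T) (𝓝 (T - T)) := (continuous_const.sub continuous_id).tendsto T
        rw [sub_self] at this
        exact this.mono_left nhdsWithin_le_nhds
      filter_upwards [h2.eventually h1, self_mem_nhdsWithin] with t h3 h4 x hx
      exact h3 x hx (sub_nonneg.2 (le_of_lt h4))
    rw [Metric.tendsto_nhds]
    intro ε hε
    filter_upwards [key (ε / 2) (half_pos hε), self_mem_nhdsWithin] with t h1 h2
    have h3 : ∀ z ∈ (fun x => |sol T σ D I i t x - sol T σ D I i T x|) '' K, 0 ≤ z ∧ z ≤ ε / 2 := by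
      rintro _ ⟨x, hx, rfl⟩
      refine ⟨abs_nonneg _, ?_⟩
      simp only [sol, sub_self]
      rw [h0 x hx, sub_zero, abs_of_nonneg ((HI.reg i).v01 _ (sub_nonneg.2 (le_of_lt h2)) x).1]
      exact (h1 x hx).le
    rw [Real.dist_eq, sub_zero, abs_of_nonneg (Real.sSup_nonneg fun z hz => (h3 z hz).1)]
    exact (Real.sSup_le (fun z hz => (h3 z hz).2) (half_pos hε).le).trans_lt (half_lt_self hε)

theorem noninc_sol (hσ : 0 < σ) (hD : ∀ i j, 0 ≤ D i j) :
    IsNonincreasingSol N T (sol T σ D) := by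
  intro I i hi s t x y hs ht hst hxy
  have HI := inv_cas (N := N) hσ hD I
  have h1 := (HI.reg i).vt (T - t) (T - s) (by linarith [ht.2]) (by linarith) x
  have h2 := (HI.reg i).va (T - s) (by linarith [hs.2]) (fun j => if j ∈ I then y j else x j) x
    (fun j => by by_cases hj : j ∈ I <;> simp [hj, hxy])
  have h3 := HI.coord i (T - s) (by linarith [hs.2]) (fun j => if j ∈ I then y j else x j) y
    (fun j hj => by simp [hj])
  simp only [sol]
  linarith

theorem sol_mem (hσ : 0 < σ) (hD : ∀ i j, 0 ≤ D i j) (I : Finset (Fin N)) (i : Fin N)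
    {t : ℝ} (ht : t ∈ Icc (0:ℝ) T) (x : Fin N → ℝ) : sol T σ D I i t x ∈ Icc (0:ℝ) 1 :=
  ((inv_cas (N := N) hσ hD I).reg i).v01 _ (by linarith [ht.2]) x

end
end Casc

open Set Filter
open scoped Topology

namespace Casc
open MeasureTheory ProbabilityTheory

theorem second_le_zero {g φ : ℝ → ℝ} {a c : ℝ} (hg : ∀ᶠ y in 𝓝 a, HasDerivAt g (φ y) y)
    (hφ : HasDerivAt φ c a) (hm : IsLocalMax g a) : c ≤ 0 := by
  by_contra hc
  push Not at hc
  have h0 : φ a = 0 := hm.hasDerivAt_eq_zero hg.self_of_nhds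
  have he : deriv g =ᶠ[𝓝 a] φ := hg.mono fun y hy => hy.deriv
  have hdd : deriv (deriv g) a = c := by rw [he.deriv_eq]; exact hφ.deriv
  have hmin : IsLocalMin g a := isLocalMin_of_deriv_deriv_pos (by rw [hdd]; exact hc)
    (by rw [he.eq_of_nhds, h0]) hg.self_of_nhds.continuousAt
  have heq : g =ᶠ[𝓝 a] fun _ => g a := by
    filter_upwards [hm, hmin] with y h1 h2
    exact le_antisymm h1 h2
  have h1 : deriv g =ᶠ[𝓝 a] deriv fun _ => g a := heq.deriv
  have h2 : deriv (deriv g) a = 0 := by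
    rw [h1.deriv_eq]; simp
  linarith

theorem right_deriv_le_zero {g : ℝ → ℝ} {a t T : ℝ} (h0 : 0 ≤ t) (htT : t < T)
    (h : HasDerivWithinAt g a (Icc 0 T) t) (hm : ∀ s, t ≤ s → s < T → g s ≤ g t) : a ≤ 0 := by
  have h1 : HasDerivWithinAt g a (Ioo t T) t :=
    h.mono fun s hs => ⟨h0.trans hs.1.le, hs.2.le⟩
  rw [hasDerivWithinAt_iff_tendsto_slope' (by simp)] at h1
  have : NeBot (𝓝[Ioo t T] t) := by
    rw [nhdsWithin_Ioo_eq_nhdsGT htT]; infer_instance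
  refine le_of_tendsto h1 ?_
  filter_upwards [self_mem_nhdsWithin] with s hs
  rw [slope_def_field]
  exact div_nonpos_of_nonpos_of_nonneg (by linarith [hm s hs.1.le hs.2]) (by linarith [hs.1])

/-- maximum principle -/
theorem maxp {N : ℕ} {T σ : ℝ} {Φ : ℝ → (Fin N → ℝ) → ℝ}
    (hc : ContinuousOn (fun p : ℝ × (Fin N → ℝ) => Φ p.1 p.2) {p | p.1 ∈ Ico 0 T})
    (R : ℝ) (hR : ∀ t ∈ Ico 0 T, ∀ x, x ∉ Metric.closedBall (0 : Fin N → ℝ) R → Φ t x ≤ 0)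
    (hT0 : ∀ x, ∀ᶠ p : ℝ × (Fin N → ℝ) in 𝓝 (T, x), p.1 ∈ Ico 0 T → Φ p.1 p.2 ≤ 0)
    (hpde : ∀ t ∈ Ico 0 T, ∀ x, 0 < Φ t x → ∃ (a : ℝ) (φ : Fin N → ℝ → ℝ) (b : Fin N → ℝ),
      HasDerivWithinAt (fun s => Φ s x) a (Icc 0 T) t ∧
      (∀ j, (∀ᶠ y in 𝓝 (x j), HasDerivAt (fun y => Φ t (Function.update x j y)) (φ j y) y) ∧
        HasDerivAt (φ j) (b j) (x j)) ∧ 0 < a + σ ^ 2 / 2 * ∑ j, b j) :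
    ∀ t ∈ Ico 0 T, ∀ x, Φ t x ≤ 0 := by
  intro t0 ht0 x0
  by_contra hpos
  push Not at hpos
  have h1 : ∀ᶠ t : ℝ in 𝓝 T, ∀ x ∈ Metric.closedBall (0 : Fin N → ℝ) R,
      t ∈ Ico 0 T → Φ t x ≤ 0 :=
    (isCompact_closedBall 0 R).eventually_forall_of_forall_eventually fun x _ => hT0 x
  obtain ⟨δ, hδ, hb⟩ := Metric.mem_nhds_iff.1 h1
  have hneg : ∀ t ∈ Ico 0 T, T - δ < t → ∀ x, Φ t x ≤ 0 := by
    intro t ht htd x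
    by_cases hx : x ∈ Metric.closedBall (0 : Fin N → ℝ) R
    · refine hb (show t ∈ Metric.ball T δ from ?_) x hx ht
      rw [Metric.mem_ball, Real.dist_eq, abs_lt]
      constructor <;> linarith [ht.2]
    · exact hR t ht x hx
  have hsub : Icc 0 (T - δ) ×ˢ Metric.closedBall (0 : Fin N → ℝ) R ⊆ {p | p.1 ∈ Ico 0 T} :=
    fun p hp => ⟨hp.1.1, by linarith [hp.1.2]⟩
  have hmem : ∀ t ∈ Ico 0 T, ∀ x, 0 < Φ t x →
      (t, x) ∈ Icc 0 (T - δ) ×ˢ Metric.closedBall (0 : Fin N → ℝ) R := by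
    intro t ht x h
    constructor
    · refine ⟨ht.1, ?_⟩
      by_contra hlt
      exact absurd (hneg t ht (not_le.1 hlt) x) (not_le.2 h)
    · by_contra hx
      exact absurd (hR t ht x hx) (not_le.2 h)
  obtain ⟨⟨t1, x1⟩, hp1, hmax⟩ := (isCompact_Icc.prod (isCompact_closedBall (0 : Fin N → ℝ) R)
    ).exists_isMaxOn ⟨(t0, x0), hmem t0 ht0 x0 hpos⟩ (hc.mono hsub)
  have ht1 : t1 ∈ Ico 0 T := hsub hp1
  have hge : Φ t0 x0 ≤ Φ t1 x1 := hmax (hmem t0 ht0 x0 hpos)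
  have hpos1 : 0 < Φ t1 x1 := hpos.trans_le hge
  have hglob : ∀ t ∈ Ico 0 T, ∀ x, Φ t x ≤ Φ t1 x1 := by
    intro t ht x
    by_cases h : 0 < Φ t x
    · exact hmax (hmem t ht x h)
    · exact (not_lt.1 h).trans hpos1.le
  obtain ⟨a, φ, b, ha, hφ, hs⟩ := hpde t1 ht1 x1 hpos1
  have ha0 : a ≤ 0 := right_deriv_le_zero ht1.1 ht1.2 ha
    fun s h1 h2 => hglob s ⟨ht1.1.trans h1, h2⟩ x1
  have hb0 : ∑ j, b j ≤ 0 := Finset.sum_nonpos fun j _ =>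
    second_le_zero (hφ j).1 (hφ j).2 (Filter.Eventually.of_forall fun y => by
      simp only [Function.update_eq_self]
      exact hglob t1 ht1 _)
  have : 0 ≤ σ ^ 2 / 2 := by positivity
  nlinarith

/-- one dimensional barrier -/
noncomputable def bar (σ ε τ y : ℝ) : ℝ :=
  Real.exp (Real.log ε / 2 - Real.log (τ + ε) / 2 - y ^ 2 / (2 * σ ^ 2 * (τ + ε)))

theorem bar_t {σ ε τ : ℝ} (hσ : 0 < σ) (h : 0 < τ + ε) (y : ℝ) :
    HasDerivAt (fun τ => bar σ ε τ y)
      ((y ^ 2 / (2 * σ ^ 2 * (τ + ε) ^ 2) - 1 / (2 * (τ + ε))) * bar σ ε τ y) τ := by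
  have h1 : HasDerivAt (fun τ => τ + ε) 1 τ := (hasDerivAt_id τ).add_const ε
  have h2 := (h1.log h.ne').div_const 2
  have h3 : HasDerivAt (fun τ => y ^ 2 / (2 * σ ^ 2 * (τ + ε)))
      (-(y ^ 2 / (2 * σ ^ 2 * (τ + ε) ^ 2))) τ := by
    have := (hasDerivAt_const τ (y ^ 2)).fun_div (h1.const_mul (2 * σ ^ 2)) (by positivity)
    refine this.congr_deriv ?_
    field_simp
    ring
  have h4 := (((hasDerivAt_const τ (Real.log ε / 2)).sub h2).sub h3).exp
  refine h4.congr_deriv ?_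
  simp only [bar, Pi.sub_apply]
  field_simp
  ring

theorem bar_y {σ ε τ : ℝ} (hσ : 0 < σ) (h : 0 < τ + ε) (y : ℝ) :
    HasDerivAt (fun y => bar σ ε τ y) (-(y / (σ ^ 2 * (τ + ε))) * bar σ ε τ y) y := by
  have h3 : HasDerivAt (fun y : ℝ => y ^ 2 / (2 * σ ^ 2 * (τ + ε)))
      (2 * y / (2 * σ ^ 2 * (τ + ε))) y := by
    refine (((hasDerivAt_id y).fun_pow 2).div_const _).congr_deriv ?_
    simp
  have h4 := ((hasDerivAt_const y (Real.log ε / 2 - Real.log (τ + ε) / 2)).sub h3).exp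
  refine h4.congr_deriv ?_
  simp only [bar, Pi.sub_apply]
  field_simp
  ring

theorem bar_yy {σ ε τ : ℝ} (hσ : 0 < σ) (h : 0 < τ + ε) (y : ℝ) :
    HasDerivAt (fun y => -(y / (σ ^ 2 * (τ + ε))) * bar σ ε τ y)
      ((y ^ 2 / (σ ^ 2 * (τ + ε)) ^ 2 - 1 / (σ ^ 2 * (τ + ε))) * bar σ ε τ y) y := by
  have h1 : HasDerivAt (fun y : ℝ => -(y / (σ ^ 2 * (τ + ε)))) (-(1 / (σ ^ 2 * (τ + ε)))) y :=
    ((hasDerivAt_id y).div_const _).fun_neg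
  refine (h1.mul (bar_y hσ h y)).congr_deriv ?_
  field_simp
  ring

theorem bar_heat {σ ε τ : ℝ} (hσ : 0 < σ) (h : 0 < τ + ε) (y : ℝ) :
    (y ^ 2 / (2 * σ ^ 2 * (τ + ε) ^ 2) - 1 / (2 * (τ + ε))) * bar σ ε τ y =
    σ ^ 2 / 2 * ((y ^ 2 / (σ ^ 2 * (τ + ε)) ^ 2 - 1 / (σ ^ 2 * (τ + ε))) * bar σ ε τ y) := by
  field_simp

theorem bar_cont {σ ε τ : ℝ} (hσ : 0 < σ) (h : 0 < τ + ε) (y : ℝ) :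
    ContinuousAt (fun p : ℝ × ℝ => bar σ ε p.1 p.2) (τ, y) := by
  unfold bar
  have h1 : (τ + ε) ≠ 0 := h.ne'
  have h2 : 2 * σ ^ 2 * (τ + ε) ≠ 0 := by positivity
  refine Real.continuous_exp.continuousAt.comp' ?_
  refine ContinuousAt.sub (ContinuousAt.sub continuousAt_const ?_) ?_
  · have h3 : ContinuousAt (fun p : ℝ × ℝ => p.1 + ε) (τ, y) := by fun_prop
    exact (h3.log h1).div_const 2
  · exact ContinuousAt.div (by fun_prop) (by fun_prop) h2

theorem bar_zero {σ ε : ℝ} : bar σ ε 0 0 = 1 := by simp [bar]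

theorem bar_pos {σ ε τ y : ℝ} : 0 < bar σ ε τ y := Real.exp_pos _

theorem bar_le {σ ε τ y : ℝ} (hτ : 0 < τ) (hε : 0 < ε) :
    bar σ ε τ y ≤ Real.exp (Real.log ε / 2 - Real.log τ / 2) := by
  refine Real.exp_le_exp.2 ?_
  have h1 : Real.log τ ≤ Real.log (τ + ε) := Real.log_le_log hτ (by linarith)
  have h2 : 0 ≤ y ^ 2 / (2 * σ ^ 2 * (τ + ε)) := by positivity
  linarith

end Casc

open Set Filter
open scoped Topology

namespace Casc
open MeasureTheory ProbabilityTheory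

/-- one dimensional barrier sum -/
noncomputable def gb {ι : Type} [Fintype ι] (σ ε C : ℝ) (c : ι → ℝ) (τ y : ℝ) : ℝ :=
  2 * C * ∑ A, bar σ ε τ (y - c A) + ε * y ^ 2

theorem gb_deriv {ι : Type} [Fintype ι] {σ ε C τ : ℝ} (hσ : 0 < σ) (h : 0 < τ + ε) (c : ι → ℝ)
    (y : ℝ) : ∃ (gt gyy : ℝ) (gy : ℝ → ℝ), HasDerivAt (fun τ => gb σ ε C c τ y) gt τ ∧
      (∀ z, HasDerivAt (fun y => gb σ ε C c τ y) (gy z) z) ∧ HasDerivAt gy gyy y ∧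
      gt - σ ^ 2 / 2 * gyy = - (σ ^ 2 * ε) := by
  have hs : ∀ A z, HasDerivAt (fun y => y - c A) 1 z := fun A z => (hasDerivAt_id z).sub_const _
  have e1 := ((HasDerivAt.fun_sum (u := Finset.univ) (fun A _ => bar_t hσ h (y - c A))).const_mul
    (2 * C)).add_const (ε * y ^ 2)
  have e2 := fun z => ((HasDerivAt.fun_sum (u := Finset.univ) (fun A _ =>
    (bar_y hσ h (z - c A)).comp z (hs A z))).const_mul (2 * C)).add
    (((hasDerivAt_id z).fun_pow 2).const_mul ε)
  have e3 := ((HasDerivAt.fun_sum (u := Finset.univ) (fun A _ =>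
    ((bar_yy hσ h (y - c A)).comp y (hs A y)).mul_const 1)).const_mul (2 * C)).add
    ((((hasDerivAt_id y).const_mul 2)).const_mul ε)
  refine ⟨_, _, _, e1, fun z => (e2 z).congr_deriv ?_, e3, ?_⟩
  · simp
  · simp only [bar_heat hσ h]
    simp only [mul_one]
    rw [← Finset.mul_sum]
    ring

theorem gb_cont {ι : Type} [Fintype ι] {σ ε C τ : ℝ} (hσ : 0 < σ) (h : 0 < τ + ε) (c : ι → ℝ)
    (y : ℝ) : ContinuousAt (fun p : ℝ × ℝ => gb σ ε C c p.1 p.2) (τ, y) := by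
  unfold gb
  refine ContinuousAt.add (ContinuousAt.mul continuousAt_const ?_) (by fun_prop)
  refine tendsto_finsetSum _ fun A _ => ?_
  have := bar_cont (σ := σ) (ε := ε) hσ h (y - c A)
  exact ContinuousAt.comp (f := fun p : ℝ × ℝ => (p.1, p.2 - c A)) (x := (τ, y)) this (by fun_prop)

theorem gb_ge {ι : Type} [Fintype ι] {σ ε C τ : ℝ} (hC : 0 < C) (c : ι → ℝ) (y : ℝ) :
    ε * y ^ 2 ≤ gb σ ε C c τ y := by
  unfold gb
  have : 0 ≤ ∑ A, bar σ ε τ (y - c A) := Finset.sum_nonneg fun A _ => bar_pos.le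
  nlinarith [mul_nonneg hC.le this]

theorem gb_ge' {ι : Type} [Fintype ι] {σ ε C τ : ℝ} (hε : 0 < ε) (hC : 0 < C) (c : ι → ℝ) (y : ℝ)
    (A : ι) : 2 * C * bar σ ε τ (y - c A) ≤ gb σ ε C c τ y := by
  unfold gb
  have : bar σ ε τ (y - c A) ≤ ∑ A, bar σ ε τ (y - c A) :=
    Finset.single_le_sum (f := fun A => bar σ ε τ (y - c A)) (fun A _ => bar_pos.le)
      (Finset.mem_univ A)
  nlinarith [mul_nonneg hε.le (sq_nonneg y), mul_le_mul_of_nonneg_left this hC.le]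

theorem sum_update {N : ℕ} (g : Fin N → ℝ → ℝ) (x : Fin N → ℝ) (j : Fin N) (y : ℝ) :
    ∑ i, g i (Function.update x j y i) = g j y + ∑ i ∈ Finset.univ.erase j, g i (x i) := by
  rw [← Finset.add_sum_erase _ _ (Finset.mem_univ j), Function.update_self]
  congr 1
  refine Finset.sum_congr rfl fun i hi => ?_
  rw [Function.update_of_ne (Finset.ne_of_mem_erase hi)]

theorem compar {N : ℕ} {T σ : ℝ} (hσ : 0 < σ) (c : Fin N → Finset (Fin N) → ℝ)
    {f : ℝ → (Fin N → ℝ) → ℝ} {U : Set (ℝ × (Fin N → ℝ))}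
    (hU : ∃ U' : Set (ℝ × (Fin N → ℝ)), IsOpen U' ∧
      U = U' ∩ {p : ℝ × (Fin N → ℝ) | p.1 ∈ Set.Ico 0 T})
    (hs : SolvesHeatOn N T σ Finset.univ f U) {C : ℝ} (hC : 0 < C)
    (hb : ∀ t ∈ Ico 0 T, ∀ x, f t x ≤ C)
    (hc : ContinuousOn (fun p : ℝ × (Fin N → ℝ) => f p.1 p.2) {p | p.1 ∈ Ico 0 T})
    (h0 : ∀ t ∈ Ico 0 T, ∀ x, (t, x) ∉ U → f t x ≤ 0)
    (hini : ∀ x : Fin N → ℝ, (∀ i A, x i ≠ c i A) → ∀ ε > 0,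
      ∀ᶠ p : ℝ × (Fin N → ℝ) in 𝓝 (T, x), p.1 ∈ Ico 0 T → f p.1 p.2 < ε) :
    ∀ t ∈ Ico 0 T, ∀ x, f t x ≤ 0 := by
  have key : ∀ ε > 0, ∀ t ∈ Ico 0 T, ∀ x,
      f t x - (∑ i, gb σ ε C (c i) (T - t) (x i) + ε * ((N * σ ^ 2 + 1) * (T - t) + 1)) ≤ 0 := by
    intro ε hε
    have hG0 : ∀ t ∈ Ico 0 T, ∀ x : Fin N → ℝ, ε ≤ ε * ((N * σ ^ 2 + 1) * (T - t) + 1) := by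
      intro t ht x
      have : 0 ≤ (N * σ ^ 2 + 1) * (T - t) := mul_nonneg (by positivity) (by linarith [ht.2])
      nlinarith
    have hgnn : ∀ (i : Fin N) τ y, 0 ≤ gb σ ε C (c i) τ y := fun i τ y =>
      le_trans (by positivity) (gb_ge hC (c i) y)
    have hsg : ∀ (i : Fin N) τ (x : Fin N → ℝ),
        gb σ ε C (c i) τ (x i) ≤ ∑ i, gb σ ε C (c i) τ (x i) := fun i τ x =>
      Finset.single_le_sum (f := fun i => gb σ ε C (c i) τ (x i)) (fun i _ => hgnn i _ _)
        (Finset.mem_univ i)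
    obtain ⟨U', hU', hUe⟩ := hU
    obtain ⟨ft, fx, fxx, d1, d2, d3, -, -, -, d7⟩ := hs
    refine maxp (σ := σ) ?_ (√(C / ε)) ?_ ?_ ?_
    · refine ContinuousOn.sub hc fun p hp => ContinuousAt.continuousWithinAt ?_
      have hT : 0 < T - p.1 + ε := by linarith [hp.2]
      refine ContinuousAt.add (tendsto_finsetSum _ fun i _ => ?_) (by fun_prop)
      exact ContinuousAt.comp (f := fun p : ℝ × (Fin N → ℝ) => (T - p.1, p.2 i))
        (gb_cont hσ hT (c i) (p.2 i)) (by fun_prop)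
    · intro t ht x hx
      rw [mem_closedBall_zero_iff, pi_norm_le_iff_of_nonneg (Real.sqrt_nonneg _)] at hx
      push Not at hx
      obtain ⟨i, hi⟩ := hx
      have h1 := Real.lt_sq_of_sqrt_lt hi
      rw [Real.norm_eq_abs, sq_abs, div_lt_iff₀ hε] at h1
      have h2 := gb_ge (σ := σ) (ε := ε) (τ := T - t) hC (c i) (x i)
      linarith [hb t ht x, hG0 t ht x, hsg i (T - t) x]
    · intro x
      by_cases hx : ∀ i A, x i ≠ c i A
      · filter_upwards [hini x hx ε hε] with p hp hpI
        linarith [hp hpI, hG0 p.1 hpI p.2,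
          Finset.sum_nonneg fun i (_ : i ∈ Finset.univ) => hgnn i (T - p.1) (p.2 i)]
      · push Not at hx
        obtain ⟨i, A, hiA⟩ := hx
        have hcc : ContinuousAt (fun p : ℝ × (Fin N → ℝ) => bar σ ε (T - p.1) (p.2 i - c i A))
            (T, x) := by
          have h1 := bar_cont (σ := σ) (ε := ε) (τ := T - T) hσ (by linarith) (x i - c i A)
          exact ContinuousAt.comp (f := fun p : ℝ × (Fin N → ℝ) => (T - p.1, p.2 i - c i A))
            (x := (T, x)) h1 (by fun_prop)
        have h2 := hcc.eventually (lt_mem_nhds (show 1 / 2 < _ by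
          simp only [hiA, sub_self, bar_zero]; norm_num))
        filter_upwards [h2] with p hp hpI
        have h3 := gb_ge' (σ := σ) (τ := T - p.1) hε hC (c i) (p.2 i) A
        nlinarith [hb p.1 hpI p.2, hG0 p.1 hpI p.2, hsg i (T - p.1) p.2]
    · intro t ht x hpos
      have hT : 0 < T - t + ε := by linarith [ht.2]
      have hfp : 0 < f t x := by
        linarith [hG0 t ht x,
          Finset.sum_nonneg fun i (_ : i ∈ Finset.univ) => hgnn i (T - t) (x i)]
      have hxU : (t, x) ∈ U := by
        by_contra h
        exact absurd (h0 t ht x h) (not_le.2 hfp)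
      choose gt gyy gy g1 g2 g3 g4 using fun i => gb_deriv (C := C) hσ hT (c i) (x i)
      refine ⟨ft t x - (∑ i, gt i * (-1) + ε * ((N * σ ^ 2 + 1) * (-1))),
        fun j y => fx t (Function.update x j y) j - gy j y,
        fun j => fxx t x j - gyy j, ?_, ?_, ?_⟩
      · have e0 : HasDerivAt (fun s => T - s) (-1) t := (hasDerivAt_id t).const_sub T
        have e1 : HasDerivAt (fun s => ∑ i, gb σ ε C (c i) (T - s) (x i)) (∑ i, gt i * (-1)) t :=
          HasDerivAt.fun_sum fun i _ => (g1 i).comp t e0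
        have e2 : HasDerivAt (fun s => ε * ((N * σ ^ 2 + 1) * (T - s) + 1))
            (ε * ((N * σ ^ 2 + 1) * (-1))) t :=
          ((e0.const_mul (N * σ ^ 2 + 1)).add_const 1).const_mul ε
        exact (d1 (t, x) hxU).fun_sub (e1.fun_add e2).hasDerivWithinAt
      · intro j
        constructor
        · have hev : ∀ᶠ y in 𝓝 (x j), (t, Function.update x j y) ∈ U := by
            have hcu : ContinuousAt (fun y => ((t, Function.update x j y) : ℝ × (Fin N → ℝ)))
                (x j) := by
              have : Continuous (fun y => ((t, Function.update x j y) : ℝ × (Fin N → ℝ))) :=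
                continuous_const.prodMk (continuous_const.update j continuous_id)
              exact this.continuousAt
            have hmem : U' ∈ 𝓝 ((t, Function.update x j (x j)) : ℝ × (Fin N → ℝ)) := by
              rw [Function.update_eq_self]
              rw [hUe] at hxU
              exact hU'.mem_nhds hxU.1
            filter_upwards [hcu hmem] with y hy
            rw [hUe]
            exact ⟨hy, ht⟩
          filter_upwards [hev] with y hy
          have e1 := d2 _ hy j (Finset.mem_univ j)
          simp only [Function.update_idem, Function.update_self] at e1
          have e2 := (((g2 j y).add_const
            (∑ i ∈ Finset.univ.erase j, gb σ ε C (c i) (T - t) (x i))).add_const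
              (ε * ((N * σ ^ 2 + 1) * (T - t) + 1)))
          refine (e1.fun_sub e2).congr_of_eventuallyEq (Filter.Eventually.of_forall fun z => ?_)
          simp only
          rw [sum_update (fun i y => gb σ ε C (c i) (T - t) y) x j z]
        · exact (d3 _ hxU j (Finset.mem_univ j)).fun_sub (g3 j)
      · have e7 := d7 _ hxU
        simp only at e7
        have e8 : ∑ i, (gt i - σ ^ 2 / 2 * gyy i) = - (N * (σ ^ 2 * ε)) := by
          rw [Finset.sum_congr rfl fun i _ => g4 i]; simp
        rw [Finset.sum_sub_distrib, ← Finset.mul_sum] at e8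
        rw [Finset.sum_sub_distrib, ← Finset.sum_mul]
        have : ft t x - ((∑ i, gt i) * -1 + ε * ((N * σ ^ 2 + 1) * -1)) +
            σ ^ 2 / 2 * (∑ i, fxx t x i - ∑ i, gyy i) = ε := by linear_combination e7 + e8
        rw [this]; exact hε
  intro t ht x
  have hτ : 0 < T - t := by linarith [ht.2]
  set E : ℝ → ℝ := fun ε => (∑ i : Fin N, (2 * C * (∑ _A : Finset (Fin N),
    Real.exp (Real.log ε / 2 - Real.log (T - t) / 2)) + ε * (x i) ^ 2)) +
    ε * ((N * σ ^ 2 + 1) * (T - t) + 1) with hE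
  have hle : ∀ ε > 0, f t x ≤ E ε := by
    intro ε hε
    have h1 := key ε hε t ht x
    have h2 : ∑ i, gb σ ε C (c i) (T - t) (x i) ≤ ∑ i : Fin N, (2 * C * (∑ _A : Finset (Fin N),
        Real.exp (Real.log ε / 2 - Real.log (T - t) / 2)) + ε * (x i) ^ 2) := by
      refine Finset.sum_le_sum fun i _ => ?_
      unfold gb
      have : ∑ A, bar σ ε (T - t) (x i - c i A) ≤ ∑ _A : Finset (Fin N),
        Real.exp (Real.log ε / 2 - Real.log (T - t) / 2) :=
        Finset.sum_le_sum fun A _ => bar_le hτ hε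
      nlinarith [mul_le_mul_of_nonneg_left this hC.le]
    simp only [hE]
    linarith
  have hexp : Tendsto (fun ε => Real.exp (Real.log ε / 2 - Real.log (T - t) / 2)) (𝓝[>] 0)
      (𝓝 0) := by
    refine Real.tendsto_exp_atBot.comp ?_
    have h1 : Tendsto (fun ε => Real.log ε / 2) (𝓝[>] 0) atBot :=
      Real.tendsto_log_nhdsGT_zero.atBot_div_const (by norm_num)
    exact tendsto_atBot_add_const_right _ (-(Real.log (T - t) / 2)) h1
  have hid : Tendsto (fun ε : ℝ => ε) (𝓝[>] 0) (𝓝 0) := nhdsWithin_le_nhds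
  have hlim : Tendsto E (𝓝[>] 0) (𝓝 ((∑ i : Fin N, (2 * C * (∑ _A : Finset (Fin N), (0:ℝ))
      + 0 * (x i) ^ 2)) + 0 * ((N * σ ^ 2 + 1) * (T - t) + 1))) := by
    refine Tendsto.add (tendsto_finsetSum _ fun i _ => Tendsto.add ?_ (hid.mul_const _))
      (hid.mul_const _)
    exact (tendsto_finsetSum _ fun A _ => hexp).const_mul _
  simp only [Finset.sum_const_zero, mul_zero, zero_mul, add_zero] at hlim
  refine ge_of_tendsto hlim ?_
  filter_upwards [self_mem_nhdsWithin] with ε hε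
  exact hle ε hε

end Casc

open Set Filter
open scoped Topology

namespace Casc
open MeasureTheory ProbabilityTheory

theorem heat_univ {N : ℕ} {T σ : ℝ} {I : Finset (Fin N)} {f : ℝ → (Fin N → ℝ) → ℝ}
    {U : Set (ℝ × (Fin N → ℝ))} (h : SolvesHeatOn N T σ I f U)
    (hU : ∀ p ∈ U, p.1 ∈ Icc 0 T)
    (hf : ∀ t ∈ Icc (0:ℝ) T, ∀ x y : Fin N → ℝ, (∀ j ∈ I, x j = y j) → f t x = f t y) :
    SolvesHeatOn N T σ Finset.univ f U := by
  obtain ⟨ft, fx, fxx, d1, d2, d3, d4, d5, d6, d7⟩ := h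
  refine ⟨ft, fun t x j => if j ∈ I then fx t x j else 0,
    fun t x j => if j ∈ I then fxx t x j else 0, d1, ?_, ?_, d4, ?_, ?_, ?_⟩
  · intro p hp j _
    by_cases hj : j ∈ I
    · simpa [hj] using d2 p hp j hj
    · simp only [hj, if_false]
      have : (fun y => f p.1 (Function.update p.2 j y)) = fun _ => f p.1 p.2 := by
        funext y
        refine hf p.1 (hU p hp) _ _ fun l hl => ?_
        have hlj : l ≠ j := fun h => hj (h ▸ hl)
        rw [Function.update_of_ne hlj]
      rw [this]
      exact hasDerivAt_const _ _
  · intro p hp j _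
    by_cases hj : j ∈ I
    · simpa [hj] using d3 p hp j hj
    · simp only [hj, if_false]
      exact hasDerivAt_const _ _
  · intro j _
    by_cases hj : j ∈ I
    · simpa [hj] using d5 j hj
    · simp only [hj, if_false]
      exact continuousOn_const
  · intro j _
    by_cases hj : j ∈ I
    · simpa [hj] using d6 j hj
    · simp only [hj, if_false]
      exact continuousOn_const
  · intro p hp
    rw [Finset.sum_ite_mem, Finset.univ_inter]
    exact d7 p hp

theorem heat_sub {N : ℕ} {T σ : ℝ} {I : Finset (Fin N)} {f g : ℝ → (Fin N → ℝ) → ℝ}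
    {U : Set (ℝ × (Fin N → ℝ))} (hf : SolvesHeatOn N T σ I f U) (hg : SolvesHeatOn N T σ I g U) :
    SolvesHeatOn N T σ I (fun t x => f t x - g t x) U := by
  obtain ⟨ft, fx, fxx, d1, d2, d3, d4, d5, d6, d7⟩ := hf
  obtain ⟨gt, gx, gxx, e1, e2, e3, e4, e5, e6, e7⟩ := hg
  refine ⟨fun t x => ft t x - gt t x, fun t x j => fx t x j - gx t x j,
    fun t x j => fxx t x j - gxx t x j, fun p hp => (d1 p hp).fun_sub (e1 p hp),
    fun p hp j hj => (d2 p hp j hj).fun_sub (e2 p hp j hj),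
    fun p hp j hj => (d3 p hp j hj).fun_sub (e3 p hp j hj), d4.sub e4,
    fun j hj => (d5 j hj).sub (e5 j hj), fun j hj => (d6 j hj).sub (e6 j hj), fun p hp => ?_⟩
  rw [Finset.sum_sub_distrib]
  linear_combination d7 p hp - e7 p hp

theorem cas_loc {N : ℕ} {σ : ℝ} {D : Fin N → Fin N → ℝ} (hσ : 0 < σ) (hD : ∀ i j, 0 ≤ D i j)
    {x : Fin N → ℝ} (hx : ∀ i (A : Finset (Fin N)), x i ≠ ∑ j ∈ A, D i j) (J : Finset (Fin N)) :
    ∃ A : Finset (Fin N), ∀ᶠ y in 𝓝 x, ∀ j, cas σ D J j 0 y = if j ∈ A then 1 else 0 := by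
  induction J using Finset.strongInduction with
  | H J ih =>
    have HJ := inv_cas (N := N) hσ hD J
    choose! A hA using ih
    have hk : ∀ k ∈ J, ∀ᶠ y in 𝓝 x, ∑ j, D k j * cas σ D (J.erase k) j 0 y =
        ∑ j ∈ A (J.erase k), D k j := by
      intro k hk
      filter_upwards [hA _ (Finset.erase_ssubset hk)] with y hy
      simp [hy]
    have hxk : ∀ k, Continuous fun y : Fin N → ℝ => y k := fun k => continuous_apply k
    by_cases hex : ∃ k ∈ J, x k < ∑ j ∈ A (J.erase k), D k j
    · obtain ⟨k, hkJ, hlt⟩ := hex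
      refine ⟨A (J.erase k), ?_⟩
      filter_upwards [hA _ (Finset.erase_ssubset hkJ), hk k hkJ,
        (hxk k).continuousAt.eventually (gt_mem_nhds hlt)] with y h1 h2 h3 j
      rw [HJ.kill k hkJ 0 le_rfl y (by rw [h2]; exact h3.le) j, h1 j]
    · push Not at hex
      refine ⟨Jᶜ, ?_⟩
      have hall : ∀ᶠ y in 𝓝 x, ∀ k ∈ J, ∑ j, D k j * cas σ D (J.erase k) j 0 y < y k := by
        rw [Filter.eventually_all_finset]
        intro k hkJ
        have hlt := lt_of_le_of_ne (hex k hkJ) (hx k _).symm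
        filter_upwards [hk k hkJ, (hxk k).continuousAt.eventually (lt_mem_nhds hlt)] with y h2 h3
        rw [h2]; exact h3
      filter_upwards [hall] with y hy j
      by_cases hj : j ∈ J
      · rw [HJ.zero j hj y]
        · simp [hj]
        · rintro ⟨k, hkJ, hle⟩
          exact absurd (hy k hkJ) (not_lt.2 hle)
      · rw [HJ.one j hj]; simp [hj]

theorem kset_loc {N : ℕ} {σ : ℝ} {D : Fin N → Fin N → ℝ} (hσ : 0 < σ) (hD : ∀ i j, 0 ≤ D i j)
    {x : Fin N → ℝ} (hx : ∀ i (A : Finset (Fin N)), x i ≠ ∑ j ∈ A, D i j) (J : Finset (Fin N)) :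
    (∀ᶠ y in 𝓝 x, y ∈ kset D (cas σ D) J 0) ∨ (∀ᶠ y in 𝓝 x, y ∉ kset D (cas σ D) J 0) := by
  choose A hA using cas_loc hσ hD hx
  have hk : ∀ k, ∀ᶠ y in 𝓝 x, ∑ j, D k j * cas σ D (J.erase k) j 0 y =
      ∑ j ∈ A (J.erase k), D k j := by
    intro k
    filter_upwards [hA (J.erase k)] with y hy
    simp [hy]
  have hxk : ∀ k, Continuous fun y : Fin N → ℝ => y k := fun k => continuous_apply k
  by_cases hex : ∃ k ∈ J, x k < ∑ j ∈ A (J.erase k), D k j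
  · left
    obtain ⟨k, hkJ, hlt⟩ := hex
    filter_upwards [hk k, (hxk k).continuousAt.eventually (gt_mem_nhds hlt)] with y h2 h3
    exact ⟨k, hkJ, by rw [h2]; exact h3.le⟩
  · right
    push Not at hex
    have hall : ∀ᶠ y in 𝓝 x, ∀ k ∈ J, ∑ j, D k j * cas σ D (J.erase k) j 0 y < y k := by
      rw [Filter.eventually_all_finset]
      intro k hkJ
      have hlt := lt_of_le_of_ne (hex k hkJ) (hx k _).symm
      filter_upwards [hk k, (hxk k).continuousAt.eventually (lt_mem_nhds hlt)] with y h2 h3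
      rw [h2]; exact h3
    filter_upwards [hall] with y hy
    rintro ⟨k, hkJ, hle⟩
    exact absurd (hy k hkJ) (not_lt.2 hle)

/-- small values near the terminal time -/
theorem init_small {N : ℕ} {T σ : ℝ} {D : Fin N → Fin N → ℝ}
    {v : Finset (Fin N) → Fin N → ℝ → (Fin N → ℝ) → ℝ} (hv : IsClassicalSolution N T σ D v)
    {I : Finset (Fin N)} {i : Fin N} (hi : i ∈ I) {x : Fin N → ℝ}
    (hx : ∀ᶠ y in 𝓝 x, (T, y) ∈ domT N T D v I) {ε : ℝ} (hε : 0 < ε) :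
    ∀ᶠ p : ℝ × (Fin N → ℝ) in 𝓝 (T, x), p.1 ∈ Ico 0 T → |v I i p.1 p.2| < ε := by
  obtain ⟨-, -, h3⟩ := hv I
  obtain ⟨-, -, ⟨C, hC⟩, -, -, h0, hK⟩ := h3 i hi
  obtain ⟨r, hr, hb⟩ := Metric.mem_nhds_iff.1 hx
  have hsub : {T} ×ˢ Metric.closedBall x (r / 2) ⊆ domT N T D v I := by
    rintro ⟨t, y⟩ ⟨rfl, hy⟩
    exact hb (Metric.closedBall_subset_ball (half_lt_self hr) hy)
  have ht := hK _ (isCompact_closedBall x (r / 2)) hsub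
  have h1 : ∀ᶠ t in 𝓝 T, t < T → sSup ((fun y => |v I i t y - v I i T y|) ''
      Metric.closedBall x (r / 2)) < ε :=
    eventually_nhdsWithin_iff.1 (ht.eventually (gt_mem_nhds hε))
  have h2 : ∀ᶠ p : ℝ × (Fin N → ℝ) in 𝓝 (T, x), p.2 ∈ Metric.closedBall x (r / 2) :=
    continuous_snd.continuousAt.eventually (Metric.closedBall_mem_nhds x (half_pos hr))
  filter_upwards [continuous_fst.continuousAt.eventually h1, h2] with p hp1 hp2 hpI
  have hz : ∀ y ∈ Metric.closedBall x (r / 2), v I i T y = 0 := fun y hy => h0 y (hsub ⟨rfl, hy⟩)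
  refine lt_of_le_of_lt ?_ (hp1 hpI.2)
  have hbd : BddAbove ((fun y => |v I i p.1 y - v I i T y|) '' Metric.closedBall x (r / 2)) := by
    refine ⟨C, ?_⟩
    rintro _ ⟨y, hy, rfl⟩
    simp only [hz y hy, sub_zero]
    exact hC p.1 hpI y
  have := le_csSup hbd ⟨p.2, hp2, rfl⟩
  simp only [hz p.2 hp2, sub_zero] at this
  simpa [hz p.2 hp2] using this

theorem kset_mono_t {N : ℕ} {σ : ℝ} {D : Fin N → Fin N → ℝ} (hσ : 0 < σ) (hD : ∀ i j, 0 ≤ D i j)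
    {I : Finset (Fin N)} {τ : ℝ} (hτ : 0 ≤ τ) {x : Fin N → ℝ} (h : x ∈ kset D (cas σ D) I 0) :
    x ∈ kset D (cas σ D) I τ := by
  obtain ⟨k, hk, hle⟩ := h
  exact ⟨k, hk, hle.trans (sumD_mono hD (fun j =>
    ((inv_cas hσ hD (I.erase k)).reg j).vt 0 τ le_rfl hτ x) k)⟩

/-- one sided comparison of two solutions sharing the domain of `sol` -/
theorem comp_two {N : ℕ} {T σ : ℝ} {D : Fin N → Fin N → ℝ} (hT : 0 < T) (hσ : 0 < σ)
    (hD : ∀ i j, 0 ≤ D i j)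
    {v w : Finset (Fin N) → Fin N → ℝ → (Fin N → ℝ) → ℝ} (hv : IsClassicalSolution N T σ D v)
    (hw : IsClassicalSolution N T σ D w) {I : Finset (Fin N)} {i : Fin N} (hi : i ∈ I)
    (dv : domT N T D v I = domT N T D (sol T σ D) I)
    (dw : domT N T D w I = domT N T D (sol T σ D) I)
    (hoff : ∀ t ∈ Icc 0 T, ∀ x, (t, x) ∉ domT N T D (sol T σ D) I → w I i t x = v I i t x) :
    ∀ t ∈ Ico 0 T, ∀ x, w I i t x ≤ v I i t x := by
  have dv' : dom N T D v I = dom N T D (sol T σ D) I := by simp only [dom, dv]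
  have dw' : dom N T D w I = dom N T D (sol T σ D) I := by simp only [dom, dw]
  obtain ⟨v1, -, v3⟩ := hv I
  obtain ⟨w1, -, w3⟩ := hw I
  obtain ⟨v4, v5, ⟨C1, v6⟩, v7, -, -, -⟩ := v3 i hi
  obtain ⟨-, w5, ⟨C2, w6⟩, w7, -, -, -⟩ := w3 i hi
  rw [dv'] at v4 v5
  rw [dw'] at w5
  have hUI : ∀ p ∈ dom N T D (sol T σ D) I, p.1 ∈ Icc 0 T := fun p hp => hp.1.1
  have hheat := heat_sub (heat_univ w5 hUI (w1 i)) (heat_univ v5 hUI (v1 i))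
  have hoff' : ∀ t ∈ Ico 0 T, ∀ x, x ∈ kset D (cas σ D) I (T - t) → w I i t x = v I i t x :=
    fun t ht x hx => hoff t ⟨ht.1, ht.2.le⟩ x fun h => (mem_domT_sol.1 h).2 hx
  have key := compar (N := N) (T := T) hσ (fun i A => ∑ j ∈ A, D i j) v4 hheat
    (C := |C1| + |C2| + 1) (by positivity) ?_ ?_ ?_ ?_
  · intro t ht x
    linarith [key t ht x]
  · intro t ht x
    have h1 := abs_le.1 (v6 t ht x)
    have h2 := abs_le.1 (w6 t ht x)
    linarith [le_abs_self C1, le_abs_self C2]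
  · exact w7.sub v7
  · intro t ht x hx
    rw [hoff' t ht x, sub_self]
    by_contra h
    exact hx (mem_dom_sol.2 ⟨ht, h⟩)
  · intro x hx ε hε
    rcases kset_loc hσ hD hx I with h | h
    · filter_upwards [continuous_snd.continuousAt.eventually h] with p hp hpI
      rw [hoff' p.1 hpI p.2 (kset_mono_t hσ hD (by linarith [hpI.2]) hp), sub_self]
      exact hε
    · have hd : ∀ᶠ y in 𝓝 x, (T, y) ∈ domT N T D (sol T σ D) I := by
        filter_upwards [h] with y hy
        exact mem_domT_sol.2 ⟨⟨hT.le, le_rfl⟩, by rwa [sub_self]⟩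
      filter_upwards [init_small hv hi (by rw [dv]; exact hd) (half_pos hε),
        init_small hw hi (by rw [dw]; exact hd) (half_pos hε)] with p h1 h2 hpI
      linarith [(abs_lt.1 (h1 hpI)).1, (abs_lt.1 (h2 hpI)).2]

theorem uniq {N : ℕ} {T σ : ℝ} {D : Fin N → Fin N → ℝ} (hT : 0 < T) (hσ : 0 < σ)
    (hD : ∀ i j, 0 ≤ D i j)
    {w : Finset (Fin N) → Fin N → ℝ → (Fin N → ℝ) → ℝ} (hw : IsClassicalSolution N T σ D w)
    (I : Finset (Fin N)) :
    ∀ i, ∀ t ∈ Icc (0:ℝ) T, ∀ x : Fin N → ℝ, w I i t x = sol T σ D I i t x := by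
  induction I using Finset.strongInduction with
  | H I ih =>
    have hv := classical_sol (N := N) hT hσ hD
    have hbs : ∀ k ∈ I, ∀ t ∈ Icc (0:ℝ) T, ∀ x, bdrySum N D w I k t x =
        bdrySum N D (sol T σ D) I k t x := by
      intro k hk t ht x
      refine Finset.sum_congr rfl fun j _ => ?_
      rw [ih _ (Finset.erase_ssubset hk) j t ht x]
    have hdom : domT N T D w I = domT N T D (sol T σ D) I := by
      ext p
      refine and_congr_right fun hp => forall₂_congr fun k hk => ?_
      rw [hbs k hk p.1 hp p.2]
    have hks : ∀ t ∈ Icc (0:ℝ) T, ∀ x, killedSet N D w I t x =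
        killedSet N D (sol T σ D) I t x := by
      intro t ht x
      refine Finset.filter_congr fun k hk => ?_
      rw [hbs k hk t ht x]
    intro i
    by_cases hi : i ∈ I
    · obtain ⟨-, -, -, -, v5, v6, -⟩ := (hv I).2.2 i hi
      obtain ⟨-, -, -, -, w5, w6, -⟩ := (hw I).2.2 i hi
      have hoff : ∀ t ∈ Icc 0 T, ∀ x, (t, x) ∉ domT N T D (sol T σ D) I →
          w I i t x = sol T σ D I i t x := by
        intro t ht x hx
        rw [v5 t ht x hx, w5 t ht x (by rwa [hdom])]
        have hne : (killedSet N D (sol T σ D) I t x).Nonempty := by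
          by_contra hne
          rw [Finset.not_nonempty_iff_eq_empty] at hne
          refine hx ⟨ht, fun k hk => ?_⟩
          by_contra hle
          have : k ∈ killedSet N D (sol T σ D) I t x := Finset.mem_filter.2 ⟨hk, not_lt.1 hle⟩
          rw [hne] at this
          simp at this
        simp only [bdryFun, hks t ht x]
        rw [dif_pos hne, dif_pos hne]
        have h2 := Finset.mem_filter.1 ((killedSet N D (sol T σ D) I t x).min'_mem hne)
        exact ih _ (Finset.erase_ssubset h2.1) i t ht x
      intro t ht x
      rcases ht.2.eq_or_lt with rfl | hlt
      · by_cases hx : (t, x) ∈ domT N t D (sol t σ D) I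
        · rw [v6 x hx, w6 x (by rwa [hdom])]
        · exact hoff t ht x hx
      · refine le_antisymm ?_ ?_
        · exact comp_two hT hσ hD hv hw hi rfl hdom hoff t ⟨ht.1, hlt⟩ x
        · exact comp_two hT hσ hD hw hv hi hdom rfl
            (fun t ht x hx => (hoff t ht x hx).symm) t ⟨ht.1, hlt⟩ x
    · intro t ht x
      rw [(hw I).2.1 i hi t ht x, (hv I).2.1 i hi t ht x]

end Casc

/-- existence and uniqueness of a classical solution of the cascade of moving
boundary PDEs; the solution is nonincreasing and takes values in `[0,1]`. -/
theorem existsUnique_classicalSolution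
    (hT : 0 < T) (hσ : 0 < σ) (hD : ∀ i j, 0 ≤ D i j) :
    ∃ v : Finset (Fin N) → Fin N → ℝ → (Fin N → ℝ) → ℝ,
      IsClassicalSolution N T σ D v ∧
      IsNonincreasingSol N T v ∧
      (∀ I : Finset (Fin N), ∀ i ∈ I, ∀ t ∈ Set.Icc (0 : ℝ) T, ∀ x : Fin N → ℝ,
        v I i t x ∈ Set.Icc (0 : ℝ) 1) ∧
      (∀ w : Finset (Fin N) → Fin N → ℝ → (Fin N → ℝ) → ℝ,
        IsClassicalSolution N T σ D w →
        ∀ I : Finset (Fin N), ∀ i : Fin N, ∀ t ∈ Set.Icc (0 : ℝ) T, ∀ x : Fin N → ℝ,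
          w I i t x = v I i t x) := by
  refine ⟨Casc.sol T σ D, Casc.classical_sol hT hσ hD, Casc.noninc_sol hσ hD,
    fun I i _ t ht x => Casc.sol_mem hσ hD I i ht x,
    fun w hw I i t ht x => Casc.uniq hT hσ hD hw I i t ht x⟩
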